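/- arXiv:2510.18397 — 3 statements merged into one kernel-verified Lean document; each statement's English description precedes it below -/
import Mathlib

section
/- Let q be an odd prime power and n ≥ 2 an integer. If SL_n(𝔽_q) contains a picky 2-element, then one of the following holds: q = 3; or n = 2; or n ∈ {3, 5} and q ≡ 3 (mod 4). -/
section GroupTheory

variable {G : Type*} [Group G] {p : ℕ}

/-- Two elements lie in a common `2`-subgroup. -/
def InCommonTwoSubgroup (x a : G) : Prop :=
  ∃ H : Subgroup G, IsPGroup 2 H ∧ x ∈ H ∧ a ∈ H

theorem isPGroup_zpowers_of_pow_eq_one {g : G} {k : ℕ} (hg : g ^ p ^ k = 1) :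
    IsPGroup p (Subgroup.zpowers g) :=
  .of_card_dvd_pow (n := k) (by rw [Nat.card_zpowers]; exact orderOf_dvd_of_pow_eq_one hg)

theorem IsPGroup.subgroupProd {G' : Type*} [Group G'] {H : Subgroup G} {K : Subgroup G'}
    (hH : IsPGroup p H) (hK : IsPGroup p K) : IsPGroup p (H.prod K) := by
  rintro ⟨⟨g, g'⟩, hg, hg'⟩
  obtain ⟨k, hk⟩ := hH ⟨g, hg⟩
  obtain ⟨l, hl⟩ := hK ⟨g', hg'⟩
  rw [Subtype.ext_iff] at hk hl
  refine ⟨k + l, Subtype.ext (Prod.ext ?_ ?_)⟩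
  · simpa [pow_add, pow_mul] using congrArg (· ^ p ^ l) hk
  · simpa [pow_add, pow_mul, mul_comm (p ^ k)] using congrArg (· ^ p ^ k) hl

theorem mem_normalizer_of_conj_mem [Finite G] {K : Subgroup G} {a : G}
    (h : ∀ g ∈ K, a * g * a⁻¹ ∈ K) : a ∈ Subgroup.normalizer (K : Set G) := by
  have hle : K.map (MulAut.conj a).toMonoidHom ≤ K := by
    rintro _ ⟨g, hg, rfl⟩
    exact h g hg
  have heq : K.map (MulAut.conj a).toMonoidHom = K :=
    Subgroup.eq_of_le_of_card_ge hle
      (Subgroup.card_map_of_injective (MulAut.conj a).injective).ge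
  refine Subgroup.mem_normalizer_iff.2 fun g => ⟨h g, fun hg => ?_⟩
  rw [← heq] at hg
  obtain ⟨g', hg', he⟩ := hg
  have : g' = g := (MulAut.conj a).injective he
  exact this ▸ hg'

/-- A `2`-element normalising a `2`-subgroup containing `x` lies in a common `2`-subgroup
with `x`. -/
theorem inCommonTwoSubgroup_of_conj_mem [Finite G] {K : Subgroup G} (hK : IsPGroup 2 K)
    {x a : G} (hx : x ∈ K) {k : ℕ} (ha : a ^ 2 ^ k = 1) (h : ∀ g ∈ K, a * g * a⁻¹ ∈ K) :
    InCommonTwoSubgroup x a :=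
  ⟨Subgroup.zpowers a ⊔ K,
    (isPGroup_zpowers_of_pow_eq_one ha).to_sup_of_normal_right' hK
      (by rw [Subgroup.zpowers_le]; exact mem_normalizer_of_conj_mem h),
    Subgroup.mem_sup_right hx, Subgroup.mem_sup_left (Subgroup.mem_zpowers a)⟩

theorem InCommonTwoSubgroup.map {G' : Type*} [Group G'] {x a : G}
    (h : InCommonTwoSubgroup x a) (f : G →* G') : InCommonTwoSubgroup (f x) (f a) := by
  obtain ⟨H, hH, hx, ha⟩ := h
  exact ⟨H.map f, hH.map f, Subgroup.mem_map_of_mem f hx, Subgroup.mem_map_of_mem f ha⟩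

theorem InCommonTwoSubgroup.of_map {G' : Type*} [Group G'] {x a : G} {f : G →* G'}
    (hf : Function.Injective f) (h : InCommonTwoSubgroup (f x) (f a)) :
    InCommonTwoSubgroup x a := by
  obtain ⟨H, hH, hx, ha⟩ := h
  exact ⟨H.comap f, hH.comap_of_injective f hf, hx, ha⟩

/-- If `x` is picky, then the `2`-elements lying in a common `2`-subgroup with `x` are closed
under products. -/
theorem exists_pow_mul_eq_one_of_picky {x a b : G} (hx : ∃! P : Sylow 2 G, x ∈ P)
    (ha : InCommonTwoSubgroup x a) (hb : InCommonTwoSubgroup x b) :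
    ∃ k, (a * b) ^ 2 ^ k = 1 := by
  obtain ⟨P, -, hP⟩ := hx
  have key : ∀ c, InCommonTwoSubgroup x c → c ∈ P := by
    rintro c ⟨H, hH, hxH, hcH⟩
    obtain ⟨Q, hQ⟩ := hH.exists_le_sylow
    exact hP Q (hQ hxH) ▸ hQ hcH
  obtain ⟨k, hk⟩ := P.isPGroup' ⟨a * b, mul_mem (key a ha) (key b hb)⟩
  exact ⟨k, by simpa [Subtype.ext_iff] using hk⟩

end GroupTheory

section LinearAlgebra

variable {F : Type*} [Field F]

/-- Witnesses, inside `SL(V)`, that `x` does not determine a Sylow `2`-subgroup. -/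
def HasObstruction {V : Type*} [AddCommGroup V] [Module F V] (x : V ≃ₗ[F] V) : Prop :=
  ∃ a b : V ≃ₗ[F] V, LinearEquiv.det a = 1 ∧ LinearEquiv.det b = 1 ∧
    InCommonTwoSubgroup x a ∧ InCommonTwoSubgroup x b ∧ ∀ k, (a * b) ^ 2 ^ k ≠ 1

theorem LinearEquiv.det_prodCongr {U W : Type*} [AddCommGroup U] [Module F U]
    [FiniteDimensional F U] [AddCommGroup W] [Module F W] [FiniteDimensional F W]
    (a : U ≃ₗ[F] U) (b : W ≃ₗ[F] W) :
    LinearEquiv.det (a.prodCongr b) = LinearEquiv.det a * LinearEquiv.det b := by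
  ext
  simpa using LinearMap.det_prodMap (a : U →ₗ[F] U) (b : W →ₗ[F] W)

/-- The action of `GL(U) × GL(W)` on a space isomorphic to `U × W`. -/
def prodAutHom {U W V : Type*} [AddCommGroup U] [Module F U]
    [AddCommGroup W] [Module F W] [AddCommGroup V] [Module F V] (e : (U × W) ≃ₗ[F] V) :
    (U ≃ₗ[F] U) × (W ≃ₗ[F] W) →* (V ≃ₗ[F] V) where
  toFun g := e.symm.trans ((g.1.prodCongr g.2).trans e)
  map_one' := by ext v; simp
  map_mul' g h := by ext v; simp

theorem pow_eq_one_of_intertwines {U V : Type*} [AddCommGroup U] [Module F U]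
    [AddCommGroup V] [Module F V] {x : U ≃ₗ[F] U} {y : V ≃ₗ[F] V} (f : U →ₗ[F] V)
    (hf : Function.Injective f) (hxy : ∀ u, f (x u) = y (f u)) {k : ℕ} (hy : y ^ k = 1) :
    x ^ k = 1 := by
  have h : ∀ (n : ℕ) (u : U), f ((x ^ n) u) = (y ^ n) (f u) := by
    intro n
    induction n with
    | zero => simp
    | succ n ih => intro u; simp [pow_succ, ih, hxy]
  ext u
  exact hf (by simp [h, hy])

/-- The automorphism induced on an invariant subspace. -/
noncomputable def restrictAut {V : Type*} [AddCommGroup V] [Module F V]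
    [FiniteDimensional F V] (x : V ≃ₗ[F] V) (S : Submodule F V) (hS : ∀ v ∈ S, x v ∈ S) :
    S ≃ₗ[F] S :=
  .ofInjectiveEndo ((x : V →ₗ[F] V).restrict hS)
    fun _ _ h => Subtype.ext (x.injective (congrArg Subtype.val h))

theorem coe_restrictAut {V : Type*} [AddCommGroup V] [Module F V]
    [FiniteDimensional F V] (x : V ≃ₗ[F] V) (S : Submodule F V) (hS : ∀ v ∈ S, x v ∈ S) (v : S) :
    (restrictAut x S hS v : V) = x v := rfl

theorem restrictAut_pow_eq_one {V : Type*} [AddCommGroup V] [Module F V]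
    [FiniteDimensional F V] {x : V ≃ₗ[F] V} {S : Submodule F V} (hS : ∀ v ∈ S, x v ∈ S)
    {k : ℕ} (hx : x ^ k = 1) : restrictAut x S hS ^ k = 1 :=
  pow_eq_one_of_intertwines S.subtype S.injective_subtype (fun _ => rfl) hx

theorem isSemisimple_of_pow_eq_one (h2 : (2 : F) ≠ 0) {V : Type*} [AddCommGroup V] [Module F V]
    [FiniteDimensional F V] {x : V ≃ₗ[F] V} {k : ℕ} (hx : x ^ 2 ^ k = 1) :
    Module.End.IsSemisimple (x : V →ₗ[F] V) := by
  refine Module.End.isSemisimple_of_squarefree_aeval_eq_zero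
    (p := Polynomial.X ^ 2 ^ k - 1) ?_ ?_
  · exact (Polynomial.X_pow_sub_one_separable_iff.2
      (by simpa using fun h => absurd h h2)).squarefree
  · have : ∀ n : ℕ, ((x ^ n : V ≃ₗ[F] V) : V →ₗ[F] V) = (x : Module.End F V) ^ n := by
      intro n
      induction n with
      | zero => rfl
      | succ n ih => rw [pow_succ, pow_succ, ← ih]; rfl
    rw [map_sub, map_pow, Polynomial.aeval_X, map_one, ← this, hx]
    exact sub_self _

/-- An obstruction on a subrepresentation extends to the whole space. -/
theorem HasObstruction.of_injective (h2 : (2 : F) ≠ 0) {U V : Type*} [AddCommGroup U]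
    [Module F U] [AddCommGroup V] [Module F V] [FiniteDimensional F V]
    {x : U ≃ₗ[F] U} {y : V ≃ₗ[F] V} {k : ℕ} (hy : y ^ 2 ^ k = 1) (f : U →ₗ[F] V)
    (hf : Function.Injective f) (hxy : ∀ u, f (x u) = y (f u)) (h : HasObstruction x) :
    HasObstruction y := by
  have : FiniteDimensional F U := FiniteDimensional.of_injective f hf
  obtain ⟨W, hW, hc⟩ := Module.End.isSemisimple_iff.1 (isSemisimple_of_pow_eq_one h2 hy)
    (LinearMap.range f) (by
      rintro _ ⟨u, rfl⟩
      exact ⟨x u, hxy u⟩)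
  let z : W ≃ₗ[F] W := restrictAut y W hW
  have hz : z ^ 2 ^ k = 1 := restrictAut_pow_eq_one hW hy
  let e : (U × W) ≃ₗ[F] V :=
    ((LinearEquiv.ofInjective f hf).prodCongr (LinearEquiv.refl F W)).trans
      (Submodule.prodEquivOfIsCompl _ _ hc)
  have he : ∀ p, e p = f p.1 + p.2 := fun p => by simp [e]
  have hey : prodAutHom e (x, z) = y := by
    ext v
    obtain ⟨p, rfl⟩ := e.surjective v
    have hp : prodAutHom e (x, z) (e p) = e (x p.1, z p.2) := by simp [prodAutHom]
    rw [hp, he, he, map_add, hxy]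
    rfl
  have hinj : ∀ c : U ≃ₗ[F] U, prodAutHom e (c, 1) = 1 → c = 1 := by
    intro c hc
    ext u
    have := congrArg (fun g => e.symm (g (e (u, 0)))) hc
    simpa [prodAutHom] using congrArg Prod.fst this
  have hdet : ∀ c : U ≃ₗ[F] U, LinearEquiv.det c = 1 →
      LinearEquiv.det (prodAutHom e (c, 1)) = 1 := by
    intro c hc
    have := LinearEquiv.det_conj (c.prodCongr (1 : W ≃ₗ[F] W)) e
    rw [LinearEquiv.det_prodCongr, hc, map_one, one_mul] at this
    exact this
  have hcomm : ∀ c : U ≃ₗ[F] U, InCommonTwoSubgroup x c →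
      InCommonTwoSubgroup y (prodAutHom e (c, 1)) := by
    rintro c ⟨H, hH, hx, hc⟩
    rw [← hey]
    exact InCommonTwoSubgroup.map ⟨H.prod (Subgroup.zpowers z),
      hH.subgroupProd (isPGroup_zpowers_of_pow_eq_one hz),
      ⟨hx, Subgroup.mem_zpowers z⟩, ⟨hc, one_mem _⟩⟩ (prodAutHom e)
  obtain ⟨a, b, ha, hb, hxa, hxb, hab⟩ := h
  refine ⟨prodAutHom e (a, 1), prodAutHom e (b, 1), hdet a ha, hdet b hb, hcomm a hxa,
    hcomm b hxb, fun l hl => hab l (hinj _ ?_)⟩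
  rw [← map_mul, ← map_pow] at hl
  simpa using hl

theorem exists_conj_mem_sylow [Finite F] {S S' : Type*} [AddCommGroup S] [Module F S]
    [FiniteDimensional F S] [AddCommGroup S'] [Module F S'] [FiniteDimensional F S']
    (hd : Module.finrank F S = Module.finrank F S') (R : Sylow 2 (S ≃ₗ[F] S))
    {z : S' ≃ₗ[F] S'} {k : ℕ} (hz : z ^ 2 ^ k = 1) :
    ∃ φ : S' ≃ₗ[F] S, φ.symm.trans (z.trans φ) ∈ R := by
  have : Finite S := Module.finite_of_finite F
  have : Finite (S ≃ₗ[F] S) := DFunLike.finite _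
  let φ : S' ≃ₗ[F] S := LinearEquiv.ofFinrankEq _ _ hd.symm
  let w : S ≃ₗ[F] S := φ.symm.trans (z.trans φ)
  have hw : w ^ 2 ^ k = 1 :=
    pow_eq_one_of_intertwines (φ.symm : S →ₗ[F] S') φ.symm.injective
      (fun u => by simp [w]) hz
  obtain ⟨Q, hQ⟩ := (isPGroup_zpowers_of_pow_eq_one hw).exists_le_sylow
  obtain ⟨g, hg⟩ := MulAction.exists_smul_eq (S ≃ₗ[F] S) Q R
  refine ⟨φ.trans g, ?_⟩
  have hmem : g * w * g⁻¹ ∈ g • Q :=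
    ⟨w, hQ (Subgroup.mem_zpowers w), rfl⟩
  rw [hg] at hmem
  exact hmem

section Blocks

variable {S : Type*} [AddCommGroup S] [Module F S]

/-- The map `(u, v) ↦ (s v, -s⁻¹ u)`. -/
def twistedSwap (S : Type*) [AddCommGroup S] [Module F S] (s : Fˣ) : (S × S) ≃ₗ[F] S × S where
  toFun p := (s • p.2, -(s⁻¹ • p.1))
  invFun p := (-(s • p.2), s⁻¹ • p.1)
  map_add' p q := by simp [add_comm]
  map_smul' c p := by simp [smul_comm c]
  left_inv p := by simp
  right_inv p := by simp

/-- The map `(u, v) ↦ (u + c v, v)`. -/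
def upperShear (S : Type*) [AddCommGroup S] [Module F S] (c : F) : (S × S) ≃ₗ[F] S × S where
  toFun p := (p.1 + c • p.2, p.2)
  invFun p := (p.1 - c • p.2, p.2)
  map_add' p q := by simp [add_add_add_comm]
  map_smul' d p := by simp [smul_comm c]
  left_inv p := by simp
  right_inv p := by simp

theorem det_upperShear (h2 : (2 : F) ≠ 0) [FiniteDimensional F S] (c : F) :
    LinearEquiv.det (upperShear S c) = 1 := by
  let e : (S × S) ≃ₗ[F] S × S :=
    (LinearEquiv.smulOfNeZero F S 2 h2).prodCongr (LinearEquiv.refl F S)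
  have h : (e.symm.trans (upperShear S c)).trans e = upperShear S c * upperShear S c := by
    apply LinearEquiv.ext
    intro p
    obtain ⟨q, rfl⟩ := e.surjective p
    rw [LinearEquiv.trans_apply, LinearEquiv.trans_apply, LinearEquiv.symm_apply_apply]
    simp [e, upperShear, two_smul, add_assoc]
  have := LinearEquiv.det_conj (upperShear S c) e
  rw [h, map_mul] at this
  simpa using this

theorem det_twistedSwap (h2 : (2 : F) ≠ 0) [FiniteDimensional F S] (s : Fˣ) :
    LinearEquiv.det (twistedSwap S s) = 1 := by
  let e : (S × S) ≃ₗ[F] S × S := LinearEquiv.prodComm F S S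
  have h : twistedSwap S s = upperShear S (s : F) *
      ((e.symm.trans (upperShear S (-(s⁻¹ : Fˣ) : F))).trans e) * upperShear S (s : F) := by
    ext p <;> simp [e, upperShear, twistedSwap, smul_smul, Units.smul_def, smul_add]
  rw [h, map_mul, map_mul, LinearEquiv.det_conj, det_upperShear h2, det_upperShear h2]
  simp

theorem twistedSwap_pow_four (s : Fˣ) : twistedSwap S s ^ 2 ^ 2 = 1 := by
  ext p <;> simp [pow_succ, twistedSwap]

theorem hasObstruction_prod [Finite F] [FiniteDimensional F S] [Nontrivial S]
    (h2 : (2 : F) ≠ 0) {s : Fˣ} (hs : ∀ k, s ^ 2 ^ k ≠ 1) {R : Subgroup (S ≃ₗ[F] S)}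
    (hR : IsPGroup 2 R) {x y : S ≃ₗ[F] S} (hx : x ∈ R) (hy : y ∈ R) :
    HasObstruction (x.prodCongr y) := by
  have : Finite S := Module.finite_of_finite F
  have : Finite ((S × S) ≃ₗ[F] S × S) := DFunLike.finite _
  have key : ∀ t : Fˣ, InCommonTwoSubgroup (x.prodCongr y) (twistedSwap S t) := by
    intro t
    refine inCommonTwoSubgroup_of_conj_mem
      ((hR.subgroupProd hR).map (prodAutHom (LinearEquiv.refl F (S × S))))
      ⟨(x, y), ⟨hx, hy⟩, rfl⟩ (twistedSwap_pow_four t) ?_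
    rintro _ ⟨⟨r, r'⟩, ⟨hr, hr'⟩, rfl⟩
    refine ⟨(r', r), ⟨hr', hr⟩, ?_⟩
    rw [eq_mul_inv_iff_mul_eq]
    ext p <;> simp [prodAutHom, twistedSwap, Units.smul_def]
  refine ⟨twistedSwap S s, twistedSwap S 1, det_twistedSwap h2 s, det_twistedSwap h2 1,
    key s, key 1, fun k hk => ?_⟩
  let g : (S × S) ≃ₗ[F] S × S := twistedSwap S s * twistedSwap S 1
  have hpow : ∀ (n : ℕ) (v : S), (g ^ n) (v, 0) = ((-s) ^ n • v, 0) := by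
    intro n
    induction n with
    | zero => simp
    | succ n ih =>
      intro v
      have h0 : g (v, 0) = ((-s) • v, 0) := by simp [g, twistedSwap]
      rw [pow_succ, LinearEquiv.mul_apply, h0, ih, smul_smul, pow_succ]
  obtain ⟨v, hv⟩ := exists_ne (0 : S)
  have h1 := hpow (2 ^ k) v
  rw [show g ^ 2 ^ k = 1 from hk] at h1
  have h3 : (((-s) ^ 2 ^ k : Fˣ) : F) • v = (1 : F) • v := by
    simpa [Units.smul_def] using (congrArg Prod.fst h1).symm
  have h4 : (-s) ^ 2 ^ k = 1 := Units.ext (smul_left_injective F hv h3)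
  refine hs (k + 1) ?_
  rw [pow_succ', pow_mul, ← neg_sq, ← pow_mul, mul_comm, pow_mul, h4, one_pow]

/-- The cyclic permutation of three factors. -/
def cycleThree (F S : Type*) [Field F] [AddCommGroup S] [Module F S] :
    (S × S × S) ≃ₗ[F] S × S × S where
  toFun p := (p.2.1, p.2.2, p.1)
  invFun p := (p.2.2, p.1, p.2.1)
  map_add' p q := by simp
  map_smul' c p := by simp
  left_inv p := by simp
  right_inv p := by simp

theorem hasObstruction_prod_three [Finite F] [FiniteDimensional F S] [Nontrivial S]
    (h2 : (2 : F) ≠ 0) {R : Subgroup (S ≃ₗ[F] S)} (hR : IsPGroup 2 R) {x y z : S ≃ₗ[F] S}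
    (hx : x ∈ R) (hy : y ∈ R) (hz : z ∈ R) : HasObstruction (x.prodCongr (y.prodCongr z)) := by
  have : Finite S := Module.finite_of_finite F
  have : Finite ((S × S × S) ≃ₗ[F] S × S × S) := DFunLike.finite _
  let b : (S × S × S) ≃ₗ[F] S × S × S := (LinearEquiv.refl F S).prodCongr (twistedSwap S (1 : Fˣ))
  let c := cycleThree F S
  let a : (S × S × S) ≃ₗ[F] S × S × S := c.symm.trans (b.trans c)
  have ha : ∀ p, a p = (p.2.1, -p.1, p.2.2) := fun p => by
    simp [a, b, c, cycleThree, twistedSwap]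
  have hb : ∀ p, b p = (p.1, p.2.2, -p.2.1) := fun p => by
    simp [b, twistedSwap]
  have hdb : LinearEquiv.det b = 1 := by
    rw [LinearEquiv.det_prodCongr, det_twistedSwap h2]
    simp
  let ι := (prodAutHom (LinearEquiv.refl F (S × S × S))).comp
    ((MonoidHom.id (S ≃ₗ[F] S)).prodMap (prodAutHom (LinearEquiv.refl F (S × S))))
  have hι : ∀ r p, ι r p = (r.1 p.1, r.2.1 p.2.1, r.2.2 p.2.2) := fun r p => by
    simp [ι, prodAutHom]
  have hK : IsPGroup 2 ((R.prod (R.prod R)).map ι) :=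
    (hR.subgroupProd (hR.subgroupProd hR)).map ι
  have hxK : x.prodCongr (y.prodCongr z) ∈ (R.prod (R.prod R)).map ι :=
    ⟨(x, y, z), ⟨hx, hy, hz⟩, rfl⟩
  refine ⟨a, b, (LinearEquiv.det_conj b c).trans hdb, hdb,
    inCommonTwoSubgroup_of_conj_mem (k := 2) hK hxK ?_ ?_,
    inCommonTwoSubgroup_of_conj_mem (k := 2) hK hxK ?_ ?_, fun k hk => ?_⟩
  · ext p <;> simp [pow_succ, ha]
  · rintro _ ⟨⟨r, r', r''⟩, ⟨hr, hr', hr''⟩, rfl⟩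
    refine ⟨(r', r, r''), ⟨hr', hr, hr''⟩, ?_⟩
    rw [eq_mul_inv_iff_mul_eq]
    ext p <;> simp [hι, ha]
  · ext p <;> simp [pow_succ, hb]
  · rintro _ ⟨⟨r, r', r''⟩, ⟨hr, hr', hr''⟩, rfl⟩
    refine ⟨(r, r'', r'), ⟨hr, hr'', hr'⟩, ?_⟩
    rw [eq_mul_inv_iff_mul_eq]
    ext p <;> simp [hι, hb]
  · have h3 : (a * b) ^ 3 = 1 := by ext p <;> simp [pow_succ, ha, hb]
    have h1 : a * b = 1 := by
      have hcop : Nat.Coprime 3 (2 ^ k) := Nat.Coprime.pow_right k (by norm_num)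
      rw [← orderOf_eq_one_iff]
      exact Nat.eq_one_of_dvd_coprimes hcop (orderOf_dvd_of_pow_eq_one h3)
        (orderOf_dvd_of_pow_eq_one hk)
    obtain ⟨v, hv⟩ := exists_ne (0 : S)
    have := congrArg Prod.fst (DFunLike.congr_fun h1 ((v, 0, 0) : S × S × S))
    simp [ha, hb] at this
    exact hv this.symm

end Blocks

section Field

theorem sq_eq_one_of_pow_eq_one {G : Type*} [Monoid G] {g : G} {k N : ℕ} (hg : g ^ 2 ^ k = 1)
    (hN : N % 4 = 1) (hg' : g ^ (N + 1) = 1) : g ^ 2 = 1 := by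
  obtain ⟨j, -, hj⟩ := (Nat.dvd_prime_pow Nat.prime_two).1 (orderOf_dvd_of_pow_eq_one hg)
  have hdvd := orderOf_dvd_of_pow_eq_one hg'
  rw [hj] at hdvd
  have hj1 : j ≤ 1 := by
    by_contra! h
    have : 2 ^ 2 ∣ N + 1 := (pow_dvd_pow 2 h).trans hdvd
    omega
  exact orderOf_dvd_iff_pow_eq_one.1 (hj ▸ by simpa using pow_dvd_pow 2 hj1)

/-- An involution anticommuting with an automorphism has both eigenspaces of half dimension, which
determines its determinant. -/
theorem det_of_anticommute (h2 : (2 : F) ≠ 0) {V : Type*} [AddCommGroup V] [Module F V]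
    [FiniteDimensional F V] {m : ℕ} (hV : Module.finrank F V = 2 * m) {σ τ : V ≃ₗ[F] V}
    (hσ : ∀ v, σ (σ v) = v) (hστ : ∀ v, σ (τ v) = -τ (σ v)) :
    LinearEquiv.det σ = (-1) ^ m := by
  let K : Submodule F V := LinearMap.ker ((σ : V →ₗ[F] V) - LinearMap.id)
  have hK : ∀ v, v ∈ K ↔ σ v = v := fun v => by simp [K, sub_eq_zero]
  let f : (K × K) →ₗ[F] V := K.subtype.coprod ((τ : V →ₗ[F] V) ∘ₗ K.subtype)
  have hf : ∀ p, f p = p.1 + τ p.2 := fun p => rfl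
  have hσf : ∀ p : K × K, σ (f p) = p.1 - τ p.2 := fun p => by
    rw [hf, map_add, hστ, (hK _).1 p.1.2, (hK _).1 p.2.2, sub_eq_add_neg]
  have hdouble : ∀ v : V, v + v = 0 → v = 0 := fun v hv => by
    rw [← two_smul F] at hv
    exact (smul_eq_zero.1 hv).resolve_left h2
  have hinj : Function.Injective f := by
    rw [injective_iff_map_eq_zero]
    intro p hp
    have h0 := hσf p
    rw [hp, map_zero] at h0
    rw [hf] at hp
    have h1 : (p.1 : V) = 0 := hdouble _ (by
      calc (p.1 : V) + p.1 = (p.1 + τ p.2) + (p.1 - τ p.2) := by abel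
        _ = 0 := by rw [hp, ← h0, add_zero])
    have h3 : τ (p.2 : V) = 0 := by simpa [h1] using hp
    exact Prod.ext (Subtype.ext h1) (Subtype.ext (by simpa using h3))
  have hsurj : Function.Surjective f := by
    intro v
    have hτ : ∀ w, σ (τ.symm w) = -τ.symm (σ w) := fun w => by
      apply τ.injective
      rw [map_neg, LinearEquiv.apply_symm_apply, ← neg_eq_iff_eq_neg, ← hστ,
        LinearEquiv.apply_symm_apply]
    refine ⟨(⟨(2 : F)⁻¹ • (v + σ v), (hK _).2 ?_⟩,
      ⟨(2 : F)⁻¹ • τ.symm (v - σ v), (hK _).2 ?_⟩), ?_⟩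
    · simp [hσ, add_comm]
    · simp [hσ, hτ, add_comm, sub_eq_add_neg]
    · rw [hf]
      simp only [map_smul, LinearEquiv.apply_symm_apply, ← smul_add]
      rw [add_add_sub_cancel, ← two_smul F v, smul_smul, inv_mul_cancel₀ h2, one_smul]
  let e : (K × K) ≃ₗ[F] V := LinearEquiv.ofBijective f ⟨hinj, hsurj⟩
  have hdim : Module.finrank F K = m := by
    have := e.finrank_eq
    rw [Module.finrank_prod, hV] at this
    omega
  have hconj : (e.symm.trans ((LinearEquiv.refl F K).prodCongr (LinearEquiv.neg F))).trans e
      = σ := by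
    apply LinearEquiv.ext
    intro v
    obtain ⟨p, rfl⟩ := e.surjective v
    rw [LinearEquiv.trans_apply, LinearEquiv.trans_apply, LinearEquiv.symm_apply_apply]
    refine Eq.trans ?_ (hσf p).symm
    change f _ = _
    simp [hf, sub_eq_add_neg]
  rw [← hconj, LinearEquiv.det_conj, LinearEquiv.det_prodCongr]
  ext
  have : ((LinearEquiv.neg F : K ≃ₗ[F] K) : K →ₗ[F] K) = (-1 : F) • LinearMap.id := by
    ext; simp
  simp [this, hdim]

/-- Units of `L` acting on `L` by multiplication. -/
abbrev unitAut (F : Type*) [Field F] {L : Type*} [Field L] [Algebra F L] : Lˣ →* (L ≃ₗ[F] L) :=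
  DistribMulAction.toModuleAut F L

theorem exists_scalar_for_det [Fintype F] {m : ℕ} (hm : Fintype.card F ^ m % 4 = 1) :
    ∃ c : Fˣ, (c ^ 2) ^ 2 = 1 ∧ (c ^ 2) ^ m * (-1) ^ m = 1 := by
  rcases Nat.even_or_odd m with he | ho
  · exact ⟨1, by simp, by simp [he.neg_one_pow]⟩
  · have hq : Fintype.card F % 4 ≠ 3 := by
      intro h
      obtain ⟨j, rfl⟩ := ho
      rw [pow_succ, pow_mul, Nat.mul_mod, Nat.pow_mod, Nat.pow_mod (Fintype.card F), h] at hm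
      norm_num at hm
    obtain ⟨c, hc⟩ := FiniteField.isSquare_neg_one_iff.2 hq
    have hc0 : c ≠ 0 := by rintro rfl; simp at hc
    have hc2 : (Units.mk0 c hc0) ^ 2 = -1 := Units.ext (by simp [sq, ← hc])
    exact ⟨Units.mk0 c hc0, by simp [hc2], by rw [hc2, ← mul_pow]; simp⟩

theorem hasObstruction_unitAut [Fintype F] (h2 : (2 : F) ≠ 0) {L : Type*} [Field L] [Finite L]
    [Algebra F L] {u : Lˣ} (hgen : ∀ f : L →ₐ[F] L, f u = u → f = AlgHom.id F L) {k m : ℕ}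
    (hu : u ^ 2 ^ k = 1) (hL : Module.finrank F L = 2 * m)
    (hm : Fintype.card F ^ m % 4 = 1) : HasObstruction (unitAut F u) := by
  have : Finite (L ≃ₗ[F] L) := DFunLike.finite _
  have hL2 : (2 : L) ≠ 0 := by
    rw [← map_ofNat (algebraMap F L) 2]
    simpa using h2
  let φ := FiniteField.frobeniusAlgEquivOfAlgebraic F L
  let σ := φ ^ m
  have hσ : ∀ y, σ y = y ^ Fintype.card F ^ m := fun y => by
    simp only [σ, φ, AlgEquiv.coe_pow, FiniteField.coe_frobeniusAlgEquivOfAlgebraic_iterate]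
  have hord : orderOf φ = 2 * m := by
    rw [← hL]; exact FiniteField.orderOf_frobeniusAlgEquivOfAlgebraic F L
  have hσσ : ∀ y, σ (σ y) = y := fun y => by
    have : σ * σ = 1 := by rw [← pow_add, ← two_mul, ← hord, pow_orderOf_eq_one]
    exact DFunLike.congr_fun this y
  have hpos : 0 < Module.finrank F L := Module.finrank_pos
  have hσu : σ (u : L) ≠ u := by
    intro h
    have h1 : φ ^ m = 1 := AlgEquiv.coe_toAlgHom_injective (hgen (σ : L →ₐ[F] L) h)
    have := Nat.le_of_dvd (by omega) (hord ▸ orderOf_dvd_of_pow_eq_one h1)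
    omega
  have hσ_inv : ∀ y : L, y ^ (Fintype.card F ^ m + 1) = σ y * y := fun y => by
    rw [pow_succ, hσ]
  have hneg : σ (u : L) = -u := by
    have h1 : (σ (u : L) / u) ^ 2 = 1 := by
      refine sq_eq_one_of_pow_eq_one (k := k) ?_ hm ?_
      · rw [div_pow, ← map_pow, ← Units.val_pow_eq_pow_val, hu]
        simp
      · rw [hσ_inv, map_div₀, hσσ]
        have : σ (u : L) ≠ 0 := by simp
        field_simp
    rcases mul_self_eq_one_iff.1 ((sq _).symm.trans h1) with h | h
    · exact absurd ((div_eq_one_iff_eq u.ne_zero).1 h) hσu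
    · rw [div_eq_iff u.ne_zero] at h
      simpa using h
  have hE0 : (1 + u : L) ≠ 0 := by
    intro h
    have h1 := congrArg σ h
    rw [map_add, map_one, hneg, map_zero] at h1
    exact hL2 (by linear_combination h + h1)
  let E : Lˣ := Units.mk0 (1 + u) hE0
  obtain ⟨c, hc4, hcm⟩ := exists_scalar_for_det hm
  let d : Lˣ := Units.map (algebraMap F L : F →* L) c
  have hσd : ∀ y, σ (d * y) = d * σ y := fun y => by
    rw [map_mul]
    congr 1
    exact σ.commutes _
  let s : L ≃ₗ[F] L := σ.toLinearEquiv
  let a : L ≃ₗ[F] L := unitAut F d * s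
  have ha : ∀ y, a y = d * σ y := fun y => rfl
  have hd4 : (d : L) * (d * (d * d)) = 1 := by
    have : d ^ 4 = 1 := by rw [← map_pow, show 4 = 2 * 2 from rfl, pow_mul, hc4, map_one]
    rw [← Units.val_one, ← this]
    push_cast
    ring
  have ha4 : a ^ 2 ^ 2 = 1 := by
    apply LinearEquiv.ext
    intro y
    calc (a ^ 2 ^ 2) y = a (a (a (a y))) := rfl
      _ = (d * (d * (d * d))) * y := by simp only [ha, hσd, hσσ]; ring
      _ = y := by rw [hd4, one_mul]
  have hadet : LinearEquiv.det a = 1 := by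
    have h1 : LinearEquiv.det (unitAut F d) = c ^ (2 * m) := by
      ext
      have : ((unitAut F d : L ≃ₗ[F] L) : L →ₗ[F] L) = (c : F) • LinearMap.id := by
        apply LinearMap.ext
        intro y
        exact (Algebra.smul_def (c : F) y).symm
      rw [LinearEquiv.coe_det, this]
      simp [hL]
    have h3 : LinearEquiv.det s = (-1) ^ m :=
      det_of_anticommute h2 hL (τ := unitAut F u) hσσ fun v => by
        change σ (u * v) = -(u * σ v)
        rw [map_mul, hneg, neg_mul]
    rw [map_mul, h1, h3, pow_mul, hcm]
  have haT : ∀ w w' : Lˣ, σ (w : L) = w' → a * unitAut F w = unitAut F w' * a := by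
    intro w w' hw
    apply LinearEquiv.ext
    intro y
    change d * σ (w * y) = w' * (d * σ y)
    rw [map_mul, hw]
    ring
  have hxa : InCommonTwoSubgroup (unitAut F u) a := by
    refine inCommonTwoSubgroup_of_conj_mem (K := (Subgroup.zpowers u).map (unitAut F))
      ((isPGroup_zpowers_of_pow_eq_one hu).map _) ⟨u, Subgroup.mem_zpowers u, rfl⟩ ha4 ?_
    rintro _ ⟨w, hw, rfl⟩
    refine ⟨w ^ Fintype.card F ^ m, pow_mem hw _, ?_⟩
    rw [eq_mul_inv_iff_mul_eq]
    exact (haT _ _ (by rw [hσ]; rfl)).symm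
  let e := unitAut F E
  have hxb : InCommonTwoSubgroup (unitAut F u) (e * a⁻¹ * e⁻¹) := by
    have hxa' : InCommonTwoSubgroup (unitAut F u) a⁻¹ := by
      obtain ⟨H, hH, hx, ha⟩ := hxa
      exact ⟨H, hH, hx, inv_mem ha⟩
    have h1 := hxa'.map (MulAut.conj e).toMonoidHom
    have h3 : (MulAut.conj e).toMonoidHom (unitAut F u) = unitAut F u := by
      change e * unitAut F u * e⁻¹ = _
      rw [← map_mul, mul_comm, map_mul, mul_inv_cancel_right]
    rw [h3] at h1
    exact h1
  have hE1 : (1 - u : L) ≠ 0 := by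
    intro h
    have h1 := congrArg σ h
    rw [map_sub, map_one, hneg, map_zero, sub_neg_eq_add] at h1
    exact hE0 h1
  let E' : Lˣ := Units.mk0 (1 - u) hE1
  have hEE' : σ (E : L) = E' := by
    change σ (1 + u) = 1 - u
    rw [map_add, map_one, hneg, sub_eq_add_neg]
  have hEE : σ (E' : L) = E := by rw [← hEE', hσσ]
  refine ⟨a, e * a⁻¹ * e⁻¹, hadet, by simp [hadet], hxa, hxb, fun l hl => ?_⟩
  have hab : a * (e * a⁻¹ * e⁻¹) = unitAut F (E' / E) := by
    rw [← mul_assoc, ← mul_assoc, haT E E' hEE', mul_inv_cancel_right, div_eq_mul_inv, map_mul,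
      map_inv]
  rw [hab, ← map_pow] at hl
  have hg : (E' / E) ^ 2 ^ l = 1 := by
    have h1 : (((E' / E) ^ 2 ^ l : Lˣ) : L) * 1 = 1 := DFunLike.congr_fun hl (1 : L)
    exact Units.ext ((mul_one _).symm.trans h1)
  have hg2 : ((E' / E : Lˣ) : L) ^ 2 = 1 := by
    refine sq_eq_one_of_pow_eq_one (k := l) ?_ hm ?_
    · rw [← Units.val_pow_eq_pow_val, hg, Units.val_one]
    · rw [hσ_inv, Units.val_div_eq_div_val, map_div₀, hEE, hEE']
      have := E.ne_zero
      have := E'.ne_zero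
      field_simp
  rw [Units.val_div_eq_div_val, div_pow, div_eq_one_iff_eq (by simp)] at hg2
  have h4 : (2 : L) * 2 * u = 0 := by
    have h5 : (1 - u : L) ^ 2 = (1 + u) ^ 2 := hg2
    linear_combination -h5
  simp [hL2] at h4

/-- A simple constituent without obstruction has dimension one, or dimension two with
`q ≡ 3 (mod 4)`. -/
theorem finrank_of_not_hasObstruction [Fintype F] (hodd : Odd (Fintype.card F))
    (h2 : (2 : F) ≠ 0) {L : Type*} [Field L] [Finite L]
    [Algebra F L] {u : Lˣ} (hgen : ∀ f : L →ₐ[F] L, f u = u → f = AlgHom.id F L) {k : ℕ}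
    (hu : u ^ 2 ^ k = 1) (hn : ¬ HasObstruction (unitAut F u)) :
    Module.finrank F L = 1 ∨ (Module.finrank F L = 2 ∧ Fintype.card F % 4 = 3) := by
  let φ := FiniteField.frobeniusAlgHom F L
  have hφ : φ ^ 2 ^ k = 1 := by
    apply hgen
    rw [AlgHom.coe_pow, FiniteField.coe_frobeniusAlgHom, pow_iterate]
    have h1 : Fintype.card F ^ 2 ^ k ≡ 1 [MOD 2 ^ k] := by
      rcases k with _ | k
      · exact Nat.modEq_one
      · have := Nat.ModEq.pow_totient (hodd.coprime_two_right.pow_right (k + 1))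
        rw [Nat.totient_prime_pow_succ Nat.prime_two] at this
        simpa [pow_succ, pow_mul] using this.pow 2
    have h3 : u ^ Fintype.card F ^ 2 ^ k = u ^ 1 :=
      pow_eq_pow_iff_modEq.2 (h1.of_dvd (orderOf_dvd_of_pow_eq_one hu))
    rw [pow_one] at h3
    exact congrArg Units.val h3
  have hdvd : Module.finrank F L ∣ 2 ^ k := by
    rw [← FiniteField.orderOf_frobeniusAlgHom]
    exact orderOf_dvd_of_pow_eq_one hφ
  obtain ⟨j, -, hj⟩ := (Nat.dvd_prime_pow Nat.prime_two).1 hdvd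
  obtain ⟨r, hr⟩ := hodd
  rcases j with _ | j
  · exact .inl (by simpa using hj)
  · rw [pow_succ'] at hj
    have hm := mt (hasObstruction_unitAut h2 hgen hu hj) hn
    refine .inr ?_
    have hq : Fintype.card F % 4 = 3 := by
      by_contra h
      have : Fintype.card F % 4 = 1 := by omega
      exact hm (by rw [Nat.pow_mod, this]; simp)
    rcases j with _ | j
    · exact ⟨by simpa using hj, hq⟩
    · exfalso
      apply hm
      rw [pow_succ', pow_mul, Nat.pow_mod, Nat.pow_mod (Fintype.card F), hq]
      norm_num

end Field

section Constituents

open Module Polynomial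

variable {V : Type*} [AddCommGroup V] [Module F V] [FiniteDimensional F V]

/-- Every proper invariant subspace misses a simple constituent, described as a simple field
extension of `F`. -/
theorem exists_simple_constituent (h2 : (2 : F) ≠ 0) {x : V ≃ₗ[F] V} {k : ℕ}
    (hx : x ^ 2 ^ k = 1) {T : Submodule F V} (hT : ∀ v ∈ T, x v ∈ T) (hTop : T ≠ ⊤) :
    ∃ (I : Ideal F[X]) (_ : I.IsMaximal) (f : (F[X] ⧸ I) →ₗ[F] V), Function.Injective f ∧
      (∀ y, f (Ideal.Quotient.mk I X * y) = x (f y)) ∧ Disjoint T (LinearMap.range f) := by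
  have hss : IsSemisimpleModule F[X] (AEval' (x : V →ₗ[F] V)) := isSemisimple_of_pow_eq_one h2 hx
  let T' : Submodule F[X] (AEval' (x : V →ₗ[F] V)) := AEval.mapSubmodule F V _ ⟨T, hT⟩
  have hT' : ∀ v, AEval'.of (x : V →ₗ[F] V) v ∈ T' ↔ v ∈ T := fun v =>
    AEval.mem_mapSubmodule_apply ..
  obtain ⟨W, hW⟩ := exists_isCompl T'
  have hWbot : W ≠ ⊥ := by
    rintro rfl
    refine hTop (eq_top_iff.2 fun v _ => (hT' v).1 ?_)
    rw [eq_top_of_isCompl_bot hW]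
    trivial
  obtain ⟨m, hmW, hm⟩ := (IsSemisimpleModule.eq_bot_or_exists_simple_le W).resolve_left hWbot
  obtain ⟨I, hI, ⟨e⟩⟩ := isSimpleModule_iff_quot_maximal.1 hm
  let g : (F[X] ⧸ I) →ₗ[F[X]] AEval' (x : V →ₗ[F] V) := m.subtype ∘ₗ (e.symm : _ →ₗ[F[X]] m)
  have hg : Function.Injective g := m.injective_subtype.comp e.symm.injective
  let f : (F[X] ⧸ I) →ₗ[F] V :=
    ((AEval'.of (x : V →ₗ[F] V)).symm : _ →ₗ[F] V) ∘ₗ g.restrictScalars F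
  have hf : ∀ y, AEval'.of (x : V →ₗ[F] V) (f y) = g y := fun y => by simp [f]
  refine ⟨I, hI, f, (AEval'.of (x : V →ₗ[F] V)).symm.injective.comp hg, fun y => ?_, ?_⟩
  · apply (AEval'.of (x : V →ₗ[F] V)).injective
    rw [hf]
    have : Ideal.Quotient.mk I X * y = (X : F[X]) • y := rfl
    rw [this, map_smul, ← hf, AEval'.X_smul_of]
    rfl
  · rw [Submodule.disjoint_def]
    rintro _ hv ⟨y, rfl⟩
    have h1 : g y ∈ T' := hf y ▸ (hT' _).2 hv
    have h3 : g y ∈ W := hmW (e.symm y).2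
    have h0 := Submodule.disjoint_def.1 hW.disjoint _ h1 h3
    rw [← hf] at h0
    simpa using h0

/-- If `x` has no obstruction, then every proper invariant subspace is disjoint from an invariant
subspace of dimension one, or two if `q ≡ 3 (mod 4)`. -/
theorem exists_invariant_of_not_hasObstruction [Fintype F] (hodd : Odd (Fintype.card F))
    (h2 : (2 : F) ≠ 0) {x : V ≃ₗ[F] V} {k : ℕ} (hx : x ^ 2 ^ k = 1) (hn : ¬ HasObstruction x)
    {T : Submodule F V} (hT : ∀ v ∈ T, x v ∈ T) (hTop : T ≠ ⊤) :
    ∃ S : Submodule F V, (∀ v ∈ S, x v ∈ S) ∧ Disjoint T S ∧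
      (finrank F S = 1 ∨ (finrank F S = 2 ∧ Fintype.card F % 4 = 3)) := by
  obtain ⟨I, hI, f, hf, hfx, hd⟩ := exists_simple_constituent h2 hx hT hTop
  let := Ideal.Quotient.field I
  have : Finite V := Module.finite_of_finite F
  have : Finite (F[X] ⧸ I) := Finite.of_injective f hf
  have hpow : ∀ (n : ℕ) y, f (Ideal.Quotient.mk I X ^ n * y) = (x ^ n) (f y) := by
    intro n
    induction n with
    | zero => simp
    | succ n ih => intro y; rw [pow_succ, mul_assoc, ih, hfx, pow_succ, LinearEquiv.mul_apply]
  have hX : Ideal.Quotient.mk I X ^ 2 ^ k = 1 := hf (by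
    simpa [hx] using hpow (2 ^ k) 1)
  let u : (F[X] ⧸ I)ˣ := Units.ofPowEqOne _ _ hX (by positivity)
  have hu : u ^ 2 ^ k = 1 := Units.pow_ofPowEqOne _ _
  have hgen : ∀ g : (F[X] ⧸ I) →ₐ[F] (F[X] ⧸ I), g u = u → g = AlgHom.id F _ := fun g hg =>
    Ideal.Quotient.algHom_ext F (Polynomial.algHom_ext hg)
  have hfin := finrank_of_not_hasObstruction hodd h2 hgen hu
    (mt (HasObstruction.of_injective h2 hx f hf hfx) hn)
  rw [← LinearMap.finrank_range_of_inj hf] at hfin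
  refine ⟨LinearMap.range f, ?_, hd, hfin⟩
  rintro _ ⟨y, rfl⟩
  exact ⟨_, hfx y⟩

/-- An invariant subspace of the dimension of `S` is the image of an intertwining map from `S`,
where `S` carries an element of a prescribed Sylow `2`-subgroup of `GL(S)`. -/
theorem exists_intertwining [Finite F] {x : V ≃ₗ[F] V} {k : ℕ} (hx : x ^ 2 ^ k = 1)
    {S S' : Submodule F V} (hd : finrank F S = finrank F S') (hS' : ∀ v ∈ S', x v ∈ S')
    (R : Sylow 2 (S ≃ₗ[F] S)) :
    ∃ y ∈ R, ∃ f : S →ₗ[F] V, Function.Injective f ∧ LinearMap.range f = S' ∧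
      ∀ v, f (y v) = x (f v) := by
  obtain ⟨φ, hφ⟩ := exists_conj_mem_sylow hd R (restrictAut_pow_eq_one hS' hx)
  refine ⟨_, hφ, S'.subtype ∘ₗ (φ.symm : S →ₗ[F] S'), S'.injective_subtype.comp φ.symm.injective,
    ?_, fun v => ?_⟩
  · rw [LinearMap.range_comp, LinearEquiv.range, Submodule.map_top, Submodule.range_subtype]
  · simp [coe_restrictAut]

omit [FiniteDimensional F V] in
theorem coprod_injective {U W : Type*} [AddCommGroup U] [Module F U] [AddCommGroup W] [Module F W]
    {f : U →ₗ[F] V} {g : W →ₗ[F] V} (hf : Function.Injective f) (hg : Function.Injective g)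
    (hd : Disjoint (LinearMap.range f) (LinearMap.range g)) :
    Function.Injective (f.coprod g) := by
  rw [← LinearMap.ker_eq_bot] at *
  rw [LinearMap.ker_coprod_of_disjoint_range f g hd, hf, hg, Submodule.prod_bot]

theorem hasObstruction_of_disjoint [Finite F] (h2 : (2 : F) ≠ 0) {s : Fˣ}
    (hs : ∀ k, s ^ 2 ^ k ≠ 1) {x : V ≃ₗ[F] V} {k : ℕ} (hx : x ^ 2 ^ k = 1)
    {S₁ S₂ : Submodule F V} (h₁ : ∀ v ∈ S₁, x v ∈ S₁) (h₂ : ∀ v ∈ S₂, x v ∈ S₂)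
    (hd : Disjoint S₁ S₂) (hpos : 0 < finrank F S₁) (h : finrank F S₁ = finrank F S₂) :
    HasObstruction x := by
  have : Nontrivial S₁ := finrank_pos_iff.1 hpos
  let R : Sylow 2 (S₁ ≃ₗ[F] S₁) := default
  obtain ⟨y, hy, f, hf, hfr, hfx⟩ := exists_intertwining hx rfl h₁ R
  obtain ⟨z, hz, g, hg, hgr, hgx⟩ := exists_intertwining hx h h₂ R
  exact (hasObstruction_prod h2 hs R.isPGroup' hy hz).of_injective h2 hx (f.coprod g)
    (coprod_injective hf hg (by rwa [hfr, hgr])) fun v => by simp [hfx, hgx]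

theorem hasObstruction_of_disjoint_three [Finite F] (h2 : (2 : F) ≠ 0) {x : V ≃ₗ[F] V} {k : ℕ}
    (hx : x ^ 2 ^ k = 1) {S₁ S₂ S₃ : Submodule F V} (h₁ : ∀ v ∈ S₁, x v ∈ S₁)
    (h₂ : ∀ v ∈ S₂, x v ∈ S₂) (h₃ : ∀ v ∈ S₃, x v ∈ S₃) (hd : Disjoint S₁ S₂)
    (hd' : Disjoint (S₁ ⊔ S₂) S₃) (hpos : 0 < finrank F S₁)
    (h : finrank F S₁ = finrank F S₂) (h' : finrank F S₁ = finrank F S₃) :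
    HasObstruction x := by
  have : Nontrivial S₁ := finrank_pos_iff.1 hpos
  let R : Sylow 2 (S₁ ≃ₗ[F] S₁) := default
  obtain ⟨y, hy, f, hf, hfr, hfx⟩ := exists_intertwining hx rfl h₁ R
  obtain ⟨z, hz, g, hg, hgr, hgx⟩ := exists_intertwining hx h h₂ R
  obtain ⟨w, hw, l, hl, hlr, hlx⟩ := exists_intertwining hx h' h₃ R
  have hgl : Disjoint S₂ S₃ := hd'.mono_left le_sup_right
  refine (hasObstruction_prod_three h2 R.isPGroup' hy hz hw).of_injective h2 hx
    (f.coprod (g.coprod l))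
    (coprod_injective hf (coprod_injective hg hl (by rwa [hgr, hlr])) ?_)
    fun v => by simp [hfx, hgx, hlx]
  rw [LinearMap.range_coprod, hfr, hgr, hlr]
  exact hd.disjoint_sup_right_of_disjoint_sup_left hd'

theorem exists_units_pow_two_pow_ne_one [Fintype F] (hq : Fintype.card F % 4 = 3)
    (h3 : Fintype.card F ≠ 3) : ∃ s : Fˣ, ∀ k, s ^ 2 ^ k ≠ 1 := by
  obtain ⟨s, hs⟩ := IsCyclic.exists_generator (α := Fˣ)
  refine ⟨s, fun k hk => ?_⟩
  have hord : orderOf s = Fintype.card F - 1 := by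
    rw [orderOf_eq_card_of_forall_mem_zpowers hs, Nat.card_units, Nat.card_eq_fintype_card]
  obtain ⟨j, -, hj⟩ := (Nat.dvd_prime_pow Nat.prime_two).1 (orderOf_dvd_of_pow_eq_one hk)
  rw [hord] at hj
  rcases j with _ | _ | j
  · omega
  · omega
  · rw [pow_add] at hj
    omega

omit [FiniteDimensional F V] in
theorem map_mem_sup {x : V ≃ₗ[F] V} {S₁ S₂ : Submodule F V} (h₁ : ∀ v ∈ S₁, x v ∈ S₁)
    (h₂ : ∀ v ∈ S₂, x v ∈ S₂) : ∀ v ∈ S₁ ⊔ S₂, x v ∈ S₁ ⊔ S₂ := by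
  intro v hv
  obtain ⟨a, ha, b, hb, rfl⟩ := Submodule.mem_sup.1 hv
  rw [map_add]
  exact Submodule.add_mem_sup (h₁ a ha) (h₂ b hb)

theorem hasObstruction_of_finrank [Fintype F] (hodd : Odd (Fintype.card F)) (h2 : (2 : F) ≠ 0)
    (h3 : Fintype.card F ≠ 3) {x : V ≃ₗ[F] V} {k : ℕ} (hx : x ^ 2 ^ k = 1)
    (hV : 2 < finrank F V) (hq : Fintype.card F % 4 = 3 → finrank F V ≠ 3) :
    HasObstruction x := by
  by_contra hn
  have step : ∀ {T : Submodule F V}, (∀ v ∈ T, x v ∈ T) → finrank F T < finrank F V →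
      ∃ S : Submodule F V, (∀ v ∈ S, x v ∈ S) ∧ Disjoint T S ∧
        (finrank F S = 1 ∨ (finrank F S = 2 ∧ Fintype.card F % 4 = 3)) := fun hT hlt =>
    exists_invariant_of_not_hasObstruction hodd h2 hx hn hT fun h => by
      rw [h, finrank_top] at hlt
      exact hlt.false
  obtain ⟨S₁, h₁, -, d₁⟩ := step (T := ⊥) (by simp) (by rw [finrank_bot]; omega)
  obtain ⟨S₂, h₂, hd, d₂⟩ := step h₁ (by omega)
  have hsup := Submodule.finrank_add_le_finrank_add_finrank S₁ S₂
  by_cases hF : Fintype.card F % 4 = 3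
  · obtain ⟨s, hs⟩ := exists_units_pow_two_pow_ne_one hF h3
    have hne : finrank F S₁ ≠ finrank F S₂ := fun h =>
      hn (hasObstruction_of_disjoint h2 hs hx h₁ h₂ hd (by omega) h)
    obtain ⟨S₃, h₃, hd', d₃⟩ := step (map_mem_sup h₁ h₂) (by have := hq hF; omega)
    rcases (by omega : finrank F S₁ = finrank F S₃ ∨ finrank F S₂ = finrank F S₃) with h | h
    · exact hn (hasObstruction_of_disjoint h2 hs hx h₁ h₃ (hd'.mono_left le_sup_left) (by omega) h)
    · exact hn (hasObstruction_of_disjoint h2 hs hx h₂ h₃ (hd'.mono_left le_sup_right)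
        (by omega) h)
  · obtain ⟨S₃, h₃, hd', d₃⟩ := step (map_mem_sup h₁ h₂) (by omega)
    exact hn (hasObstruction_of_disjoint_three h2 hx h₁ h₂ h₃ hd hd' (by omega) (by omega)
      (by omega))

end Constituents

theorem not_hasObstruction_of_picky {ι : Type*} [Fintype ι] [DecidableEq ι]
    {x : Matrix.SpecialLinearGroup ι F}
    (hx : ∃! P : Sylow 2 (Matrix.SpecialLinearGroup ι F), x ∈ P) :
    ¬ HasObstruction (Matrix.SpecialLinearGroup.toLin' x) := by
  rintro ⟨a, b, ha, hb, hxa, hxb, hab⟩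
  have lift : ∀ c : (ι → F) ≃ₗ[F] (ι → F), LinearEquiv.det c = 1 →
      ∃ C : Matrix.SpecialLinearGroup ι F, Matrix.SpecialLinearGroup.toLin' C = c := by
    intro c hc
    refine ⟨⟨LinearMap.toMatrix' (c : (ι → F) →ₗ[F] (ι → F)), ?_⟩, ?_⟩
    · rw [LinearMap.det_toMatrix', ← LinearEquiv.coe_det, hc, Units.val_one]
    · apply LinearEquiv.toLinearMap_injective
      exact Matrix.toLin'_toMatrix' _
  obtain ⟨A, rfl⟩ := lift a ha
  obtain ⟨B, rfl⟩ := lift b hb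
  have hinj := Matrix.SpecialLinearGroup.toLin'_injective (n := ι) (R := F)
  obtain ⟨k, hk⟩ := exists_pow_mul_eq_one_of_picky hx (hxa.of_map hinj) (hxb.of_map hinj)
  exact hab k (by rw [← map_mul, ← map_pow, hk, map_one])

end LinearAlgebra

/-- If `SL_n(𝔽_q)`, with `q` odd and `n ≥ 2`, contains a picky `2`-element, then
`q = 3`, or `n = 2`, or `n ∈ {3, 5}` and `q ≡ 3 (mod 4)`. -/
theorem picky_two_element_SL_reduction
    (q : ℕ) (hq : IsPrimePow q) (hodd : Odd q) (n : ℕ) (hn : 2 ≤ n)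
    (F : Type*) [Field F] [Fintype F] [DecidableEq F] (hF : Fintype.card F = q)
    (x : Matrix.SpecialLinearGroup (Fin n) F) (hx : ∃ k : ℕ, orderOf x = 2 ^ k)
    (hpicky : ∃! P : Sylow 2 (Matrix.SpecialLinearGroup (Fin n) F), x ∈ P) :
    q = 3 ∨ n = 2 ∨ ((n = 3 ∨ n = 5) ∧ q % 4 = 3) := by
  subst hF
  by_contra! hcon
  obtain ⟨h3, h2n, hmod⟩ := hcon
  have h2 : (2 : F) ≠ 0 := by
    have : ringChar F ≠ 2 := fun h => by
      have := FiniteField.even_card_iff_char_two.1 h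
      rw [Nat.odd_iff] at hodd
      omega
    exact Ring.two_ne_zero this
  obtain ⟨k, hk⟩ := hx
  refine not_hasObstruction_of_picky hpicky (hasObstruction_of_finrank (k := k) hodd h2 h3 ?_ ?_ ?_)
  · rw [← map_pow, ← hk, pow_orderOf_eq_one, map_one]
  · rw [Module.finrank_fin_fun]
    omega
  · rw [Module.finrank_fin_fun]
    exact fun hq3 hn3 => hmod (.inl hn3) hq3
end

section
/- Let q be an odd prime power and n ≥ 1 an integer. If Sp_{2n}(𝔽_q) contains a picky 2-element, then one of the following holds: q = 3; or q = 5 and n ≤ 5; or n ≤ 2. -/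
/-- `x` lies in a largest `2`-subgroup among the `2`-subgroups containing it. -/
def IsPicky {G : Type*} [Group G] (x : G) : Prop :=
  ∃ P : Subgroup G, IsPGroup 2 P ∧ ∀ Q : Subgroup G, IsPGroup 2 Q → x ∈ Q → Q ≤ P

section Picky

variable {G H : Type*} [Group G] [Group H]

theorem IsPicky.of_existsUnique_sylow {x : G} (h : ∃! P : Sylow 2 G, x ∈ P) : IsPicky x := by
  obtain ⟨P, -, hP⟩ := h
  refine ⟨P, P.isPGroup', fun Q hQ hx => ?_⟩
  obtain ⟨R, hR⟩ := hQ.exists_le_sylow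
  rw [← hP R (hR hx)]
  exact hR

theorem IsPicky.of_injective {f : H →* G} (hf : Function.Injective f) {x : H}
    (h : IsPicky (f x)) : IsPicky x := by
  obtain ⟨P, hP, hmax⟩ := h
  refine ⟨P.comap f, hP.comap_of_injective f hf, fun Q hQ hx => ?_⟩
  rw [← Subgroup.map_le_iff_le_comap]
  exact hmax _ (hQ.map f) (Subgroup.mem_map_of_mem f hx)

theorem isPGroup_zpowers {p : ℕ} {x : G} (hx : ∃ k, x ^ p ^ k = 1) :
    IsPGroup p (Subgroup.zpowers x) := by
  obtain ⟨k, hk⟩ := hx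
  rw [isPGroup_iff_pow_pow_eq_one]
  rintro ⟨g, hg⟩
  refine ⟨k, Subtype.ext ?_⟩
  obtain ⟨m, rfl⟩ := Subgroup.mem_zpowers_iff.1 hg
  change (x ^ m) ^ p ^ k = 1
  rw [← zpow_natCast, zpow_comm, zpow_natCast, hk, one_zpow]

theorem IsPicky.map_of_surjective [Finite G] {f : G →* H} (hf : Function.Surjective f) {x : G}
    (hx : ∃ k, x ^ 2 ^ k = 1) (h : IsPicky x) : IsPicky (f x) := by
  obtain ⟨P, hP, hmax⟩ := h
  refine ⟨P.map f, hP.map f, fun R hR hxR => ?_⟩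
  have hfin : Finite H := Finite.of_surjective f hf
  let K := R.comap f
  let g : K →* R := f.subgroupComap R
  have hg : Function.Surjective g := by
    rintro ⟨r, hr⟩
    obtain ⟨a, rfl⟩ := hf r
    exact ⟨⟨a, hr⟩, rfl⟩
  have hxK : IsPGroup 2 (Subgroup.zpowers (⟨x, hxR⟩ : K)) :=
    isPGroup_zpowers (hx.imp fun k hk => Subtype.ext hk)
  obtain ⟨Q, hQ⟩ := hxK.exists_le_sylow
  have hQR : (Q : Subgroup K).map g = ⊤ := by
    have := (Q.mapSurjective hg).is_maximal' (hR.to_subgroup ⊤) le_top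
    simpa using this.symm
  have hQP : (Q : Subgroup K).map K.subtype ≤ P :=
    hmax _ (Q.isPGroup'.map _) ⟨⟨x, hxR⟩, hQ (Subgroup.mem_zpowers _), rfl⟩
  intro r hr
  obtain ⟨a, ha, har⟩ : (⟨r, hr⟩ : R) ∈ (Q : Subgroup K).map g := hQR ▸ Subgroup.mem_top _
  exact ⟨a, hQP ⟨a, ha, rfl⟩, congrArg Subtype.val har⟩

theorem isPGroup_closure_of_commute {p : ℕ} {s : Set G} (hs : ∀ a ∈ s, ∀ b ∈ s, Commute a b)
    (hp : ∀ a ∈ s, ∃ k, a ^ p ^ k = 1) : IsPGroup p (Subgroup.closure s) := by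
  have hcomm : ∀ a ∈ Subgroup.closure s, ∀ b ∈ Subgroup.closure s, Commute a b := by
    intro a ha b hb
    have : IsMulCommutative (Subgroup.closure s) := Subgroup.isMulCommutative_closure hs
    exact setLike_mul_comm ha hb
  rw [isPGroup_iff_pow_pow_eq_one]
  rintro ⟨a, ha⟩
  suffices ∃ k, a ^ p ^ k = 1 from this.imp fun k hk => Subtype.ext hk
  induction ha using Subgroup.closure_induction with
  | mem a ha => exact hp a ha
  | one => exact ⟨0, by simp⟩
  | mul a b ha hb iha ihb =>
    obtain ⟨k, hk⟩ := iha
    obtain ⟨l, hl⟩ := ihb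
    refine ⟨k + l, ?_⟩
    rw [(hcomm a ha b hb).mul_pow, pow_add, pow_mul, hk, mul_comm, pow_mul, hl]
    simp
  | inv a ha iha => exact iha.imp fun k hk => by simp [hk]

/-- If the conjugates of `a` under powers of `x` commute with `a`, then the `2`-elements `x` and
`a` lie in a common `2`-subgroup. -/
theorem exists_isPGroup_of_commute_conj [Finite G] {p : ℕ} {x a : G} (hx : ∃ k, x ^ p ^ k = 1)
    (ha : ∃ k, a ^ p ^ k = 1) (hc : ∀ j : ℤ, Commute (x ^ j * a * (x ^ j)⁻¹) a) :
    ∃ Q : Subgroup G, IsPGroup p Q ∧ x ∈ Q ∧ a ∈ Q := by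
  let s : Set G := Set.range fun j : ℤ => x ^ j * a * (x ^ j)⁻¹
  have hN : IsPGroup p (Subgroup.closure s) := by
    refine isPGroup_closure_of_commute ?_ ?_
    · rintro _ ⟨i, rfl⟩ _ ⟨j, rfl⟩
      have h := (hc (i - j)).conj (x ^ j)
      convert h using 1
      rw [zpow_sub]
      group
    · rintro _ ⟨i, rfl⟩
      exact ha.imp fun k hk => by rw [conj_pow, hk]; simp
  have hnorm : Subgroup.zpowers x ≤ Subgroup.normalizer (Subgroup.closure s : Set G) := by
    rw [Subgroup.zpowers_le]
    have hmap : (Subgroup.closure s).map (MulAut.conj x).toMonoidHom = Subgroup.closure s := by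
      rw [MonoidHom.map_closure]
      congr 1
      ext g
      constructor
      · rintro ⟨_, ⟨i, rfl⟩, rfl⟩
        exact ⟨1 + i, by simp [zpow_add, mul_assoc]⟩
      · rintro ⟨i, rfl⟩
        refine ⟨_, ⟨-1 + i, rfl⟩, by simp [zpow_add, mul_assoc]⟩
    exact Subgroup.mem_normalizer_iff_map_conj_eq.2 hmap
  refine ⟨Subgroup.zpowers x ⊔ Subgroup.closure s,
    (isPGroup_zpowers hx).to_sup_of_normal_right' hN hnorm,
    Subgroup.mem_sup_left (Subgroup.mem_zpowers x),
    Subgroup.mem_sup_right (Subgroup.subset_closure ⟨0, by simp⟩)⟩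

theorem IsPicky.exists_mul_pow_eq_one [Finite G] {x a b : G} (h : IsPicky x)
    (hx : ∃ k, x ^ 2 ^ k = 1) (ha : ∃ k, a ^ 2 ^ k = 1) (hb : ∃ k, b ^ 2 ^ k = 1)
    (hca : ∀ j : ℤ, Commute (x ^ j * a * (x ^ j)⁻¹) a)
    (hcb : ∀ j : ℤ, Commute (x ^ j * b * (x ^ j)⁻¹) b) : ∃ k, (a * b) ^ 2 ^ k = 1 := by
  obtain ⟨P, hP, hmax⟩ := h
  obtain ⟨Q, hQ, hxQ, haQ⟩ := exists_isPGroup_of_commute_conj hx ha hca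
  obtain ⟨R, hR, hxR, hbR⟩ := exists_isPGroup_of_commute_conj hx hb hcb
  obtain ⟨k, hk⟩ := (isPGroup_iff_pow_pow_eq_one.1 hP)
    ⟨a * b, mul_mem (hmax Q hQ hxQ haQ) (hmax R hR hxR hbR)⟩
  exact ⟨k, congrArg Subtype.val hk⟩

/-- A permutation with three fixed points is not picky. -/
theorem Equiv.Perm.not_isPicky {α : Type*} [Fintype α] [DecidableEq α] {σ : Equiv.Perm α}
    (hσ : ∃ k, σ ^ 2 ^ k = 1) {i j l : α} (hi : σ i = i) (hj : σ j = j) (hl : σ l = l)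
    (hij : i ≠ j) (hil : i ≠ l) (hjl : j ≠ l) : ¬ IsPicky σ := by
  intro h
  have hcomm : ∀ a b : α, σ a = a → σ b = b → Commute σ (swap a b) := by
    intro a b ha hb
    rw [commute_iff_eq, ← mul_inv_eq_iff_eq_mul, ← Equiv.swap_apply_apply, ha, hb]
  have hconj : ∀ a b : α, σ a = a → σ b = b →
      ∀ m : ℤ, Commute (σ ^ m * swap a b * (σ ^ m)⁻¹) (swap a b) := by
    intro a b ha hb m
    rw [((hcomm a b ha hb).zpow_left m).eq, mul_inv_cancel_right]
  have htwo : ∀ a b : α, ∃ k, swap a b ^ 2 ^ k = 1 :=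
    fun a b => ⟨1, by rw [pow_one, pow_two, swap_mul_self]⟩
  obtain ⟨k, hk⟩ := h.exists_mul_pow_eq_one hσ (htwo i j) (htwo i l) (hconj i j hi hj)
    (hconj i l hi hl)
  have h3 : orderOf (swap i j * swap i l) = 3 :=
    (Equiv.Perm.isThreeCycle_swap_mul_swap_same hij hil hjl).orderOf
  have hd := orderOf_dvd_of_pow_eq_one hk
  rw [h3] at hd
  have := (Nat.prime_three).dvd_of_dvd_pow hd
  omega

end Picky

/-- The `2 × 2` matrices over `F`, with the adjugate as involution. -/
def Quat (F : Type*) : Type _ := Matrix (Fin 2) (Fin 2) F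

namespace Quat

variable {F : Type*} [Field F]

instance : Ring (Quat F) := inferInstanceAs (Ring (Matrix (Fin 2) (Fin 2) F))

instance : Algebra F (Quat F) := inferInstanceAs (Algebra F (Matrix (Fin 2) (Fin 2) F))

instance [Finite F] : Finite (Quat F) := inferInstanceAs (Finite (Matrix (Fin 2) (Fin 2) F))

instance : Nontrivial (Quat F) := inferInstanceAs (Nontrivial (Matrix (Fin 2) (Fin 2) F))

theorem _root_.Matrix.adjugate_adjugate_fin_two (a : Matrix (Fin 2) (Fin 2) F) :
    a.adjugate.adjugate = a := by
  rw [Matrix.adjugate_fin_two, Matrix.adjugate_fin_two]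
  ext i j
  fin_cases i <;> fin_cases j <;> simp

theorem _root_.Matrix.adjugate_add_fin_two (a b : Matrix (Fin 2) (Fin 2) F) :
    (a + b).adjugate = a.adjugate + b.adjugate := by
  rw [Matrix.adjugate_fin_two, Matrix.adjugate_fin_two, Matrix.adjugate_fin_two]
  ext i j
  fin_cases i <;> fin_cases j <;> simp [add_comm]

theorem _root_.Matrix.add_adjugate_fin_two (a : Matrix (Fin 2) (Fin 2) F) :
    a + a.adjugate = algebraMap F (Matrix (Fin 2) (Fin 2) F) a.trace := by
  rw [Matrix.adjugate_fin_two, Matrix.trace_fin_two]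
  ext i j
  fin_cases i <;> fin_cases j <;> simp [Matrix.algebraMap_matrix_apply, add_comm]

instance : StarRing (Quat F) where
  star a := Matrix.adjugate (n := Fin 2) a
  star_involutive a := Matrix.adjugate_adjugate_fin_two a
  star_mul a b := Matrix.adjugate_mul_distrib (n := Fin 2) a b
  star_add a b := Matrix.adjugate_add_fin_two a b

theorem star_def (a : Quat F) : star a = Matrix.adjugate (n := Fin 2) a := rfl

theorem add_star (a : Quat F) :
    a + star a = algebraMap F (Quat F) (Matrix.trace (n := Fin 2) a) :=
  Matrix.add_adjugate_fin_two a

theorem star_algebraMap (r : F) :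
    star (algebraMap F (Quat F) r) = algebraMap F (Quat F) r := by
  rw [star_def]
  change Matrix.adjugate (algebraMap F (Matrix (Fin 2) (Fin 2) F) r) =
    algebraMap F (Matrix (Fin 2) (Fin 2) F) r
  rw [Matrix.adjugate_fin_two]
  ext i j
  fin_cases i <;> fin_cases j <;> simp [Matrix.algebraMap_matrix_apply]

theorem star_smul' (r : F) (a : Quat F) : star (r • a) = r • star a := by
  rw [Algebra.smul_def, star_mul, star_algebraMap, Algebra.smul_def, Algebra.commutes]

theorem exists_sq_eq_neg_one :
    ∃ i : Quat F, i * star i = 1 ∧ i * i = -1 := by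
  have h1 : (!![0, -1; 1, 0] : Matrix (Fin 2) (Fin 2) F) *
      Matrix.adjugate !![0, -1; 1, 0] = 1 := by
    rw [Matrix.adjugate_fin_two]
    ext i j
    fin_cases i <;> fin_cases j <;> simp
  have h2 : (!![0, -1; 1, 0] : Matrix (Fin 2) (Fin 2) F) * !![0, -1; 1, 0] = -1 := by
    ext i j
    fin_cases i <;> fin_cases j <;> simp
  exact ⟨_, h1, h2⟩

theorem eq_one_or_eq_neg_one (h2 : (2 : F) ≠ 0) {u : Quat F} (hu : u * star u = 1)
    (hsq : u * u = 1) : u = 1 ∨ u = -1 := by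
  have hs : star u = u := by
    calc star u = (u * u) * star u := by rw [hsq, one_mul]
      _ = u := by rw [mul_assoc, hu, mul_one]
  obtain ⟨r, hr⟩ : ∃ r, u = algebraMap F (Quat F) r := by
    refine ⟨2⁻¹ * Matrix.trace (n := Fin 2) u, ?_⟩
    rw [map_mul, ← add_star, hs, ← Algebra.smul_def, ← two_smul F u, smul_smul,
      inv_mul_cancel₀ h2, one_smul]
  rw [hr, ← map_mul, ← map_one (algebraMap F (Quat F))] at hsq
  have := (algebraMap F (Quat F)).injective hsq
  rcases mul_self_eq_one_iff.1 this with h | h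
  · left; rw [hr, h, map_one]
  · right; rw [hr, h, map_neg, map_one]

theorem exists_pow_mul_pow_eq_neg_one (h2 : (2 : F) ≠ 0) (k : ℕ) :
    ∀ y : unitary (Quat F), y ^ 2 ^ k = 1 →
      (y : Quat F) = 1 ∨ (y : Quat F) = -1 ∨ ∃ m : ℕ, (y : Quat F) ^ m * (y : Quat F) ^ m = -1 := by
  induction k with
  | zero => intro y hy; left; simpa using congrArg Subtype.val hy
  | succ k ih =>
    intro y hy
    rcases ih (y ^ 2) (by rw [← pow_mul, ← pow_succ', hy]) with h | h | ⟨m, hm⟩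
    · have := eq_one_or_eq_neg_one h2 (Unitary.mul_star_self_of_mem y.2)
        (by simpa [pow_two] using h)
      tauto
    · exact Or.inr (Or.inr ⟨1, by simpa [pow_two] using h⟩)
    · exact Or.inr (Or.inr ⟨2 * m, by simpa [pow_mul] using hm⟩)

/-- The minimal polynomial of an element of norm one. -/
theorem mul_self_eq {y : Quat F} (hy : y * star y = 1) :
    y * y = Matrix.trace (n := Fin 2) y • y - 1 := by
  have h := add_star y
  have : star y = algebraMap F (Quat F) (Matrix.trace (n := Fin 2) y) - y := by
    rw [← h]; abel
  rw [this, mul_sub, ← Algebra.commutes, ← Algebra.smul_def] at hy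
  rw [← hy]; abel

theorem exists_pow_eq {y : Quat F} (hy : y * star y = 1) (m : ℕ) :
    ∃ a b : F, y ^ m = a • (1 : Quat F) + b • y := by
  induction m with
  | zero => exact ⟨1, 0, by simp⟩
  | succ m ih =>
    obtain ⟨a, b, h⟩ := ih
    refine ⟨-b, a + b * Matrix.trace (n := Fin 2) y, ?_⟩
    rw [pow_succ, h, add_mul, smul_mul_assoc, smul_mul_assoc, mul_self_eq hy, one_mul]
    module

/-- Either `y` has a square root of norm one commuting with an element `i` of norm one with
`i ^ 2 = -1`, or the trace `t` of `y` is such that `2 - t` is not a square. -/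
theorem exists_sqrt_or_not_isSquare (h2 : (2 : F) ≠ 0) {y : unitary (Quat F)}
    (hy : ∃ k, y ^ 2 ^ k = 1) :
    (∃ c i : Quat F, c * star c = 1 ∧ i * star i = 1 ∧ i * i = -1 ∧ c * i = i * c ∧
      c * c = y) ∨
    ((y : Quat F) ≠ 1 ∧ ¬ IsSquare (2 - Matrix.trace (n := Fin 2) (y : Quat F))) := by
  obtain ⟨k, hk⟩ := hy
  obtain ⟨i₀, hi₀, hi₀'⟩ := exists_sq_eq_neg_one (F := F)
  by_cases hy1 : (y : Quat F) = 1
  · exact Or.inl ⟨1, i₀, by simp, hi₀, hi₀', by simp, by simp [hy1]⟩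
  by_cases hym : (y : Quat F) = -1
  · exact Or.inl ⟨i₀, i₀, hi₀, hi₀, hi₀', rfl, by rw [hi₀', hym]⟩
  obtain ⟨m, hm⟩ : ∃ m : ℕ, (y : Quat F) ^ m * (y : Quat F) ^ m = -1 := by
    rcases exists_pow_mul_pow_eq_neg_one h2 k y hk with h | h | h
    exacts [absurd h hy1, absurd h hym, h]
  have hyy := Unitary.mul_star_self_of_mem y.2
  have hum : (y : Quat F) ^ m * star ((y : Quat F) ^ m) = 1 :=
    Unitary.mul_star_self_of_mem (y ^ m).2
  obtain ⟨a, b, hab⟩ := exists_pow_eq hyy m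
  generalize ht : Matrix.trace (n := Fin 2) (y : Quat F) = t
  have hmin := mul_self_eq hyy
  rw [ht] at hmin
  have htr := add_star (y : Quat F)
  rw [ht] at htr
  have hstar : star ((y : Quat F) ^ m) = -(y : Quat F) ^ m := by
    calc star ((y : Quat F) ^ m)
        = -((y : Quat F) ^ m * (y : Quat F) ^ m) * star ((y : Quat F) ^ m) := by
          rw [hm]; simp
      _ = -(y : Quat F) ^ m := by rw [neg_mul, mul_assoc, hum, mul_one]
  have hb : (2 - t) * (2 + t) * b ^ 2 = 4 := by
    have h1 : 2 * a + b * t = 0 := by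
      have h := hstar
      rw [hab, star_add, star_smul', star_smul', star_one,
        show star (y : Quat F) = t • 1 - y by rw [← Algebra.algebraMap_eq_smul_one, ← htr]; abel]
        at h
      have h' : (2 * a + b * t) • (1 : Quat F) = 0 := by
        rw [← sub_eq_zero] at h
        rw [← h]; module
      exact (smul_eq_zero.1 h').resolve_right one_ne_zero
    have h3 : a ^ 2 + a * b * t + b ^ 2 = 1 := by
      have h := hm
      rw [hab, add_mul, mul_add, mul_add, smul_mul_smul_comm, smul_mul_smul_comm,
        smul_mul_smul_comm, smul_mul_smul_comm, hmin, one_mul, mul_one, one_mul] at h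
      have h' : (a ^ 2 - b ^ 2 + 1) • (1 : Quat F) + (b * (2 * a + b * t)) • (y : Quat F) = 0 := by
        rw [← sub_eq_zero] at h
        rw [← h]; module
      rw [h1, mul_zero, zero_smul, add_zero] at h'
      have h'' := (smul_eq_zero.1 h').resolve_right one_ne_zero
      linear_combination (-1 : F) * h'' + a * h1
    linear_combination 4 * h3 - (2 * a + b * t) * h1
  by_cases hsq : IsSquare (2 - t)
  · left
    obtain ⟨r, hr⟩ := hsq
    have h4 : (4 : F) ≠ 0 := by
      rw [show (4 : F) = 2 * 2 by norm_num]; exact mul_ne_zero h2 h2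
    have hr0 : r ≠ 0 := by
      rintro rfl
      rw [hr] at hb
      exact h4 (by linear_combination -hb)
    have hb0 : b ≠ 0 := by
      rintro rfl
      exact h4 (by linear_combination -hb)
    have hst : (2 + t) * (r * b / 2) ^ 2 = 1 := by
      rw [hr] at hb
      field_simp
      linear_combination hb
    set s := r * b / 2
    refine ⟨s • (y + 1), y ^ m, ?_, hum, hm, ?_, ?_⟩
    · rw [star_smul', star_add, star_one, smul_mul_smul_comm, mul_add, add_mul, hyy, mul_one,
        one_mul, show (1 : Quat F) + star (y : Quat F) + (y + 1) = (y + star (y : Quat F)) + (2 : F) • 1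
          by rw [two_smul]; abel, htr, Algebra.algebraMap_eq_smul_one, ← add_smul, smul_smul,
        show s * s * (t + 2) = 1 by linear_combination hst, one_smul]
    · rw [smul_mul_assoc, mul_smul_comm, add_mul, mul_add, one_mul, mul_one, ← pow_succ,
        ← pow_succ']
    · rw [smul_mul_smul_comm, mul_add, add_mul, hmin, mul_one, one_mul,
        show t • (y : Quat F) - 1 + y + (y + 1) = (2 + t) • (y : Quat F) by module, smul_smul,
        show s * s * (2 + t) = 1 by linear_combination hst, one_smul]
  · exact Or.inr ⟨hy1, hsq⟩

end Quat

section Pairs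

variable {G : Type*} [Group G]

open Matrix

variable {F : Type*} [Field F]

/-- The `2`-element `f` generates with `z` a `2`-group containing commuting `f` and
`z * f * z⁻¹`. -/
structure IsLinked (z f : G) : Prop where
  exists_pow_eq_one : ∃ k, f ^ 2 ^ k = 1
  commute_sq : Commute (z ^ 2) f
  commute_conj : Commute (z * f * z⁻¹) f

theorem IsLinked.of_swap {z f f' : G} (hf : ∃ k, f ^ 2 ^ k = 1) (h1 : z * f = f' * z)
    (h2 : z * f' = f * z) (h3 : f' * f = f * f') : IsLinked z f := by
  refine ⟨hf, ?_, ?_⟩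
  · rw [commute_iff_eq, pow_two, mul_assoc, h1, ← mul_assoc, h2, mul_assoc]
  · rw [h1, mul_inv_cancel_right]; exact h3

set_option linter.unusedSimpArgs false in
set_option maxHeartbeats 2000000 in
theorem exists_isLinked_of_sqrt [Finite F] (h2 : (2 : F) ≠ 0) {c i : Quat F} (hc : c * star c = 1)
    (hi : i * star i = 1) (hii : i * i = -1) (hci : c * i = i * c)
    {z : unitary (Matrix (Fin 2) (Fin 2) (Quat F))}
    (hz : (z : Matrix (Fin 2) (Fin 2) (Quat F)) = !![0, c * c; 1, 0]) :
    ∃ f g, IsLinked z f ∧ IsLinked z g ∧ ∀ k, (f * g) ^ 2 ^ k ≠ 1 := by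
  obtain ⟨h, hh⟩ : ∃ h : F, h + h = 1 := ⟨2⁻¹, by rw [← two_mul, mul_inv_cancel₀ h2]⟩
  have his : star i = -i := by
    calc star i = -(i * i) * star i := by rw [hii]; simp
      _ = -i := by rw [neg_mul, mul_assoc, hi, mul_one]
  obtain ⟨d, hd⟩ : ∃ d, star c = d := ⟨_, rfl⟩
  have hds : star d = c := by rw [← hd, star_star]
  rw [hd] at hc
  have hsc : star d * star c = 1 := by rw [← star_mul, hc, star_one]
  have hdc : d * c = 1 := by
    exact mul_eq_one_comm.1 hc
  have hdi : d * i = i * d := by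
    calc d * i = d * i * (c * d) := by rw [hc, mul_one]
      _ = d * (c * i) * d := by rw [hci]; simp only [mul_assoc]
      _ = i * d := by rw [← mul_assoc d, hdc, one_mul]
  have hii' : ∀ x, i * (i * x) = -x := fun x => by rw [← mul_assoc, hii, neg_one_mul]
  have hci' : ∀ x, c * (i * x) = i * (c * x) := fun x => by rw [← mul_assoc, hci, mul_assoc]
  have hdi' : ∀ x, d * (i * x) = i * (d * x) := fun x => by rw [← mul_assoc, hdi, mul_assoc]
  have hcc : ∀ x, c * (d * x) = x := fun x => by rw [← mul_assoc, hc, one_mul]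
  have hcc' : ∀ x, d * (c * x) = x := fun x => by rw [← mul_assoc, hdc, one_mul]
  let e : Matrix (Fin 2) (Fin 2) (Quat F) :=
    !![h • (1 - i), h • (1 + i) * c; h • (1 + i) * d, h • (1 - i)]
  let w : Matrix (Fin 2) (Fin 2) (Quat F) := !![0, c; d, 0]
  let f : Matrix (Fin 2) (Fin 2) (Quat F) := !![i, 0; 0, 1]
  let f' : Matrix (Fin 2) (Fin 2) (Quat F) := !![1, 0; 0, i]
  let p : Matrix (Fin 2) (Fin 2) (Quat F) :=
    !![h • (1 + i), h • (1 + i) * c; -(h • (1 - i) * d), h • (1 - i)]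
  have he : e * star e = 1 := by
    ext a b
    fin_cases a <;> fin_cases b <;>
    simp [e, Matrix.mul_apply, Fin.sum_univ_two, Matrix.star_apply, Quat.star_smul', mul_add,
      add_mul, mul_sub, sub_mul, mul_assoc, his, hd, hds, hii, hii', hci, hci', hdi, hdi', hc,
      hdc, hcc, hcc', smul_mul_assoc, mul_smul_comm, smul_smul] <;>
    match_scalars <;> grind
  have hew : e * e = w := by
    ext a b
    fin_cases a <;> fin_cases b <;>
    simp [e, w, Matrix.mul_apply, Fin.sum_univ_two, mul_add,
      add_mul, mul_sub, sub_mul, mul_assoc, his, hd, hds, hii, hii', hci, hci', hdi, hdi', hc,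
      hdc, hcc, hcc', smul_mul_assoc, mul_smul_comm, smul_smul] <;>
    match_scalars <;> grind
  have hw : w * w = 1 := by
    ext a b
    fin_cases a <;> fin_cases b <;> simp [w, Matrix.mul_apply, Fin.sum_univ_two, hc, hdc]
  have hez : !![0, c * c; 1, 0] * e = e * !![0, c * c; 1, 0] := by
    ext a b
    fin_cases a <;> fin_cases b <;>
    simp [e, Matrix.mul_apply, Fin.sum_univ_two, mul_add,
      add_mul, mul_sub, sub_mul, mul_assoc, hii, hii', hci, hci', hdi, hdi', hc,
      hdc, hcc, hcc', smul_mul_assoc, mul_smul_comm]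
  have hf : f * star f = 1 := by
    ext a b
    fin_cases a <;> fin_cases b <;>
    simp [f, Matrix.mul_apply, Fin.sum_univ_two, Matrix.star_apply, hi]
  have hf' : f' * star f' = 1 := by
    ext a b
    fin_cases a <;> fin_cases b <;>
    simp [f', Matrix.mul_apply, Fin.sum_univ_two, Matrix.star_apply, hi]
  have hff' : f' * f = f * f' := by
    ext a b
    fin_cases a <;> fin_cases b <;> simp [f, f', Matrix.mul_apply, Fin.sum_univ_two]
  have hf4 : (f * f) * (f * f) = 1 := by
    ext a b
    fin_cases a <;> fin_cases b <;> simp [f, Matrix.mul_apply, Fin.sum_univ_two, hii]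
  have hzf : !![0, c * c; 1, 0] * f = f' * !![0, c * c; 1, 0] := by
    ext a b
    fin_cases a <;> fin_cases b <;> simp [f, f', Matrix.mul_apply, Fin.sum_univ_two]
  have hzf' : !![0, c * c; 1, 0] * f' = f * !![0, c * c; 1, 0] := by
    ext a b
    fin_cases a <;> fin_cases b <;>
    simp [f, f', Matrix.mul_apply, Fin.sum_univ_two, hci, hci', mul_assoc]
  have hef : e * f = p := by
    ext a b
    fin_cases a <;> fin_cases b <;>
    simp [e, f, p, Matrix.mul_apply, Fin.sum_univ_two, mul_add,
      add_mul, mul_sub, sub_mul, mul_assoc, hii, hii', hci, hci', hdi, hdi', hc,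
      hdc, hcc, hcc', smul_mul_assoc, mul_smul_comm, smul_smul, ← sub_eq_add_neg] <;>
    module
  have hp : p * p = p - 1 := by
    ext a b
    fin_cases a <;> fin_cases b <;>
    simp [p, Matrix.mul_apply, Fin.sum_univ_two, mul_add,
      add_mul, mul_sub, sub_mul, mul_assoc, hii, hii', hci, hci', hdi, hdi', hc,
      hdc, hcc, hcc', smul_mul_assoc, mul_smul_comm, smul_smul] <;>
    match_scalars <;> grind
  have hp01 : p 0 1 ≠ 0 := by
    intro h0
    have h1 : (1 - i) * (p 0 1 * d) = 1 := by
      simp [p, mul_add,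
        add_mul, mul_sub, sub_mul, mul_assoc, hii, hii', hci, hci', hdi, hdi', hc,
        hdc, hcc, hcc', smul_mul_assoc, mul_smul_comm]
      match_scalars <;> grind
    rw [h0] at h1
    simp at h1
  have hmem : ∀ m : Matrix (Fin 2) (Fin 2) (Quat F), m * star m = 1 → m ∈ unitary _ :=
    fun m hm => ⟨mul_eq_one_comm.1 hm, hm⟩
  refine ⟨⟨e, hmem e he⟩, ⟨f, hmem f hf⟩, ?_, ?_, fun k hk => ?_⟩
  · have hze : z * ⟨e, hmem e he⟩ = ⟨e, hmem e he⟩ * z :=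
      Subtype.ext (by simpa only [Submonoid.coe_mul, hz] using hez)
    refine .of_swap ⟨2, Subtype.ext ?_⟩ hze hze rfl
    change e ^ 4 = 1
    rw [show 4 = 2 * 2 from rfl, pow_mul, pow_two e, hew, pow_two, hw]
  · refine .of_swap (f' := ⟨f', hmem f' hf'⟩) ⟨2, Subtype.ext ?_⟩ ?_ ?_ ?_
    · change f ^ 4 = 1
      rw [show 4 = 2 * 2 from rfl, pow_mul, pow_two f, pow_two, hf4]
    · exact Subtype.ext (by simpa only [Submonoid.coe_mul, hz] using hzf)
    · exact Subtype.ext (by simpa only [Submonoid.coe_mul, hz] using hzf')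
    · exact Subtype.ext hff'
  · have hk' : p ^ 2 ^ k = 1 := by
      rw [← hef]; exact congrArg Subtype.val hk
    have key : p ^ 2 ^ k = p ∨ p ^ 2 ^ k = p - 1 ∨ p ^ 2 ^ k = -p := by
      clear hk hk'
      induction k with
      | zero => left; simp
      | succ k ih =>
        rw [pow_succ, pow_mul]
        rcases ih with h | h | h <;> rw [h, pow_two]
        · exact Or.inr (Or.inl hp)
        · right; right
          rw [sub_mul, mul_sub, hp, one_mul, mul_one]; abel
        · rw [neg_mul_neg]; exact Or.inr (Or.inl hp)
    apply hp01
    rw [hk'] at key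
    rcases key with h | h | h
    · rw [← h]; simp
    · rw [← add_eq_of_eq_sub h]; simp
    · rw [← neg_eq_iff_eq_neg.2 h]; simp

end Pairs

section

variable {F : Type*} [Field F]

theorem coeff_eq_zero_of_pow_eq_one {A : Type*} [Ring A] [Algebra F A] (h2 : (2 : F) ≠ 0) {δ : F}
    {η : A} (hη : η * η = δ • 1) (hδ : ¬ IsSquare (-δ))
    (hind : ∀ a b : F, a • 1 + b • η = 1 → b = 0) (k : ℕ) :
    ∀ a b : F, a ^ 2 - δ * b ^ 2 = 1 → (a • 1 + b • η) ^ 2 ^ k = 1 → b = 0 := by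
  induction k with
  | zero => intro a b _ h; exact hind a b (by simpa using h)
  | succ k ih =>
    intro a b hab h
    have hsq : (a • 1 + b • η) ^ 2 = (a ^ 2 + δ * b ^ 2) • 1 + (2 * a * b) • η := by
      rw [pow_two, add_mul, mul_add, mul_add, smul_mul_smul_comm, smul_mul_smul_comm,
        smul_mul_smul_comm, smul_mul_smul_comm, hη, one_mul, one_mul, mul_one]
      module
    rw [pow_succ', pow_mul, hsq] at h
    have h0 := ih _ _ (by linear_combination (a ^ 2 - δ * b ^ 2 + 1) * hab) h
    by_contra hb
    have ha : a = 0 := by simpa [h2, hb] using h0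
    refine hδ ⟨b⁻¹, ?_⟩
    field_simp
    rw [ha] at hab
    linear_combination hab

theorem exists_ne_zero_and_sub_eq_one [Finite F] (h2 : (2 : F) ≠ 0) (hF : 3 < Nat.card F) (δ : F) :
    ∃ a b : F, b ≠ 0 ∧ a ^ 2 - δ * b ^ 2 = 1 := by
  obtain ⟨s, hs, hs'⟩ : ∃ s : F, s ≠ 0 ∧ 1 - δ * s ^ 2 ≠ 0 := by
    by_cases hδ : δ = 1
    · obtain ⟨s, hs⟩ : ∃ s : F, s ∉ ({0, 1, -1} : Set F) := by
        by_contra! h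
        have h1 : ({0, 1, -1} : Set F) = Set.univ := Set.eq_univ_of_forall h
        have h3 : ({0, 1, -1} : Set F).ncard ≤ 3 := by
          refine (Set.ncard_insert_le _ _).trans (Nat.succ_le_succ ?_)
          exact (Set.ncard_insert_le _ _).trans (by simp)
        rw [h1, Set.ncard_univ] at h3
        omega
      simp only [Set.mem_insert_iff, Set.mem_singleton_iff, not_or] at hs
      refine ⟨s, hs.1, fun h => ?_⟩
      have : s * s = 1 := by rw [hδ] at h; linear_combination -h
      rcases mul_self_eq_one_iff.1 this with h | h
      exacts [hs.2.1 h, hs.2.2 h]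
    · exact ⟨1, one_ne_zero, fun h => hδ (by linear_combination -h)⟩
  refine ⟨(1 + δ * s ^ 2) / (1 - δ * s ^ 2), 2 * s / (1 - δ * s ^ 2),
    div_ne_zero (mul_ne_zero h2 hs) hs', ?_⟩
  field_simp
  ring

open Matrix

theorem exists_isLinked_of_not_isSquare [Finite F] (h2 : (2 : F) ≠ 0) (hF : 3 < Nat.card F)
    {y : Quat F} (hyy : y * star y = 1) (hy1 : y ≠ 1)
    (hsq : ¬ IsSquare (2 - Matrix.trace (n := Fin 2) y))
    {z : unitary (Matrix (Fin 2) (Fin 2) (Quat F))}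
    (hz : (z : Matrix (Fin 2) (Fin 2) (Quat F)) = !![0, y; 1, 0]) :
    ∃ f g, IsLinked z f ∧ IsLinked z g ∧ ∀ k, (f * g) ^ 2 ^ k ≠ 1 := by
  have htr := Quat.add_star y
  rw [Algebra.algebraMap_eq_smul_one] at htr
  generalize Matrix.trace (n := Fin 2) y = t at hsq htr
  obtain ⟨a, b, hb, hab⟩ := exists_ne_zero_and_sub_eq_one h2 hF (t - 2)
  obtain ⟨y', hy'⟩ : ∃ y', star y = y' := ⟨_, rfl⟩
  have hy's : star y' = y := by rw [← hy', star_star]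
  rw [hy'] at hyy htr
  have hyy' : y' * y = 1 := mul_eq_one_comm.1 hyy
  let η : Matrix (Fin 2) (Fin 2) (Quat F) := !![0, y - 1; 1 - y', 0]
  let d : Matrix (Fin 2) (Fin 2) (Quat F) := !![1, 0; 0, -1]
  let g : Matrix (Fin 2) (Fin 2) (Quat F) := a • 1 + b • η
  have hη : η * η = (t - 2) • 1 := by
    have h1 : (t - 2) • (1 : Quat F) = y + y' - 1 - 1 := by
      rw [htr]; module
    ext i j
    fin_cases i <;> fin_cases j <;>
    simp [η, Matrix.mul_apply, Fin.sum_univ_two, mul_sub, sub_mul, hyy, hyy', h1] <;> abel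
  have hηd : η * d = -(d * η) := by
    ext i j
    fin_cases i <;> fin_cases j <;> simp [η, d, Matrix.mul_apply, Fin.sum_univ_two]
  have hd : d * d = 1 := by
    ext i j
    fin_cases i <;> fin_cases j <;> simp [d, Matrix.mul_apply, Fin.sum_univ_two]
  have hds : star d = d := by
    ext i j
    fin_cases i <;> fin_cases j <;> simp [d, Matrix.star_apply]
  have hgs : star g = a • 1 - b • η := by
    ext i j
    fin_cases i <;> fin_cases j <;>
    simp [g, η, Matrix.star_apply, Quat.star_smul', hy', hy's] <;> module
  have hgg : (a • 1 - b • η) * g = 1 := by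
    simp only [g, sub_mul, mul_add, smul_mul_smul_comm, hη, one_mul, mul_one]
    calc _ = (a ^ 2 - (t - 2) * b ^ 2) • (1 : Matrix (Fin 2) (Fin 2) (Quat F)) := by module
      _ = 1 := by rw [hab, one_smul]
  have hgd : g * d = d * (a • 1 - b • η) := by
    simp only [g, add_mul, mul_sub, smul_mul_assoc, mul_smul_comm, hηd, one_mul, mul_one]
    module
  have hzη : !![0, y; 1, 0] * η = η * !![0, y; 1, 0] := by
    ext i j
    fin_cases i <;> fin_cases j <;>
    simp [η, Matrix.mul_apply, Fin.sum_univ_two, mul_sub, sub_mul, hyy, hyy']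
  have hzg : !![0, y; 1, 0] * g = g * !![0, y; 1, 0] := by
    simp only [g, mul_add, add_mul, smul_mul_assoc, mul_smul_comm, hzη, one_mul, mul_one]
  have hzd : !![0, y; 1, 0] * d = -d * !![0, y; 1, 0] := by
    ext i j
    fin_cases i <;> fin_cases j <;> simp [d, Matrix.mul_apply, Fin.sum_univ_two]
  have hdm : d ∈ unitary (Matrix (Fin 2) (Fin 2) (Quat F)) :=
    ⟨by rw [hds, hd], by rw [hds, hd]⟩
  have hgm : g ∈ unitary (Matrix (Fin 2) (Fin 2) (Quat F)) :=
    ⟨by rw [hgs, hgg], by rw [hgs]; exact mul_eq_one_comm.1 hgg⟩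
  have hnm : (-1 : Matrix (Fin 2) (Fin 2) (Quat F)) ∈
      unitary (Matrix (Fin 2) (Fin 2) (Quat F)) := by
    constructor <;> simp
  let D : unitary (Matrix (Fin 2) (Fin 2) (Quat F)) := ⟨d, hdm⟩
  let H : unitary (Matrix (Fin 2) (Fin 2) (Quat F)) := ⟨g, hgm⟩
  let N : unitary (Matrix (Fin 2) (Fin 2) (Quat F)) := ⟨-1, hnm⟩
  have hDD : D * D = 1 := Subtype.ext hd
  have hN : ∀ u, N * u = u * N := fun u => Subtype.ext (by simp [N])
  have hNN : N * N = 1 := Subtype.ext (by simp [N])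
  have hzD : z * D = N * D * z := Subtype.ext (by simpa [hz, N, D] using hzd)
  have hzH : z * H = H * z := Subtype.ext (by simpa [hz, H] using hzg)
  have hDH : D * H * (D * H) = 1 := by
    refine Subtype.ext ?_
    change d * g * (d * g) = 1
    rw [mul_assoc, ← mul_assoc g, hgd, ← mul_assoc, ← mul_assoc, hd, one_mul, hgg]
  have key : ∀ u, u * u = 1 → z * u = N * u * z → IsLinked z u := by
    intro u hu hzu
    refine .of_swap (f' := N * u) ⟨1, by rw [pow_one, pow_two, hu]⟩ hzu ?_ ?_
    · rw [← mul_assoc, ← hN, mul_assoc, hzu, ← mul_assoc, ← mul_assoc, hNN, one_mul]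
    · rw [← mul_assoc, ← hN]
  refine ⟨D, D * H, key D hDD hzD, key _ hDH ?_, fun k hk => ?_⟩
  · rw [← mul_assoc, hzD, mul_assoc, hzH, mul_assoc, mul_assoc, mul_assoc]
  · rw [← mul_assoc, hDD, one_mul] at hk
    refine hb (coeff_eq_zero_of_pow_eq_one h2 hη (by rwa [neg_sub]) ?_ k a b hab
      (congrArg Subtype.val hk))
    intro a b h
    have h01 := congrFun (congrFun h 0) 1
    simp [η, sub_eq_zero, hy1] at h01
    exact h01

theorem exists_isLinked_pair [Finite F] (h2 : (2 : F) ≠ 0) (hF : 3 < Nat.card F)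
    {y : unitary (Quat F)} (hy : ∃ k, y ^ 2 ^ k = 1)
    {z : unitary (Matrix (Fin 2) (Fin 2) (Quat F))}
    (hz : (z : Matrix (Fin 2) (Fin 2) (Quat F)) = !![0, (y : Quat F); 1, 0]) :
    ∃ f g, IsLinked z f ∧ IsLinked z g ∧ ∀ k, (f * g) ^ 2 ^ k ≠ 1 := by
  rcases Quat.exists_sqrt_or_not_isSquare h2 hy with ⟨c, i, hc, hi, hii, hci, hcy⟩ | ⟨hy1, hsq⟩
  · exact exists_isLinked_of_sqrt h2 hc hi hii hci (by rw [hz, hcy])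
  · exact exists_isLinked_of_not_isSquare h2 hF (Unitary.mul_star_self_of_mem y.2) hy1 hsq hz

end

section

theorem IsLinked.commute_zpow {G : Type*} [Group G] {z f : G} (h : IsLinked z f) (l : ℤ) :
    Commute (z ^ l * f * (z ^ l)⁻¹) f := by
  have h1 (m : ℤ) : Commute (z ^ (2 * m)) f := by
    rw [_root_.zpow_mul, zpow_two, ← pow_two]; exact h.commute_sq.zpow_left m
  rcases Int.even_or_odd' l with ⟨m, rfl | rfl⟩
  · rw [(h1 m).eq, mul_inv_cancel_right]
  · have h2 : z ^ (2 * m + 1) * f * (z ^ (2 * m + 1))⁻¹ = z * f * z⁻¹ := by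
      rw [add_comm, zpow_add, zpow_one, mul_assoc z, (h1 m).eq, mul_inv_rev]
      group
    rw [h2]
    exact h.commute_conj

open Matrix

variable {A : Type*} [Ring A] [StarRing A] {n m : Type*} [Fintype n] [DecidableEq n] [Fintype m]
  [DecidableEq m]

theorem coe_inv_unitary {R : Type*} [Monoid R] [StarMul R] (u : unitary R) :
    ((u⁻¹ : unitary R) : R) = star (u : R) := rfl

/-- The embedding of unitary groups attached to an orthonormal family. -/
def unitaryEmbedding (E : Matrix n m A) (hE : Eᴴ * E = 1) :
    unitary (Matrix m m A) →* unitary (Matrix n n A) :=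
  have hmul (a b : Matrix m m A) : (1 + E * (a - 1) * Eᴴ) * (1 + E * (b - 1) * Eᴴ) =
      1 + E * (a * b - 1) * Eᴴ := by
    have h1 : E * (a - 1) * Eᴴ * (E * (b - 1) * Eᴴ) = E * ((a - 1) * (b - 1)) * Eᴴ := by
      calc _ = E * (a - 1) * (Eᴴ * E) * (b - 1) * Eᴴ := by simp only [Matrix.mul_assoc]
        _ = _ := by rw [hE]; simp only [Matrix.mul_assoc, Matrix.mul_one]
    rw [add_mul, one_mul, mul_add, mul_one, h1, add_assoc, ← Matrix.add_mul,
      ← Matrix.add_mul, ← Matrix.mul_add, ← Matrix.mul_add]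
    congr 4
    noncomm_ring
  have hstar (a : Matrix m m A) :
      star (1 + E * (a - 1) * Eᴴ) = 1 + E * (star a - 1) * Eᴴ := by
    simp [star_eq_conjTranspose, Matrix.mul_assoc]
  { toFun := fun g => ⟨1 + E * ((g : Matrix m m A) - 1) * Eᴴ, by
      rw [Unitary.mem_iff, hstar, hmul, hmul]
      simp⟩
    map_one' := Subtype.ext (by simp)
    map_mul' := fun a b => Subtype.ext (hmul a b).symm }

theorem coe_unitaryEmbedding (E : Matrix n m A) (hE : Eᴴ * E = 1) (g : unitary (Matrix m m A)) :
    (unitaryEmbedding E hE g : Matrix n n A) = 1 + E * ((g : Matrix m m A) - 1) * Eᴴ := rfl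

theorem unitaryEmbedding_injective (E : Matrix n m A) (hE : Eᴴ * E = 1) :
    Function.Injective (unitaryEmbedding E hE) := by
  refine (injective_iff_map_eq_one _).2 fun g hg => Subtype.ext ?_
  have h1 : E * ((g : Matrix m m A) - 1) * Eᴴ = 0 := by
    have := congrArg Subtype.val hg
    rw [coe_unitaryEmbedding] at this
    simpa using this
  have h2 : Eᴴ * (E * ((g : Matrix m m A) - 1) * Eᴴ) * E = (g : Matrix m m A) - 1 := by
    calc _ = (Eᴴ * E) * ((g : Matrix m m A) - 1) * (Eᴴ * E) := by simp only [Matrix.mul_assoc]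
      _ = _ := by rw [hE, Matrix.one_mul, Matrix.mul_one]
  rw [h1, Matrix.mul_zero, Matrix.zero_mul] at h2
  exact (sub_eq_zero.1 h2.symm)

theorem zpow_mul_eq {x : unitary (Matrix n n A)} {E : Matrix n m A} {z : unitary (Matrix m m A)}
    (h : (x : Matrix n n A) * E = E * (z : Matrix m m A)) (l : ℤ) :
    ((x ^ l : unitary (Matrix n n A)) : Matrix n n A) * E =
      E * ((z ^ l : unitary (Matrix m m A)) : Matrix m m A) := by
  have hnat (l : ℕ) : ((x ^ l : unitary (Matrix n n A)) : Matrix n n A) * E =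
      E * ((z ^ l : unitary (Matrix m m A)) : Matrix m m A) := by
    induction l with
    | zero => simp
    | succ l ih =>
      rw [pow_succ', pow_succ, Submonoid.coe_mul, Submonoid.coe_mul, Matrix.mul_assoc, ih,
        ← Matrix.mul_assoc, h, Matrix.mul_assoc, ← Submonoid.coe_mul, ← Submonoid.coe_mul,
        ← pow_succ, pow_succ']
  have hinv {x : unitary (Matrix n n A)} {z : unitary (Matrix m m A)}
      (h : (x : Matrix n n A) * E = E * (z : Matrix m m A)) :
      ((x⁻¹ : unitary (Matrix n n A)) : Matrix n n A) * E =
        E * ((z⁻¹ : unitary (Matrix m m A)) : Matrix m m A) := by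
    have hz : (z : Matrix m m A) * ((z⁻¹ : unitary (Matrix m m A)) : Matrix m m A) = 1 := by
      rw [← Submonoid.coe_mul, mul_inv_cancel, Submonoid.coe_one]
    have hx : ((x⁻¹ : unitary (Matrix n n A)) : Matrix n n A) * (x : Matrix n n A) = 1 := by
      rw [← Submonoid.coe_mul, inv_mul_cancel, Submonoid.coe_one]
    calc _ = ((x⁻¹ : unitary (Matrix n n A)) : Matrix n n A) * (E * (z : Matrix m m A)) *
          ((z⁻¹ : unitary (Matrix m m A)) : Matrix m m A) := by
          rw [Matrix.mul_assoc, Matrix.mul_assoc, hz, Matrix.mul_one]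
      _ = _ := by rw [← h, ← Matrix.mul_assoc, hx, Matrix.one_mul]
  cases l with
  | ofNat l => simpa using hnat l
  | negSucc l => simpa [zpow_negSucc] using hinv (hnat (l + 1))

theorem conj_unitaryEmbedding {x : unitary (Matrix n n A)} {E : Matrix n m A} (hE : Eᴴ * E = 1)
    {z : unitary (Matrix m m A)} (h : (x : Matrix n n A) * E = E * (z : Matrix m m A))
    (g : unitary (Matrix m m A)) :
    x * unitaryEmbedding E hE g * x⁻¹ = unitaryEmbedding E hE (z * g * z⁻¹) := by
  have hx : (x : Matrix n n A) * star (x : Matrix n n A) = 1 := Unitary.mul_star_self_of_mem x.2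
  have hz : (z : Matrix m m A) * star (z : Matrix m m A) = 1 := Unitary.mul_star_self_of_mem z.2
  have h' : Eᴴ * star (x : Matrix n n A) = star (z : Matrix m m A) * Eᴴ := by
    rw [star_eq_conjTranspose, star_eq_conjTranspose, ← conjTranspose_mul, h, conjTranspose_mul]
  refine Subtype.ext ?_
  simp only [Submonoid.coe_mul, coe_unitaryEmbedding, coe_inv_unitary]
  calc _ = (x : Matrix n n A) * star (x : Matrix n n A) +
        ((x : Matrix n n A) * E) * ((g : Matrix m m A) - 1) * (Eᴴ * star (x : Matrix n n A)) := by
        simp only [mul_add, add_mul, mul_one, Matrix.mul_assoc]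
    _ = 1 + E * ((z : Matrix m m A) * ((g : Matrix m m A) - 1) * star (z : Matrix m m A)) * Eᴴ := by
        rw [hx, h, h']; simp only [Matrix.mul_assoc]
    _ = _ := by rw [mul_sub, sub_mul, mul_one, hz]

theorem commute_conj_unitaryEmbedding {x : unitary (Matrix n n A)} {E : Matrix n m A}
    (hE : Eᴴ * E = 1) {z : unitary (Matrix m m A)} {k : ℕ}
    (h : ((x ^ k : unitary (Matrix n n A)) : Matrix n n A) * E = E * (z : Matrix m m A))
    (h0 : ∀ j : ℤ, ¬ (k : ℤ) ∣ j →
      Eᴴ * (((x ^ j : unitary (Matrix n n A)) : Matrix n n A) * E) = 0)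
    {f : unitary (Matrix m m A)} (hf : IsLinked z f) (j : ℤ) :
    Commute (x ^ j * unitaryEmbedding E hE f * (x ^ j)⁻¹) (unitaryEmbedding E hE f) := by
  by_cases hkj : (k : ℤ) ∣ j
  · obtain ⟨l, rfl⟩ := hkj
    rw [_root_.zpow_mul, zpow_natCast, conj_unitaryEmbedding hE (zpow_mul_eq h l)]
    exact (hf.commute_zpow l).map _
  · have h1 := h0 j hkj
    have h2 := h0 (-j) (by rwa [dvd_neg])
    rw [_root_.zpow_neg] at h2
    generalize x ^ j = u at h1 h2
    refine Subtype.ext ?_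
    have huu : (u : Matrix n n A) * star (u : Matrix n n A) = 1 := Unitary.mul_star_self_of_mem u.2
    simp only [coe_inv_unitary] at h2
    simp only [Submonoid.coe_mul, coe_unitaryEmbedding, coe_inv_unitary]
    generalize (f : Matrix m m A) - 1 = p
    have h3 : (u : Matrix n n A) * (1 + E * p * Eᴴ) * star (u : Matrix n n A) =
        1 + (u : Matrix n n A) * (E * p * Eᴴ) * star (u : Matrix n n A) := by
      rw [mul_add, add_mul, mul_one, huu]
    have h4 : (u : Matrix n n A) * (E * p * Eᴴ) * star (u : Matrix n n A) * (E * p * Eᴴ) = 0 := by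
      calc _ = (u : Matrix n n A) * (E * p * (Eᴴ * (star (u : Matrix n n A) * E)) * p * Eᴴ) := by
            simp only [Matrix.mul_assoc]
        _ = 0 := by rw [h2]; simp
    have h5 : (E * p * Eᴴ) * ((u : Matrix n n A) * (E * p * Eᴴ) * star (u : Matrix n n A)) = 0 := by
      calc _ = E * p * (Eᴴ * ((u : Matrix n n A) * E)) * p * Eᴴ * star (u : Matrix n n A) := by
            simp only [Matrix.mul_assoc]
        _ = 0 := by rw [h1]; simp
    rw [h3]
    simp only [add_mul, mul_add, h4, h5, mul_one, one_mul, add_zero]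
    abel

end

section

open Matrix

variable {F : Type*} [Field F] [Finite F] {n : Type*} [Fintype n] [DecidableEq n]

theorem IsPicky.false_of_column (h2 : (2 : F) ≠ 0) (hF : 3 < Nat.card F)
    {x : unitary (Matrix n n (Quat F))} (hpicky : IsPicky x) (hx : ∃ k, x ^ 2 ^ k = 1)
    {k : ℕ} (hk : k ≠ 0) (i : n) {y : unitary (Quat F)} (hy : ∃ k, y ^ 2 ^ k = 1)
    (h0 : ∀ j : ℤ, ¬ (2 * k : ℤ) ∣ j →
      ((x ^ j : unitary (Matrix n n (Quat F))) : Matrix n n (Quat F)) i i = 0)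
    (hxy : ∀ r, ((x ^ (2 * k : ℤ) : unitary (Matrix n n (Quat F))) : Matrix n n (Quat F)) r i =
      (1 : Matrix n n (Quat F)) r i * (y : Quat F)) : False := by
  have hk' : (k : ℤ) ≠ 0 := by exact_mod_cast hk
  let E : Matrix n (Fin 2) (Quat F) := Matrix.of fun r c =>
    ((x ^ (k * (c.val : ℤ)) : unitary (Matrix n n (Quat F))) : Matrix n n (Quat F)) r i
  have hxE (j : ℤ) (r : n) (c : Fin 2) :
      (((x ^ j : unitary (Matrix n n (Quat F))) : Matrix n n (Quat F)) * E) r c =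
      ((x ^ (j + k * (c.val : ℤ)) : unitary (Matrix n n (Quat F))) : Matrix n n (Quat F)) r i := by
    rw [_root_.zpow_add, Submonoid.coe_mul]
    rfl
  have hEE (j : ℤ) (c d : Fin 2) :
      (Eᴴ * (((x ^ j : unitary (Matrix n n (Quat F))) : Matrix n n (Quat F)) * E)) c d =
      ((x ^ (j + k * ((d.val : ℤ) - c.val)) : unitary (Matrix n n (Quat F))) :
        Matrix n n (Quat F)) i i := by
    rw [show j + k * ((d.val : ℤ) - c.val) = -(k * (c.val : ℤ)) + (j + k * (d.val : ℤ)) by ring,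
      _root_.zpow_add, _root_.zpow_neg, Submonoid.coe_mul, coe_inv_unitary, Matrix.mul_apply,
      Matrix.mul_apply]
    refine Finset.sum_congr rfl fun r _ => ?_
    rw [hxE]
    rfl
  have hE : Eᴴ * E = 1 := by
    have h := hEE 0
    simp only [_root_.zpow_zero, Submonoid.coe_one, Matrix.one_mul, zero_add] at h
    ext1 c d
    rw [h]
    by_cases hcd : c = d
    · rw [hcd, sub_self, mul_zero, _root_.zpow_zero, Submonoid.coe_one, Matrix.one_apply_eq,
        Matrix.one_apply_eq]
    · rw [h0, Matrix.one_apply_ne hcd]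
      rintro ⟨a, ha⟩
      have h1 : (d.val : ℤ) - c.val = 2 * a := mul_left_cancel₀ hk' (by linarith)
      fin_cases c <;> fin_cases d <;> simp at h1 hcd <;> omega
  let z : Matrix (Fin 2) (Fin 2) (Quat F) := !![0, (y : Quat F); 1, 0]
  have hz : z * star z = 1 := by
    have := Unitary.mul_star_self_of_mem y.2
    ext a b
    fin_cases a <;> fin_cases b <;>
    simp [z, Matrix.mul_apply, Fin.sum_univ_two, Matrix.star_apply, this]
  let Z : unitary (Matrix (Fin 2) (Fin 2) (Quat F)) := ⟨z, mul_eq_one_comm.1 hz, hz⟩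
  have hEz : ((x ^ k : unitary (Matrix n n (Quat F))) : Matrix n n (Quat F)) * E = E * z := by
    ext1 r c
    rw [← zpow_natCast, hxE]
    fin_cases c
    · simp [z, E, Matrix.mul_apply, Fin.sum_univ_two]
    · simp [z, E, Matrix.mul_apply, Fin.sum_univ_two, ← hxy, two_mul]
  have hcomm {f : unitary (Matrix (Fin 2) (Fin 2) (Quat F))} (hf : IsLinked Z f) (j : ℤ) :
      Commute (x ^ j * unitaryEmbedding E hE f * (x ^ j)⁻¹) (unitaryEmbedding E hE f) := by
    refine commute_conj_unitaryEmbedding hE (z := Z) hEz (fun j hj => ?_) hf j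
    ext1 c d
    rw [hEE, h0, Matrix.zero_apply]
    rintro ⟨a, ha⟩
    exact hj ⟨2 * a - ((d.val : ℤ) - c.val), by linear_combination ha⟩
  have h2el {f : unitary (Matrix (Fin 2) (Fin 2) (Quat F))} (hf : ∃ k, f ^ 2 ^ k = 1) :
      ∃ k, unitaryEmbedding E hE f ^ 2 ^ k = 1 := by
    obtain ⟨k, hk⟩ := hf
    exact ⟨k, by rw [← map_pow, hk, map_one]⟩
  obtain ⟨f, g, hf, hg, hfg⟩ := exists_isLinked_pair h2 hF hy (z := Z) rfl
  obtain ⟨K, hK⟩ := hpicky.exists_mul_pow_eq_one hx (h2el hf.1) (h2el hg.1) (hcomm hf) (hcomm hg)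
  rw [← map_mul, ← map_pow] at hK
  exact hfg K (unitaryEmbedding_injective E hE (hK.trans (map_one _).symm))

end

section Monomial

open Matrix

variable {A : Type*} [Ring A] [StarRing A] {n : Type*} [Fintype n] [DecidableEq n]

/-- The wreath product of the unitary group of `A` with the symmetric group. -/
abbrev MonomialGroup (A : Type*) [Ring A] [StarRing A] (n : Type*) : Type _ :=
  (n → unitary A) ⋊[mulAutArrow] Equiv.Perm n

/-- The monomial matrix of an element of the wreath product. -/
def monomialMatrix (w : MonomialGroup A n) : Matrix n n A :=
  Matrix.of fun i j => if i = w.right j then (w.left i : A) else 0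

theorem monomialMatrix_apply (w : MonomialGroup A n) (i j : n) :
    monomialMatrix w i j = if i = w.right j then (w.left i : A) else 0 := rfl

theorem MonomialGroup.mul_left_apply (w v : MonomialGroup A n) (i : n) :
    (w * v).left i = w.left i * v.left (w.right⁻¹ i) := rfl

theorem monomialMatrix_mul (w v : MonomialGroup A n) :
    monomialMatrix w * monomialMatrix v = monomialMatrix (w * v) := by
  ext i j
  rw [Matrix.mul_apply, Finset.sum_eq_single (v.right j)]
  · simp only [monomialMatrix_apply, if_true]
    by_cases h : i = w.right (v.right j)
    · have : w.right⁻¹ i = v.right j := by rw [h]; simp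
      rw [if_pos h, if_pos (show i = (w * v).right j from h), MonomialGroup.mul_left_apply, this, Submonoid.coe_mul]
    · rw [if_neg h, if_neg (show ¬ i = (w * v).right j from h), zero_mul]
  · intro k _ hk
    simp [monomialMatrix_apply, hk]
  · simp

theorem monomialMatrix_mul_star (w : MonomialGroup A n) :
    monomialMatrix w * star (monomialMatrix w) = 1 := by
  ext i j
  rw [Matrix.mul_apply, Finset.sum_eq_single (w.right⁻¹ i)]
  · by_cases h : i = j
    · subst h
      simp [monomialMatrix_apply, Matrix.star_apply, Matrix.one_apply_eq]
    · simp [monomialMatrix_apply, Matrix.star_apply, Matrix.one_apply_ne h, Ne.symm h]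
  · intro k _ hk
    have : i ≠ w.right k := by rintro rfl; simp at hk
    simp [monomialMatrix_apply, this]
  · simp

theorem star_mul_monomialMatrix (w : MonomialGroup A n) :
    star (monomialMatrix w) * monomialMatrix w = 1 := by
  ext i j
  rw [Matrix.mul_apply, Finset.sum_eq_single (w.right i)]
  · by_cases h : i = j
    · subst h
      simp [monomialMatrix_apply, Matrix.star_apply, Matrix.one_apply_eq]
    · simp [monomialMatrix_apply, Matrix.star_apply, Matrix.one_apply_ne h, h]
  · intro k _ hk
    simp [monomialMatrix_apply, Matrix.star_apply, hk]
  · simp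

variable (A n) in
/-- The wreath product as a group of monomial matrices. -/
def monomialHom : MonomialGroup A n →* unitary (Matrix n n A) where
  toFun w := ⟨monomialMatrix w, star_mul_monomialMatrix w, monomialMatrix_mul_star w⟩
  map_one' := Subtype.ext (by ext i j; by_cases h : i = j <;> simp [monomialMatrix_apply, h])
  map_mul' w v := Subtype.ext (monomialMatrix_mul w v).symm

theorem monomialHom_apply (w : MonomialGroup A n) (i j : n) :
    (monomialHom A n w : Matrix n n A) i j = if i = w.right j then (w.left i : A) else 0 := rfl

theorem monomialHom_injective [Nontrivial A] : Function.Injective (monomialHom A n) := by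
  have hne (u : unitary A) : (u : A) ≠ 0 := fun h => by
    have := Unitary.mul_star_self_of_mem u.2
    rw [h, zero_mul] at this
    exact zero_ne_one this
  intro w v h
  have h' (i j : n) := congrFun (congrFun (congrArg Subtype.val h) i) j
  simp only [monomialHom_apply] at h'
  have hr : w.right = v.right := by
    ext j
    have := h' (w.right j) j
    rw [if_pos rfl] at this
    by_contra hc
    rw [if_neg hc] at this
    exact hne _ this
  refine SemidirectProduct.ext (funext fun i => Subtype.ext ?_) hr
  simpa [hr] using h' i (v.right⁻¹ i)

theorem MonomialGroup.pow_left_apply {w : MonomialGroup A n} {i : n} (hi : w.right i = i) (k : ℕ) :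
    (w ^ k).left i = w.left i ^ k := by
  induction k with
  | zero => simp
  | succ k ih =>
    have : w.right⁻¹ i = i := by rw [Equiv.Perm.inv_eq_iff_eq, hi]
    rw [pow_succ', MonomialGroup.mul_left_apply, this, ih, pow_succ']

end Monomial

section

open Matrix

variable {F : Type*} [Field F] [Finite F] {n : Type*} [Fintype n] [DecidableEq n]

theorem MonomialGroup.not_isPicky (h2 : (2 : F) ≠ 0) (hF : 3 < Nat.card F)
    (hn : 3 ≤ Fintype.card n) {w : MonomialGroup (Quat F) n} (hw : ∃ k, w ^ 2 ^ k = 1) :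
    ¬ IsPicky (monomialHom (Quat F) n w) := by
  intro hpicky
  have hσ : ∃ k, w.right ^ 2 ^ k = 1 := by
    obtain ⟨k, hk⟩ := hw
    refine ⟨k, ?_⟩
    have := congrArg SemidirectProduct.rightHom hk
    rwa [map_pow, map_one] at this
  have : Finite (MonomialGroup (Quat F) n) := Finite.of_injective _ monomialHom_injective
  have hpw : IsPicky w := IsPicky.of_injective monomialHom_injective hpicky
  have hpσ : IsPicky w.right :=
    hpw.map_of_surjective (f := SemidirectProduct.rightHom) SemidirectProduct.rightHom_surjective hw
  obtain ⟨i, hi⟩ : ∃ i, w.right i ≠ i := by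
    by_contra! h
    obtain ⟨a, b, c, hab, hac, hbc⟩ := Fintype.two_lt_card_iff.1 hn
    exact Equiv.Perm.not_isPicky hσ (h a) (h b) (h c) hab hac hbc hpσ
  have hright (j : ℤ) : (w ^ j).right = w.right ^ j := by
    have := map_zpow (SemidirectProduct.rightHom (φ := mulAutArrow (A := n) (M := unitary (Quat F)))) w j
    exact this
  have hper (j : ℤ) : (w.right ^ j) i = i ↔
      (Function.minimalPeriod (w.right • ·) i : ℤ) ∣ j :=
    MulAction.zpow_smul_eq_iff_minimalPeriod_dvd (a := w.right) (b := i)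
  obtain ⟨K, hK⟩ := hw
  obtain ⟨k, hk0, hk⟩ : ∃ k : ℕ, k ≠ 0 ∧ Function.minimalPeriod (w.right • ·) i = 2 * k := by
    have h1 : Function.minimalPeriod (w.right • ·) i ∣ 2 ^ K := by
      have := (hper (2 ^ K : ℕ)).1 (by rw [← hright, zpow_natCast, hK]; simp)
      exact_mod_cast this
    obtain ⟨a, -, ha⟩ := (Nat.dvd_prime_pow Nat.prime_two).1 h1
    cases a with
    | zero =>
      refine absurd ?_ hi
      have := (hper 1).2 (by rw [ha]; simp)
      simpa using this
    | succ a => exact ⟨2 ^ a, by positivity, by rw [ha, pow_succ']⟩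
  rw [hk] at hper
  push_cast at hper
  have hfix : (w ^ (2 * k : ℤ)).right i = i := by
    rw [hright, hper]
  refine hpicky.false_of_column h2 hF (y := (w ^ (2 * k : ℤ)).left i)
    ⟨K, by rw [← map_pow, hK, map_one]⟩ hk0 i ⟨K, ?_⟩ (fun j hj => ?_) fun r => ?_
  · rw [← MonomialGroup.pow_left_apply hfix, ← zpow_natCast, zpow_comm, zpow_natCast, hK]
    simp
  · rw [← map_zpow, monomialHom_apply, if_neg]
    rw [hright]
    exact fun h => hj ((hper j).1 h.symm)
  · rw [← map_zpow, monomialHom_apply, hfix]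
    by_cases hr : r = i
    · rw [if_pos hr, hr, Matrix.one_apply_eq, one_mul]
    · rw [if_neg hr, Matrix.one_apply_ne hr, zero_mul]

end

section Counting

variable {F : Type*} [Field F]

/-- The hyperbolic pairs of a bilinear form. -/
abbrev HyperbolicPair {V : Type*} [AddCommGroup V] [Module F V] (B : LinearMap.BilinForm F V) :
    Type _ :=
  {p : V × V // B p.1 p.2 = 1}

/-- The families of `n` pairwise orthogonal hyperbolic pairs of a bilinear form. -/
abbrev HyperbolicFrame {V : Type*} [AddCommGroup V] [Module F V] (B : LinearMap.BilinForm F V)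
    (n : ℕ) : Type _ :=
  {b : Fin n → V × V // ∀ i j, B (b i).1 (b j).1 = 0 ∧ B (b i).2 (b j).2 = 0 ∧
    B (b i).1 (b j).2 = if i = j then 1 else 0}

/-- The orthogonal complement of a hyperbolic pair. -/
def pairPerp {V : Type*} [AddCommGroup V] [Module F V] (B : LinearMap.BilinForm F V)
    (p : V × V) : Submodule F V :=
  LinearMap.ker (B p.1) ⊓ LinearMap.ker (B p.2)

section Form

variable {V : Type*} [AddCommGroup V] [Module F V] {B : LinearMap.BilinForm F V}

theorem mem_pairPerp {p : V × V} {v : V} : v ∈ pairPerp B p ↔ B p.1 v = 0 ∧ B p.2 v = 0 := by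
  simp [pairPerp]

theorem bilin_swap_eq_neg_one (hB : B.IsAlt) {p : V × V} (hp : B p.1 p.2 = 1) :
    B p.2 p.1 = -1 := by
  rw [← hB.neg_eq, hp]

theorem sub_mem_pairPerp (hB : B.IsAlt) {p : V × V} (hp : B p.1 p.2 = 1) (v : V) :
    v + B p.2 v • p.1 - B p.1 v • p.2 ∈ pairPerp B p := by
  rw [mem_pairPerp]
  constructor <;>
  simp [hp, bilin_swap_eq_neg_one hB hp, hB.self_eq_zero p.1, hB.self_eq_zero p.2]

/-- The space is the sum of a hyperbolic plane and its orthogonal complement. -/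
def pairPerpEquiv (hB : B.IsAlt) {p : V × V} (hp : B p.1 p.2 = 1) :
    V ≃ pairPerp B p × F × F where
  toFun v := (⟨_, sub_mem_pairPerp hB hp v⟩, B p.1 v, B p.2 v)
  invFun w := w.1 - w.2.2 • p.1 + w.2.1 • p.2
  left_inv v := by dsimp only; abel
  right_inv := by
    rintro ⟨⟨w, hw⟩, a, b⟩
    obtain ⟨h1, h2⟩ := mem_pairPerp.1 hw
    have h3 := bilin_swap_eq_neg_one hB hp
    refine Prod.ext (Subtype.ext ?_) (Prod.ext ?_ ?_)
    · simp only [map_add, map_sub, map_smul, h1, h2, h3, hp, hB.self_eq_zero p.1,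
        hB.self_eq_zero p.2, smul_eq_mul]
      module
    · simp [h1, hp, hB.self_eq_zero p.1]
    · simp [h2, h3, hB.self_eq_zero p.2]

/-- The fibres of a nonzero linear form are equinumerous. -/
def fiberEquiv {φ : V →ₗ[F] F} {v₀ : V} (hv₀ : φ v₀ = 1) : V ≃ {v // φ v = 1} × F where
  toFun v := (⟨v - (φ v - 1) • v₀, by simp [hv₀]⟩, φ v)
  invFun w := w.1 + (w.2 - 1) • v₀
  left_inv v := by simp
  right_inv := by
    rintro ⟨⟨v, hv⟩, a⟩
    refine Prod.ext (Subtype.ext ?_) ?_ <;> simp [hv, hv₀]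

/-- A hyperbolic pair is a nonzero vector with a vector pairing to `1` with it. -/
def hyperbolicPairEquiv (B : LinearMap.BilinForm F V) :
    HyperbolicPair B ≃ Σ e : {e : V // e ≠ 0}, {f // B e.1 f = 1} where
  toFun p := ⟨⟨p.1.1, fun h => by simpa [h] using p.2⟩, ⟨p.1.2, p.2⟩⟩
  invFun s := ⟨(s.1.1, s.2.1), s.2.2⟩
  left_inv _ := rfl
  right_inv _ := rfl

theorem card_hyperbolicPair [Finite F] [Finite V] (hnd : ∀ v, (∀ w, B v w = 0) → v = 0) {n : ℕ}
    (hV : Nat.card V = Nat.card F ^ (n + 1)) :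
    Nat.card (HyperbolicPair B) = (Nat.card F ^ (n + 1) - 1) * Nat.card F ^ n := by
  classical
  have := Fintype.ofFinite V
  rw [Nat.card_congr (hyperbolicPairEquiv B), Nat.card_sigma]
  have hfib (e : {e : V // e ≠ 0}) : Nat.card {f // B e.1 f = 1} = Nat.card F ^ n := by
    obtain ⟨w, hw⟩ : ∃ w, B e.1 w ≠ 0 := by
      by_contra! h
      exact e.2 (hnd _ h)
    have h1 := Nat.card_congr (fiberEquiv (φ := B e.1) (v₀ := (B e.1 w)⁻¹ • w) (by simp [hw]))
    rw [Nat.card_prod, hV, pow_succ] at h1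
    exact (Nat.eq_of_mul_eq_mul_right Nat.card_pos h1).symm
  rw [Finset.sum_congr rfl fun e _ => hfib e, Finset.sum_const, smul_eq_mul, Finset.card_univ,
    Fintype.card_subtype_compl, ← Nat.card_eq_fintype_card (α := V), hV]
  simp

/-- A hyperbolic frame is a hyperbolic pair with a frame of its orthogonal complement. -/
def hyperbolicFrameEquiv (hB : B.IsAlt) (n : ℕ) :
    HyperbolicFrame B (n + 1) ≃
      Σ p : HyperbolicPair B, HyperbolicFrame (B.restrict (pairPerp B p.1)) n where
  toFun b := ⟨⟨b.1 0, by simpa using (b.2 0 0).2.2⟩,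
    ⟨fun i => (⟨(b.1 i.succ).1, mem_pairPerp.2 ⟨(b.2 _ _).1, by
        exact (hB.neg_eq _ _).symm.trans (by simp [(b.2 i.succ 0).2.2])⟩⟩,
      ⟨(b.1 i.succ).2, mem_pairPerp.2 ⟨by
        rw [(b.2 _ _).2.2, if_neg (Fin.succ_ne_zero i).symm], (b.2 _ _).2.1⟩⟩),
      fun i j => by simpa using b.2 i.succ j.succ⟩⟩
  invFun s := ⟨Fin.cons s.1.1 fun i => ((s.2.1 i).1.1, (s.2.1 i).2.1), by
    have hs (i : Fin n) := mem_pairPerp.1 (s.2.1 i).1.2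
    have ht (i : Fin n) := mem_pairPerp.1 (s.2.1 i).2.2
    intro i j
    cases i using Fin.cases with
    | zero =>
      cases j using Fin.cases with
      | zero => simp [s.1.2, hB.self_eq_zero]
      | succ j => simp [hs j, ht j, (Fin.succ_ne_zero j).symm]
    | succ i =>
      cases j using Fin.cases with
      | zero =>
        simp only [Fin.cons_succ, Fin.cons_zero, Fin.succ_ne_zero, if_false]
        refine ⟨?_, ?_, ?_⟩ <;> refine (hB.neg_eq _ _).symm.trans ?_ <;> simp [hs i, ht i]
      | succ j => simpa using s.2.2 i j⟩
  left_inv b := Subtype.ext (funext fun i => by cases i using Fin.cases <;> rfl)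
  right_inv _ := rfl

end Form

theorem card_hyperbolicFrame [Finite F] (n : ℕ) :
    ∀ {V : Type*} [AddCommGroup V] [Module F V] [Finite V] {B : LinearMap.BilinForm F V},
    B.IsAlt → (∀ v, (∀ w, B v w = 0) → v = 0) → Nat.card V = Nat.card F ^ (2 * n) →
    Nat.card (HyperbolicFrame B n) =
      ∏ i ∈ Finset.range n, (Nat.card F ^ (2 * (i + 1)) - 1) * Nat.card F ^ (2 * i + 1) := by
  induction n with
  | zero =>
    intro V _ _ _ B _ _ _
    have : Unique (HyperbolicFrame B 0) :=
      { default := ⟨Fin.elim0, fun i => i.elim0⟩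
        uniq := fun b => Subtype.ext (funext fun i => i.elim0) }
    simp
  | succ n ih =>
    intro V _ _ _ B hB hnd hV
    classical
    have := Fintype.ofFinite (HyperbolicPair B)
    rw [Nat.card_congr (hyperbolicFrameEquiv hB n), Nat.card_sigma]
    have hfib (p : HyperbolicPair B) :
        Nat.card (HyperbolicFrame (B.restrict (pairPerp B p.1)) n) =
          ∏ i ∈ Finset.range n, (Nat.card F ^ (2 * (i + 1)) - 1) * Nat.card F ^ (2 * i + 1) := by
      refine ih (fun v => hB.self_eq_zero v.1) (fun v hv => Subtype.ext (hnd v.1 fun w => ?_)) ?_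
      · have h1 : B v.1 (w + B p.1.2 w • p.1.1 - B p.1.1 w • p.1.2) = 0 :=
          hv ⟨_, sub_mem_pairPerp hB p.2 w⟩
        obtain ⟨h2, h3⟩ := mem_pairPerp.1 v.2
        rw [← neg_eq_zero, hB.neg_eq] at h2 h3
        simpa [h2, h3] using h1
      · have h1 := Nat.card_congr (pairPerpEquiv hB p.2)
        rw [Nat.card_prod, Nat.card_prod, hV, mul_add, mul_one, pow_add, pow_two] at h1
        exact (Nat.eq_of_mul_eq_mul_right (Nat.mul_pos Nat.card_pos Nat.card_pos) h1).symm
    rw [Finset.sum_congr rfl fun p _ => hfib p, Finset.sum_const, smul_eq_mul, Finset.card_univ,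
      ← Nat.card_eq_fintype_card, card_hyperbolicPair hnd (n := 2 * n + 1) hV,
      Finset.prod_range_succ, mul_comm]
    rfl

end Counting

section UnitaryCount

open Matrix

variable {F : Type*} [Field F]

/-- The standard alternating form on families of pairs. -/
def stdForm (F : Type*) [Field F] (n : Type*) [Fintype n] :
    LinearMap.BilinForm F (n → Fin 2 → F) :=
  LinearMap.mk₂ F (fun u w => ∑ l, (u l 0 * w l 1 - u l 1 * w l 0))
    (fun u v w => by
      rw [← Finset.sum_add_distrib]; exact Finset.sum_congr rfl fun l _ => by simp; ring)
    (fun c u w => by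
      rw [smul_eq_mul, Finset.mul_sum]; exact Finset.sum_congr rfl fun l _ => by simp; ring)
    (fun u v w => by
      rw [← Finset.sum_add_distrib]; exact Finset.sum_congr rfl fun l _ => by simp; ring)
    (fun c u w => by
      rw [smul_eq_mul, Finset.mul_sum]; exact Finset.sum_congr rfl fun l _ => by simp; ring)

variable {n : Type*} [Fintype n]

theorem stdForm_apply (u w : n → Fin 2 → F) :
    stdForm F n u w = ∑ l, (u l 0 * w l 1 - u l 1 * w l 0) := rfl

theorem stdForm_isAlt : (stdForm F n).IsAlt := fun u => by
  rw [stdForm_apply]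
  exact Finset.sum_eq_zero fun l _ => by ring

theorem eq_zero_of_stdForm_eq_zero [DecidableEq n] (u : n → Fin 2 → F)
    (h : ∀ w, stdForm F n u w = 0) : u = 0 := by
  ext l c
  have key (d : Fin 2) : u l 0 * (Pi.single d 1 : Fin 2 → F) 1 -
      u l 1 * (Pi.single d 1 : Fin 2 → F) 0 = 0 := by
    have := h (Pi.single l (Pi.single d 1))
    rw [stdForm_apply, Finset.sum_eq_single_of_mem l (Finset.mem_univ l)
      (fun k _ hk => by simp [Pi.single_eq_of_ne hk])] at this
    simpa using this
  have h0 := key 0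
  have h1 := key 1
  fin_cases c
  · simpa using h1
  · simpa using h0

theorem sum_mul_adjugate_fin_two (a b : n → Matrix (Fin 2) (Fin 2) F) :
    ∑ l, a l * (b l).adjugate =
      !![stdForm F n (fun l => a l 0) (fun l => b l 1),
        -stdForm F n (fun l => a l 0) (fun l => b l 0);
        stdForm F n (fun l => a l 1) (fun l => b l 1),
        -stdForm F n (fun l => a l 1) (fun l => b l 0)] := by
  ext c d
  rw [Matrix.sum_apply]
  fin_cases c <;> fin_cases d <;>
  simp [stdForm_apply, Matrix.adjugate_fin_two, Matrix.mul_apply, Fin.sum_univ_two,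
    Finset.sum_add_distrib] <;>
  ring

theorem Quat.mul_star_apply (M N : Matrix n n (Quat F)) (i j : n) :
    (M * star N) i j =
      (!![stdForm F n (fun l => M i l 0) (fun l => N j l 1),
        -stdForm F n (fun l => M i l 0) (fun l => N j l 0);
        stdForm F n (fun l => M i l 1) (fun l => N j l 1),
        -stdForm F n (fun l => M i l 1) (fun l => N j l 0)] : Matrix (Fin 2) (Fin 2) F) := by
  rw [Matrix.mul_apply]
  exact sum_mul_adjugate_fin_two (M i) (N j)

theorem mem_unitary_iff_hyperbolic [Finite F] [DecidableEq n] (M : Matrix n n (Quat F)) :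
    M ∈ unitary (Matrix n n (Quat F)) ↔
      ∀ i j, stdForm F n (fun l => M i l 0) (fun l => M j l 0) = 0 ∧
        stdForm F n (fun l => M i l 1) (fun l => M j l 1) = 0 ∧
        stdForm F n (fun l => M i l 0) (fun l => M j l 1) = if i = j then 1 else 0 := by
  have h1 : M ∈ unitary (Matrix n n (Quat F)) ↔ ∀ i j, (M * star M) i j =
      (1 : Matrix n n (Quat F)) i j := by
    rw [Unitary.mem_iff]
    refine ⟨fun h i j => by rw [h.2], fun h => ?_⟩
    have : M * star M = 1 := by ext1 i j; exact h i j
    exact ⟨mul_eq_one_comm.1 this, this⟩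
  have h2 (i j : n) : (1 : Matrix n n (Quat F)) i j =
      (!![if i = j then 1 else 0, 0; 0, if i = j then 1 else 0] : Matrix (Fin 2) (Fin 2) F) := by
    by_cases h : i = j
    · rw [h, Matrix.one_apply_eq]
      simp only [if_true]
      exact Matrix.one_fin_two
    · rw [Matrix.one_apply_ne h]
      simp only [if_neg h]
      exact Matrix.eta_fin_two (0 : Matrix (Fin 2) (Fin 2) F)
  have h3 (a b c d a' b' c' d' : F) : (!![a, b; c, d] : Matrix (Fin 2) (Fin 2) F) =
      !![a', b'; c', d'] ↔ a = a' ∧ b = b' ∧ c = c' ∧ d = d' := by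
    refine ⟨fun h => ?_, by rintro ⟨rfl, rfl, rfl, rfl⟩; rfl⟩
    exact ⟨congrFun (congrFun h 0) 0, congrFun (congrFun h 0) 1, congrFun (congrFun h 1) 0,
      congrFun (congrFun h 1) 1⟩
  rw [h1]
  simp_rw [Quat.mul_star_apply, h2]
  refine ⟨fun h i j => ?_, fun h i j => ?_⟩
  · obtain ⟨ha, hb, hc, -⟩ := (h3 _ _ _ _ _ _ _ _).1 (h i j)
    exact ⟨neg_eq_zero.1 hb, hc, ha⟩
  · refine (h3 _ _ _ _ _ _ _ _).2 ⟨(h i j).2.2, neg_eq_zero.2 (h i j).1, (h i j).2.1, ?_⟩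
    rw [stdForm_isAlt.neg_eq, (h j i).2.2]
    simp [eq_comm]

/-- The rows of a unitary matrix form a frame. -/
def unitaryEquivHyperbolicFrame [Finite F] (n : ℕ) :
    unitary (Matrix (Fin n) (Fin n) (Quat F)) ≃ HyperbolicFrame (stdForm F (Fin n)) n :=
  Equiv.subtypeEquiv
    { toFun := fun M i => (fun l => M i l 0, fun l => M i l 1)
      invFun := fun b => Matrix.of fun i l =>
        (Matrix.of ![(b i).1 l, (b i).2 l] : Matrix (Fin 2) (Fin 2) F)
      left_inv := fun M => by
        ext i l
        refine Matrix.ext fun c d => ?_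
        fin_cases c <;> rfl
      right_inv := fun b => rfl }
    mem_unitary_iff_hyperbolic

theorem card_unitary_quat [Finite F] (n : ℕ) :
    Nat.card (unitary (Matrix (Fin n) (Fin n) (Quat F))) =
      ∏ i ∈ Finset.range n, (Nat.card F ^ (2 * (i + 1)) - 1) * Nat.card F ^ (2 * i + 1) := by
  rw [Nat.card_congr (unitaryEquivHyperbolicFrame n)]
  refine card_hyperbolicFrame n stdForm_isAlt eq_zero_of_stdForm_eq_zero ?_
  rw [Nat.card_fun, Nat.card_fun]
  simp [pow_mul]

theorem card_unitary_eq_of_unique (A : Type*) [Ring A] [StarRing A] (n : Type*) [Fintype n]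
    [DecidableEq n] [Unique n] : Nat.card (unitary (Matrix n n A)) = Nat.card (unitary A) := by
  have h1 (M : Matrix n n A) : M ∈ unitary (Matrix n n A) ↔ M default default ∈ unitary A := by
    rw [Unitary.mem_iff, Unitary.mem_iff, ← Matrix.ext_iff, ← Matrix.ext_iff]
    simp [Unique.forall_iff, Matrix.mul_apply, Matrix.star_apply]
  exact Nat.card_congr (Equiv.subtypeEquiv
    { toFun := fun M => M default default
      invFun := fun a => Matrix.of fun _ _ => a
      left_inv := fun M => by
        ext i j; rw [Unique.eq_default i, Unique.eq_default j]; rfl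
      right_inv := fun a => rfl } h1)

theorem padicValNat_sq_pow_sub_one {q : ℕ} (hq : Odd q) (hq1 : 1 < q) (i : ℕ) :
    padicValNat 2 (q ^ (2 * (i + 1)) - 1) = padicValNat 2 (q ^ 2 - 1) + padicValNat 2 (i + 1) := by
  have key (i : ℕ) : padicValNat 2 (q ^ (2 * (i + 1)) - 1) =
      padicValNat 2 (q + 1) + padicValNat 2 (q - 1) + padicValNat 2 (i + 1) := by
    have h := padicValNat.pow_two_sub_pow (x := q) (y := 1) hq1
      (by obtain ⟨m, rfl⟩ := hq; omega) (by obtain ⟨m, rfl⟩ := hq; omega)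
      (n := 2 * (i + 1)) (by omega) (even_two_mul _)
    rw [one_pow, padicValNat.mul (by norm_num) (by omega), padicValNat.self (by norm_num)] at h
    omega
  have h0 := key 0
  have hi := key i
  simp only [zero_add, mul_one, padicValNat_one_right] at h0
  omega

theorem not_two_dvd_index_monomialHom [Finite F] (hodd : Odd (Nat.card F)) (n : ℕ) :
    ¬ 2 ∣ (monomialHom (Quat F) (Fin n)).range.index := by
  have hq1 : 1 < Nat.card F := Finite.one_lt_card
  have hW : Nat.card (monomialHom (Quat F) (Fin n)).range =
      ((Nat.card F ^ 2 - 1) * Nat.card F) ^ n * n.factorial := by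
    rw [← Nat.card_congr (MonoidHom.ofInjective monomialHom_injective).toEquiv,
      SemidirectProduct.card, Nat.card_fun, ← card_unitary_eq_of_unique (Quat F) (Fin 1),
      card_unitary_quat, Nat.card_perm]
    simp
  have hU := card_unitary_quat (F := F) n
  have hmul := (monomialHom (Quat F) (Fin n)).range.index_mul_card
  rw [hW, hU] at hmul
  have hqv (k : ℕ) : padicValNat 2 (Nat.card F ^ k) = 0 :=
    padicValNat.eq_zero_of_not_dvd fun h => by
      exact (Nat.not_even_iff_odd.2 (hodd.pow (n := k))) (even_iff_two_dvd.2 h)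
  have hq2 (i : ℕ) : Nat.card F ^ (2 * (i + 1)) - 1 ≠ 0 :=
    (Nat.sub_pos_of_lt (Nat.one_lt_pow (by omega) hq1)).ne'
  have hq0 (k : ℕ) : Nat.card F ^ k ≠ 0 := pow_ne_zero _ (by omega)
  have hval (n : ℕ) : padicValNat 2
      (∏ i ∈ Finset.range n, (Nat.card F ^ (2 * (i + 1)) - 1) * Nat.card F ^ (2 * i + 1)) =
      padicValNat 2 (((Nat.card F ^ 2 - 1) * Nat.card F) ^ n * n.factorial) := by
    have hc : (Nat.card F ^ 2 - 1) * Nat.card F ≠ 0 :=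
      mul_ne_zero (by simpa using hq2 0) (by omega)
    induction n with
    | zero => simp
    | succ n ih =>
      have h1 := hqv 1
      rw [pow_one] at h1
      rw [padicValNat.mul (pow_ne_zero _ hc) n.factorial_ne_zero] at ih
      rw [Finset.prod_range_succ,
        padicValNat.mul (Finset.prod_ne_zero_iff.2 fun i _ => mul_ne_zero (hq2 i) (hq0 _))
          (mul_ne_zero (hq2 n) (hq0 _)), ih, padicValNat.mul (hq2 n) (hq0 _), hqv,
        padicValNat_sq_pow_sub_one hodd hq1, Nat.factorial_succ,
        padicValNat.mul (pow_ne_zero _ hc) (mul_ne_zero (by omega) n.factorial_ne_zero),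
        padicValNat.mul (by omega) n.factorial_ne_zero, pow_succ _ n,
        padicValNat.mul (pow_ne_zero _ hc) hc,
        padicValNat.mul (by simpa using hq2 0) (by omega), h1]
      omega
  intro h2
  have hi0 : (monomialHom (Quat F) (Fin n)).range.index ≠ 0 := Subgroup.index_ne_zero_of_finite
  have hc0 : ((Nat.card F ^ 2 - 1) * Nat.card F) ^ n * n.factorial ≠ 0 := by
    rw [← hW]; exact Nat.card_pos.ne'
  have h3 := hval n
  rw [← hmul, padicValNat.mul hi0 hc0] at h3
  have h4 := one_le_padicValNat_of_dvd hi0 h2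
  omega

end UnitaryCount

section Symplectic

open Matrix

variable {F : Type*} [Field F]

theorem unitary_quat_not_isPicky [Finite F] (h2 : (2 : F) ≠ 0) (hF : 3 < Nat.card F)
    (hodd : Odd (Nat.card F)) {n : ℕ} (hn : 3 ≤ n)
    {x : unitary (Matrix (Fin n) (Fin n) (Quat F))} (hx : ∃ k, x ^ 2 ^ k = 1) : ¬ IsPicky x := by
  intro hpicky
  obtain ⟨a, ha⟩ := (isPGroup_zpowers hx).nonempty_fixed_point_of_prime_not_dvd_card
    (unitary (Matrix (Fin n) (Fin n) (Quat F)) ⧸ (monomialHom (Quat F) (Fin n)).range)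
    (not_two_dvd_index_monomialHom hodd n)
  obtain ⟨g, rfl⟩ := QuotientGroup.mk_surjective a
  have h1 := ha ⟨x, Subgroup.mem_zpowers x⟩
  have h3 : g⁻¹ * (x * g) ∈ (monomialHom (Quat F) (Fin n)).range :=
    QuotientGroup.eq.1 h1.symm
  obtain ⟨w, hw⟩ := h3
  have hpw : IsPicky (monomialHom (Quat F) (Fin n) w) := by
    refine IsPicky.of_injective (f := (MulAut.conj g).toMonoidHom) (MulAut.conj g).injective ?_
    simpa [hw, mul_assoc] using hpicky
  refine MonomialGroup.not_isPicky h2 hF (by simpa using hn) ?_ hpw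
  obtain ⟨k, hk⟩ := hx
  refine ⟨k, monomialHom_injective ?_⟩
  have h4 : g⁻¹ * (x * g) = MulAut.conj g⁻¹ x := by simp [mul_assoc]
  rw [map_pow, hw, h4, ← map_pow, hk, map_one, map_one]

variable {n : Type*} [Fintype n] [DecidableEq n]

/-- The matrix of `2 × 2` matrices attached to a matrix with four blocks. -/
def blocksToQuat (X : Matrix (n ⊕ n) (n ⊕ n) F) : Matrix n n (Quat F) :=
  Matrix.of fun i j => (!![X (.inl i) (.inl j), X (.inl i) (.inr j);
    X (.inr i) (.inl j), X (.inr i) (.inr j)] : Matrix (Fin 2) (Fin 2) F)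

theorem blocksToQuat_apply (X : Matrix (n ⊕ n) (n ⊕ n) F) (i j : n) :
    blocksToQuat X i j = (!![X (.inl i) (.inl j), X (.inl i) (.inr j);
      X (.inr i) (.inl j), X (.inr i) (.inr j)] : Matrix (Fin 2) (Fin 2) F) :=
  rfl

theorem blocksToQuat_bijective :
    Function.Bijective (blocksToQuat : Matrix (n ⊕ n) (n ⊕ n) F → Matrix n n (Quat F)) := by
  refine ⟨fun X Y h => ?_, fun M => ?_⟩
  · have h' (i j : n) (c d : Fin 2) :=
      congrFun (congrFun (congrFun (congrFun h i) j) c) d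
    ext (i | i) (j | j)
    exacts [h' i j 0 0, h' i j 0 1, h' i j 1 0, h' i j 1 1]
  · refine ⟨Matrix.fromBlocks (Matrix.of fun i j => M i j 0 0) (Matrix.of fun i j => M i j 0 1)
      (Matrix.of fun i j => M i j 1 0) (Matrix.of fun i j => M i j 1 1), ?_⟩
    ext i j
    exact (Matrix.eta_fin_two (M i j : Matrix (Fin 2) (Fin 2) F)).symm

theorem blocksToQuat_one : blocksToQuat (1 : Matrix (n ⊕ n) (n ⊕ n) F) = 1 := by
  ext1 i j
  by_cases h : i = j
  · rw [h, Matrix.one_apply_eq]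
    refine (blocksToQuat_apply _ _ _).trans (Eq.trans ?_ (Matrix.one_fin_two (α := F)).symm)
    simp
    rfl
  · rw [Matrix.one_apply_ne h]
    refine (blocksToQuat_apply _ _ _).trans
      (Eq.trans ?_ (Matrix.eta_fin_two (0 : Matrix (Fin 2) (Fin 2) F)).symm)
    simp [h]
    rfl

theorem blocksToQuat_mul (X Y : Matrix (n ⊕ n) (n ⊕ n) F) :
    blocksToQuat (X * Y) = blocksToQuat X * blocksToQuat Y := by
  ext1 i j
  rw [Matrix.mul_apply]
  have key (a b : n → Matrix (Fin 2) (Fin 2) F) : ∑ l, a l * b l =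
      !![∑ l, a l 0 0 * b l 0 0 + ∑ l, a l 0 1 * b l 1 0,
        ∑ l, a l 0 0 * b l 0 1 + ∑ l, a l 0 1 * b l 1 1;
        ∑ l, a l 1 0 * b l 0 0 + ∑ l, a l 1 1 * b l 1 0,
        ∑ l, a l 1 0 * b l 0 1 + ∑ l, a l 1 1 * b l 1 1] := by
    ext c d
    rw [Matrix.sum_apply]
    fin_cases c <;> fin_cases d <;>
    simp [Matrix.mul_apply, Fin.sum_univ_two, Finset.sum_add_distrib]
  refine (blocksToQuat_apply _ _ _).trans
    (Eq.trans ?_ (key (blocksToQuat X i) fun l => blocksToQuat Y l j).symm)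
  simp only [Matrix.mul_apply, Fintype.sum_sum_type]
  rfl

theorem star_blocksToQuat (X : Matrix (n ⊕ n) (n ⊕ n) F) :
    star (blocksToQuat X) = blocksToQuat (-(Matrix.J n F * Xᵀ * Matrix.J n F)) := by
  rw [← Matrix.fromBlocks_toBlocks X, Matrix.J, Matrix.fromBlocks_transpose,
    Matrix.fromBlocks_multiply, Matrix.fromBlocks_multiply, Matrix.fromBlocks_neg]
  ext1 i j
  refine (Matrix.adjugate_fin_two_of (α := F) _ _ _ _).trans
    (Eq.trans ?_ (blocksToQuat_apply _ _ _).symm)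
  simp

theorem mem_symplecticGroup_iff_blocksToQuat [Finite F] (X : Matrix (n ⊕ n) (n ⊕ n) F) :
    X ∈ Matrix.symplecticGroup n F ↔ blocksToQuat X ∈ unitary (Matrix n n (Quat F)) := by
  have h1 : X * -(Matrix.J n F * Xᵀ * Matrix.J n F) = 1 ↔ X * Matrix.J n F * Xᵀ = Matrix.J n F := by
    constructor <;> intro h
    · calc _ = X * -(Matrix.J n F * Xᵀ * Matrix.J n F) * Matrix.J n F := by
            simp [mul_assoc, Matrix.J_squared]
        _ = _ := by rw [h, one_mul]
    · calc _ = -(X * Matrix.J n F * Xᵀ * Matrix.J n F) := by simp [mul_assoc]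
        _ = 1 := by rw [h, Matrix.J_squared, neg_neg]
  rw [SymplecticGroup.mem_iff, ← h1, ← blocksToQuat_bijective.1.eq_iff, blocksToQuat_mul,
    ← star_blocksToQuat, blocksToQuat_one, Unitary.mem_iff]
  exact ⟨fun h => ⟨mul_eq_one_comm.1 h, h⟩, fun h => h.2⟩

/-- The symplectic group is a unitary group over the `2 × 2` matrices. -/
noncomputable def symplecticEquivUnitary [Finite F] :
    Matrix.symplecticGroup n F ≃* unitary (Matrix n n (Quat F)) where
  toEquiv := (Equiv.ofBijective _ blocksToQuat_bijective).subtypeEquiv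
    mem_symplecticGroup_iff_blocksToQuat
  map_mul' X Y := Subtype.ext (blocksToQuat_mul X.1 Y.1)

end Symplectic

/-- If `Sp_{2n}(𝔽_q)`, with `q` odd and `n ≥ 1`, contains a picky `2`-element, then
`q = 3`, or `q = 5` and `n ≤ 5`, or `n ≤ 2`. -/
theorem picky_two_element_Sp_reduction
    (q : ℕ) (hq : IsPrimePow q) (hodd : Odd q) (n : ℕ) (hn : 1 ≤ n)
    (F : Type*) [Field F] [Fintype F] [DecidableEq F] (hF : Fintype.card F = q)
    (x : Matrix.symplecticGroup (Fin n) F) (hx : ∃ k : ℕ, orderOf x = 2 ^ k)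
    (hpicky : ∃! P : Sylow 2 (Matrix.symplecticGroup (Fin n) F), x ∈ P) :
    q = 3 ∨ (q = 5 ∧ n ≤ 5) ∨ n ≤ 2 := by
  by_contra! hcon
  obtain ⟨hq3, -, hn2⟩ := hcon
  have hcard : Nat.card F = q := by rw [Nat.card_eq_fintype_card, hF]
  have hq1 := hq.one_lt
  have h2 : (2 : F) ≠ 0 := by
    intro h
    have h3 := FiniteField.even_card_of_char_two (F := F)
      (ringChar.spec F 2 |>.1 (by exact_mod_cast h) |> fun hd =>
        ((Nat.dvd_prime Nat.prime_two).1 hd).resolve_left (CharP.ringChar_ne_one))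
    rw [hF] at h3
    obtain ⟨m, rfl⟩ := hodd
    omega
  have hq4 : 3 < Nat.card F := by
    rw [hcard]
    obtain ⟨m, rfl⟩ := hodd
    omega
  obtain ⟨k, hk⟩ := hx
  refine unitary_quat_not_isPicky h2 hq4 (hcard ▸ hodd) hn2
    (x := symplecticEquivUnitary x) ⟨k, ?_⟩ ?_
  · rw [← map_pow, ← hk, pow_orderOf_eq_one, map_one]
  · refine IsPicky.of_injective (f := symplecticEquivUnitary.symm.toMonoidHom)
      symplecticEquivUnitary.symm.injective ?_
    simpa using IsPicky.of_existsUnique_sylow hpicky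
end

section
/- Let q be an odd prime power with q ≡ 3 (mod 4). Then SL_3(𝔽_q) contains a picky 2-element if and only if q is a Fermat prime, a Mersenne prime, or q = 9. -/
/-- `q` is a Fermat prime. -/
def IsFermatPrime (q : ℕ) : Prop := q.Prime ∧ ∃ m : ℕ, q = 2 ^ m + 1

/-- `q` is a Mersenne prime. -/
def IsMersennePrime (q : ℕ) : Prop := q.Prime ∧ ∃ m : ℕ, q = 2 ^ m - 1

namespace Sylow

open scoped Pointwise

variable {G : Type*} [Group G] {p : ℕ}

theorem mem_smul_iff_conj_mem {g x : G} {P : Sylow p G} : x ∈ g • P ↔ g⁻¹ * x * g ∈ P := by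
  change x ∈ MulAut.conj g • (P : Subgroup G) ↔ _
  rw [Subgroup.mem_pointwise_smul_iff_inv_smul_mem, ← map_inv]
  simp
  rfl

theorem existsUnique_mem_of_conj {x y g : G} (h : x * g = g * y)
    (hx : ∃! P : Sylow p G, x ∈ P) : ∃! P : Sylow p G, y ∈ P := by
  have hy : y = g⁻¹ * x * g := by rw [mul_assoc, h, inv_mul_cancel_left]
  obtain ⟨P, hP, huniq⟩ := hx
  refine ⟨g⁻¹ • P, ?_, fun Q hQ ↦ ?_⟩
  · change y ∈ g⁻¹ • P
    rw [mem_smul_iff_conj_mem, hy]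
    simpa [mul_assoc] using hP
  · rw [eq_inv_smul_iff]
    apply huniq
    rwa [mem_smul_iff_conj_mem, ← hy]

/-- If `P` is the only Sylow subgroup containing `x`, then every element conjugating `x` into `P`
normalizes `P`. -/
theorem mem_normalizer_of_conj_mem {x g : G} {P : Sylow p G}
    (huniq : ∀ Q : Sylow p G, x ∈ Q → Q = P) (h : g * x * g⁻¹ ∈ P) :
    g ∈ Subgroup.normalizer (P : Set G) := by
  rw [← smul_eq_iff_mem_normalizer, smul_eq_iff_eq_inv_smul, eq_comm]
  apply huniq
  rwa [mem_smul_iff_conj_mem, inv_inv]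

end Sylow

/-- The quadratic extension `F(i)` of `F` with `i² = -1`. -/
abbrev GaussExt (F : Type*) [Field F] := QuadraticAlgebra F (-1) 0

namespace GaussExt

open Matrix

variable {F : Type*} [Field F]

/-- The block-diagonal matrix of determinant one by which `t : F(i)ˣ` acts on `F(i) ⊕ F`. -/
def unitSL [Fact (∀ r : F, r ^ 2 ≠ -1 + 0 * r)] (t : (GaussExt F)ˣ) :
    SpecialLinearGroup (Fin 3) F :=
  ⟨!![t.val.re, -t.val.im, 0; t.val.im, t.val.re, 0; 0, 0, (QuadraticAlgebra.norm t.val)⁻¹], by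
    have h : QuadraticAlgebra.norm t.val ≠ 0 := by
      simp [QuadraticAlgebra.norm_eq_zero_iff_eq_zero]
    have h' : t.val.re * t.val.re + t.val.im * t.val.im = QuadraticAlgebra.norm t.val := by
      rw [QuadraticAlgebra.norm_def]; ring
    simp only [det_fin_three, of_apply, cons_val', cons_val_zero, cons_val_one, cons_val]
    linear_combination (QuadraticAlgebra.norm t.val)⁻¹ * h' + mul_inv_cancel₀ h⟩

theorem coe_unitSL [Fact (∀ r : F, r ^ 2 ≠ -1 + 0 * r)] (t : (GaussExt F)ˣ) :
    (unitSL t : Matrix (Fin 3) (Fin 3) F) = !![t.val.re, -t.val.im, 0;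
      t.val.im, t.val.re, 0; 0, 0, (QuadraticAlgebra.norm t.val)⁻¹] :=
  rfl

/-- The block-diagonal embedding of `F(i)ˣ` in `SL₃(F)`, acting on `F(i) ⊕ F`. -/
def toSL [Fact (∀ r : F, r ^ 2 ≠ -1 + 0 * r)] :
    (GaussExt F)ˣ →* SpecialLinearGroup (Fin 3) F where
  toFun := unitSL
  map_one' := by
    ext i j
    fin_cases i <;> fin_cases j <;> simp [coe_unitSL] <;> rfl
  map_mul' x y := by
    ext i j
    fin_cases i <;> fin_cases j <;>
      simp [coe_unitSL, Matrix.mul_apply, Fin.sum_univ_three, mul_comm, add_comm]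

/-- Complex conjugation on `F(i) ⊕ F`, acting as `-1` on `F`. -/
def conjSL : SpecialLinearGroup (Fin 3) F :=
  ⟨!![1, 0, 0; 0, -1, 0; 0, 0, -1], by simp [det_fin_three]⟩

theorem coe_conjSL : ((conjSL : SpecialLinearGroup (Fin 3) F) : Matrix (Fin 3) (Fin 3) F) =
    !![1, 0, 0; 0, -1, 0; 0, 0, -1] :=
  rfl

theorem conjSL_mul_self : (conjSL : SpecialLinearGroup (Fin 3) F) * conjSL = 1 := by
  ext i j
  fin_cases i <;> fin_cases j <;> simp [coe_conjSL, Matrix.mul_apply, Fin.sum_univ_three]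

theorem pow_card_eq_star [Fintype F] (hq : Fintype.card F % 4 = 3) (z : GaussExt F) :
    z ^ Fintype.card F = star z := by
  have hω : (QuadraticAlgebra.omega : GaussExt F) ^ Fintype.card F = -QuadraticAlgebra.omega := by
    have h2 : (QuadraticAlgebra.omega : GaussExt F) ^ 2 = -1 := by
      rw [pow_two]; ext <;> simp <;> rfl
    rw [← Nat.div_add_mod (Fintype.card F) 4, hq, pow_add, pow_mul,
      show (4 : ℕ) = 2 * 2 from rfl, pow_mul, h2, neg_one_sq, one_pow,
      pow_succ, h2, neg_one_mul, one_mul]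
  have hz : z = algebraMap F _ z.re + z.im • QuadraticAlgebra.omega := by
    ext <;> simp
  have key := congrArg (FiniteField.frobeniusAlgHom F (GaussExt F)) hz
  rw [map_add, map_smul, AlgHom.commutes] at key
  simp only [FiniteField.coe_frobeniusAlgHom, hω] at key
  rw [key]
  ext <;> simp

theorem natCard_SL3_mul [Fintype F] :
    Nat.card (SpecialLinearGroup (Fin 3) F) * (Fintype.card F - 1) =
      (Fintype.card F ^ 3 - 1) * (Fintype.card F ^ 3 - Fintype.card F) *
        (Fintype.card F ^ 3 - Fintype.card F ^ 2) := by
  classical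
  have hker : (SpecialLinearGroup.toGL (n := Fin 3) (R := F)).range =
      (GeneralLinearGroup.det (n := Fin 3) (R := F)).ker := by
    ext g
    constructor
    · rintro ⟨x, rfl⟩
      exact Units.ext x.2
    · intro hg
      exact ⟨⟨g.val, congrArg Units.val hg⟩, Units.ext rfl⟩
  have hsurj : Function.Surjective (GeneralLinearGroup.det (n := Fin 3) (R := F)) := by
    intro u
    refine ⟨GeneralLinearGroup.mkOfDetNeZero (Matrix.diagonal ![u.val, 1, 1]) ?_, ?_⟩
    · simp [det_diagonal, Fin.prod_univ_three]
    · ext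
      simp [GeneralLinearGroup.mkOfDetNeZero, Fin.prod_univ_three]
  have h := (GeneralLinearGroup.det (n := Fin 3) (R := F)).ker.card_mul_index
  rw [Subgroup.index_ker, MonoidHom.range_eq_top.2 hsurj, Subgroup.card_top, Nat.card_units,
    ← hker, card_GL_field, Nat.card_eq_fintype_card (α := F),
    Nat.card_congr (MonoidHom.ofInjective SpecialLinearGroup.toGL_injective).toEquiv.symm] at h
  simpa [Fin.prod_univ_three] using h

theorem exists_natCard_SL3_eq [Fintype F] (hq : Fintype.card F % 4 = 3) {a w : ℕ} (hw : Odd w)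
    (haw : Fintype.card F + 1 = 2 ^ a * w) :
    ∃ M, Odd M ∧ Nat.card (SpecialLinearGroup (Fin 3) F) = 2 ^ (a + 2) * M := by
  have h := natCard_SL3_mul (F := F)
  generalize Fintype.card F = q at *
  obtain ⟨k, rfl⟩ : ∃ k, q = 4 * k + 3 := ⟨q / 4, by lia⟩
  refine ⟨(4 * k + 3) ^ 3 * (2 * k + 1) ^ 2 * w * ((4 * k + 3) ^ 2 + (4 * k + 3) + 1), ?_, ?_⟩
  · have h1 : Odd (4 * k + 3) := ⟨2 * k + 1, by ring⟩
    have h2 : Odd (2 * k + 1) := ⟨k, rfl⟩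
    refine ((h1.pow.mul h2.pow).mul hw).mul ((h1.pow.add_odd h1).add_odd odd_one)
  · refine Nat.eq_of_mul_eq_mul_right (show 0 < 4 * k + 3 - 1 by lia) (h.trans ?_)
    have e1 : (4 * k + 3) ^ 3 - 1 = (4 * k + 2) * ((4 * k + 3) ^ 2 + (4 * k + 3) + 1) :=
      Nat.sub_eq_of_eq_add (by ring)
    have e2 : (4 * k + 3) ^ 3 - (4 * k + 3) = (4 * k + 3) * (4 * k + 2) * (4 * k + 3 + 1) :=
      Nat.sub_eq_of_eq_add (by ring)
    have e3 : (4 * k + 3) ^ 3 - (4 * k + 3) ^ 2 = (4 * k + 3) ^ 2 * (4 * k + 2) :=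
      Nat.sub_eq_of_eq_add (by ring)
    have e4 : 4 * k + 3 - 1 = 4 * k + 2 := rfl
    rw [e1, e2, e3, e4, haw]
    ring

theorem two_ne_zero_of_card [Fintype F] (hq : Fintype.card F % 4 = 3) : (2 : F) ≠ 0 := by
  apply Ring.two_ne_zero
  intro h
  have := FiniteField.even_card_of_char_two h
  lia

theorem exists_conj_of_mul_eq {x y z : SpecialLinearGroup (Fin 3) F}
    {X Y Z : Matrix (Fin 3) (Fin 3) F} (hx : x = X) (hy : y = Y) (hz : z = Z)
    (A : Matrix (Fin 3) (Fin 3) F) (hA : A.det = 1) (h : X * Y * A = A * Z) :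
    ∃ g : SpecialLinearGroup (Fin 3) F, x * y * g = g * z := by
  subst hx hy hz
  exact ⟨⟨A, hA⟩, Subtype.ext h⟩

variable [Fact (∀ r : F, r ^ 2 ≠ -1 + 0 * r)]

theorem coe_toSL (t : (GaussExt F)ˣ) :
    (toSL t : Matrix (Fin 3) (Fin 3) F) = !![t.val.re, -t.val.im, 0;
      t.val.im, t.val.re, 0; 0, 0, (QuadraticAlgebra.norm t.val)⁻¹] :=
  rfl

theorem toSL_injective : Function.Injective (toSL (F := F)) := by
  intro x y h
  have h0 := congrArg (fun g : SpecialLinearGroup (Fin 3) F ↦ g 0 0) h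
  have h1 := congrArg (fun g : SpecialLinearGroup (Fin 3) F ↦ g 1 0) h
  ext
  · simpa [coe_toSL] using h0
  · simpa [coe_toSL] using h1

theorem conjSL_mul_toSL [Fintype F] (hq : Fintype.card F % 4 = 3) (t : (GaussExt F)ˣ) :
    conjSL * toSL t = toSL (t ^ Fintype.card F) * conjSL := by
  ext i j
  fin_cases i <;> fin_cases j <;>
    simp [coe_conjSL, coe_toSL, -map_pow, Matrix.mul_apply, Fin.sum_univ_three, pow_card_eq_star hq]

theorem toSL_ne_toSL_mul_conjSL (h2 : (2 : F) ≠ 0) (t u : (GaussExt F)ˣ) :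
    toSL t ≠ toSL u * conjSL := by
  intro h
  have e (i j : Fin 3) := congrArg (fun g : SpecialLinearGroup (Fin 3) F ↦ g i j) h
  have h00 := e 0 0
  have h01 := e 0 1
  have h10 := e 1 0
  have h11 := e 1 1
  simp [coe_toSL, coe_conjSL, Matrix.mul_apply, Fin.sum_univ_three] at h00 h01 h10 h11
  have hre : t.val.re = 0 := by
    have : (2 : F) * t.val.re = 0 := by linear_combination h00 + h11
    simpa [h2] using this
  have him : t.val.im = 0 := by
    have : (2 : F) * t.val.im = 0 := by linear_combination h10 - h01
    simpa [h2] using this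
  exact t.ne_zero (QuadraticAlgebra.ext hre him)

theorem natCard_units [Fintype F] : Nat.card (GaussExt F)ˣ = Fintype.card F ^ 2 - 1 := by
  rw [Nat.card_units, Nat.card_congr (QuadraticAlgebra.equivProd _ _), Nat.card_prod,
    Nat.card_eq_fintype_card, pow_two]

instance [Finite F] : Finite (GaussExt F) :=
  Finite.of_equiv _ (QuadraticAlgebra.equivProd _ _).symm

theorem toSL_mul_conjSL_sq [Fintype F] (hq : Fintype.card F % 4 = 3) (t : (GaussExt F)ˣ) :
    (toSL t * conjSL) ^ 2 = toSL (t ^ (Fintype.card F + 1)) := by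
  rw [pow_two, mul_assoc, ← mul_assoc conjSL, conjSL_mul_toSL hq, mul_assoc, conjSL_mul_self,
    mul_one, ← map_mul, pow_succ']

/-- The elements of `e`-torsion in `toSL` together with their products with `conjSL`. -/
def twistedTorus [Fintype F] (hq : Fintype.card F % 4 = 3) (e : ℕ) :
    Subgroup (SpecialLinearGroup (Fin 3) F) where
  carrier := {g | ∃ t : (GaussExt F)ˣ, t ^ e = 1 ∧ (g = toSL t ∨ g = toSL t * conjSL)}
  one_mem' := ⟨1, one_pow _, .inl (map_one _).symm⟩
  mul_mem' := by
    rintro _ _ ⟨t, ht, rfl | rfl⟩ ⟨u, hu, rfl | rfl⟩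
    · exact ⟨t * u, by rw [mul_pow, ht, hu, one_mul], .inl (map_mul _ _ _).symm⟩
    · exact ⟨t * u, by rw [mul_pow, ht, hu, one_mul], .inr (by rw [map_mul, mul_assoc])⟩
    · exact ⟨t * u ^ Fintype.card F, by rw [mul_pow, ht, pow_right_comm, hu, one_pow, one_mul],
        .inr (by rw [mul_assoc, conjSL_mul_toSL hq, map_mul, mul_assoc])⟩
    · exact ⟨t * u ^ Fintype.card F, by rw [mul_pow, ht, pow_right_comm, hu, one_pow, one_mul],
        .inl (by rw [mul_assoc, ← mul_assoc conjSL, conjSL_mul_toSL hq, mul_assoc _ conjSL,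
          conjSL_mul_self, mul_one, map_mul])⟩
  inv_mem' := by
    rintro _ ⟨t, ht, rfl | rfl⟩
    · exact ⟨t⁻¹, by rw [inv_pow, ht, inv_one], .inl (map_inv _ _).symm⟩
    · refine ⟨t⁻¹ ^ Fintype.card F, by rw [pow_right_comm, inv_pow, ht, inv_one, one_pow], .inr ?_⟩
      rw [← conjSL_mul_toSL hq, _root_.mul_inv_rev, map_inv,
        inv_eq_of_mul_eq_one_right conjSL_mul_self]

theorem two_mul_le_natCard_twistedTorus [Fintype F] (hq : Fintype.card F % 4 = 3)
    (h2 : (2 : F) ≠ 0) {e : ℕ} [NeZero e] (he : e ∣ Fintype.card F ^ 2 - 1) :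
    2 * e ≤ Nat.card (twistedTorus hq e) := by
  classical
  have := Fintype.ofFinite (GaussExt F)
  have hcard : Nat.card (rootsOfUnity e (GaussExt F)) = e := by
    rw [← natCard_units] at he
    obtain ⟨g, hg⟩ := IsCyclic.exists_ofOrder_eq_natCard (α := (GaussExt F)ˣ)
    obtain ⟨d, hd⟩ := he
    have hd0 : d ≠ 0 := by
      rintro rfl
      exact Nat.card_pos.ne' (hd.trans (mul_zero e))
    have ho : orderOf (g ^ d) = e := by
      rw [orderOf_pow_of_dvd hd0 (by rw [hg, hd]; exact dvd_mul_left _ _), hg, hd,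
        Nat.mul_div_cancel _ (Nat.pos_of_ne_zero hd0)]
    have hp : IsPrimitiveRoot (g ^ d) e := ho ▸ IsPrimitiveRoot.orderOf _
    exact (IsPrimitiveRoot.coe_units_iff.mpr hp).card_rootsOfUnity
  let f : rootsOfUnity e (GaussExt F) × Bool → twistedTorus hq e := fun p ↦
    ⟨if p.2 then toSL p.1 * conjSL else toSL p.1, p.1, (mem_rootsOfUnity _ _).1 p.1.2, by
      cases p.2 <;> simp⟩
  have hf : Function.Injective f := by
    rintro ⟨t, b⟩ ⟨u, c⟩ h
    have h' := congrArg Subtype.val h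
    cases b <;> cases c <;>
      simp only [f, if_true, if_false, Bool.false_eq_true, mul_left_inj] at h'
    · exact Prod.ext (Subtype.ext (toSL_injective h')) rfl
    · exact absurd h' (toSL_ne_toSL_mul_conjSL h2 _ _)
    · exact absurd h'.symm (toSL_ne_toSL_mul_conjSL h2 _ _)
    · exact Prod.ext (Subtype.ext (toSL_injective h')) rfl
  have := Nat.card_le_card_of_injective f hf
  rw [Nat.card_prod, hcard] at this
  simpa [mul_comm] using this

theorem unit_pow_card_add_one [Fintype F] (hq : Fintype.card F % 4 = 3) (t : (GaussExt F)ˣ) :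
    ((t ^ (Fintype.card F + 1) : (GaussExt F)ˣ) : GaussExt F) =
      algebraMap F _ (QuadraticAlgebra.norm t.val) := by
  rw [Units.val_pow_eq_pow_val, pow_succ', pow_card_eq_star hq,
    QuadraticAlgebra.algebraMap_norm_eq_mul_star]

theorem isPGroup_twistedTorus [Fintype F] (hq : Fintype.card F % 4 = 3) (n : ℕ) :
    IsPGroup 2 (twistedTorus hq (2 ^ n)) := by
  rintro ⟨_, t, ht, rfl | rfl⟩
  · exact ⟨n, Subtype.ext (by simp [← map_pow, ht])⟩
  · refine ⟨n + 1, Subtype.ext ?_⟩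
    rw [pow_succ', pow_mul, SubmonoidClass.coe_pow, SubmonoidClass.coe_pow, toSL_mul_conjSL_sq hq,
      ← map_pow, pow_right_comm, ht, one_pow, map_one]
    rfl

theorem not_two_dvd_index_twistedTorus [Fintype F] (hq : Fintype.card F % 4 = 3) {a w : ℕ}
    (hw : Odd w) (haw : Fintype.card F + 1 = 2 ^ a * w) :
    ¬ 2 ∣ (twistedTorus hq (2 ^ (a + 1))).index := by
  obtain ⟨M, hM, hcard⟩ := exists_natCard_SL3_eq hq hw haw
  have hdvd : 2 ^ (a + 1) ∣ Fintype.card F ^ 2 - 1 := by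
    have : 2 ∣ Fintype.card F - 1 := by lia
    rw [← one_pow 2, Nat.sq_sub_sq, haw, pow_succ]
    exact mul_dvd_mul (dvd_mul_right _ _) this
  have hle := two_mul_le_natCard_twistedTorus hq (two_ne_zero_of_card hq) hdvd
  obtain ⟨j, hj⟩ := (isPGroup_twistedTorus hq (a + 1)).exists_card_eq
  have hmul := (twistedTorus hq (2 ^ (a + 1))).card_mul_index
  rw [hj, ← pow_succ'] at hle
  have hja := (Nat.pow_le_pow_iff_right one_lt_two).1 hle
  obtain ⟨d, rfl⟩ := Nat.exists_eq_add_of_le hja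
  rw [hj, hcard, pow_add, mul_assoc] at hmul
  have := Nat.eq_of_mul_eq_mul_left (by positivity) hmul
  intro h2
  exact hM.not_two_dvd_nat (this ▸ h2.mul_left _)

/-- A Sylow `2`-subgroup of `SL₃(F)`, where `2 ^ a` is the `2`-part of `|F| + 1`. -/
noncomputable def sylow [Fintype F] (hq : Fintype.card F % 4 = 3) {a w : ℕ}
    (hw : Odd w) (haw : Fintype.card F + 1 = 2 ^ a * w) :
    Sylow 2 (SpecialLinearGroup (Fin 3) F) :=
  (isPGroup_twistedTorus hq (a + 1)).toSylow (not_two_dvd_index_twistedTorus hq hw haw)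

theorem mem_sylow [Fintype F] (hq : Fintype.card F % 4 = 3) {a w : ℕ}
    (hw : Odd w) (haw : Fintype.card F + 1 = 2 ^ a * w) {g : SpecialLinearGroup (Fin 3) F} :
    g ∈ sylow hq hw haw ↔
      ∃ t : (GaussExt F)ˣ, t ^ 2 ^ (a + 1) = 1 ∧ (g = toSL t ∨ g = toSL t * conjSL) :=
  Iff.rfl

theorem coe_toSL_neg_one : (toSL (-1 : (GaussExt F)ˣ) : Matrix (Fin 3) (Fin 3) F) =
    !![-1, 0, 0; 0, -1, 0; 0, 0, 1] := by
  rw [coe_toSL]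
  ext i j
  fin_cases i <;> fin_cases j <;> simp <;> rfl

theorem exists_conj_of_norm_eq_one (h2 : (2 : F) ≠ 0) {t : (GaussExt F)ˣ}
    (ht : QuadraticAlgebra.norm t.val = 1) :
    ∃ (u : (GaussExt F)ˣ) (g : SpecialLinearGroup (Fin 3) F),
      toSL t * conjSL * g = g * toSL u := by
  have hn := ht
  rw [QuadraticAlgebra.norm_def] at hn
  refine ⟨-1, ?_⟩
  by_cases ha : t.val.re = -1
  · have hb : t.val.im = 0 := by simpa [ha] using hn
    refine exists_conj_of_mul_eq (coe_toSL _) coe_conjSL coe_toSL_neg_one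
      !![1, 0, 0; 0, 0, -1; 0, 1, 0] (by simp [det_fin_three]) ?_
    rw [ht, ha, hb]
    ext i j
    fin_cases i <;> fin_cases j <;> simp [Matrix.mul_apply, Fin.sum_univ_three]
  · obtain ⟨k, hk⟩ : ∃ k, k * (2 + 2 * t.val.re) = 1 := by
      refine ⟨_, inv_mul_cancel₀ fun h ↦ ha ?_⟩
      exact mul_left_cancel₀ h2 (by linear_combination h)
    refine exists_conj_of_mul_eq (coe_toSL _) coe_conjSL coe_toSL_neg_one
      !![-t.val.im, 0, k * (1 + t.val.re); 1 + t.val.re, 0, k * t.val.im; 0, 1, 0] ?_ ?_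
    · simp only [det_fin_three, of_apply, cons_val', cons_val_zero, cons_val_one, cons_val]
      linear_combination hk + k * hn
    · rw [ht]
      ext i j
      fin_cases i <;> fin_cases j <;> simp [Matrix.mul_apply, Fin.sum_univ_three] <;>
        first | ring1 | linear_combination hn | linear_combination -hn | linear_combination k * hn

theorem exists_conj_of_norm_eq_neg_one {t : (GaussExt F)ˣ}
    (ht : QuadraticAlgebra.norm t.val = -1) :
    ∃ (u : (GaussExt F)ˣ) (g : SpecialLinearGroup (Fin 3) F),
      toSL t * conjSL * g = g * toSL u := by
  have hn := ht
  rw [QuadraticAlgebra.norm_def] at hn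
  have hb : t.val.im ≠ 0 := by
    intro hb
    apply Fact.out (p := ∀ r : F, r ^ 2 ≠ -1 + 0 * r) t.val.re
    simp [hb] at hn
    linear_combination hn
  refine ⟨⟨⟨0, 1⟩, ⟨0, -1⟩, by ext <;> simp <;> rfl, by ext <;> simp <;> rfl⟩, ?_⟩
  refine exists_conj_of_mul_eq (coe_toSL _) coe_conjSL (coe_toSL _)
    !![1, t.val.re, 0; 0, t.val.im, 0; 0, 0, t.val.im⁻¹]
    (by simp [det_fin_three, hb]) ?_
  rw [ht]
  ext i j
  fin_cases i <;> fin_cases j <;>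
    simp [Matrix.mul_apply, Fin.sum_univ_three, QuadraticAlgebra.norm_def] <;>
    first | ring1 | linear_combination hn

theorem card_add_one_eq_two_pow_of_toSL [Fintype F] (hq : Fintype.card F % 4 = 3)
    {t : (GaussExt F)ˣ}
    (ht : ∃! P : Sylow 2 (SpecialLinearGroup (Fin 3) F), toSL t ∈ P) :
    ∃ m, Fintype.card F + 1 = 2 ^ m := by
  obtain ⟨P, hP, huniq⟩ := ht
  have hconj : conjSL ∈ P := by
    have hmem : conjSL ∈ Subgroup.normalizer (P : Set (SpecialLinearGroup (Fin 3) F)) := by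
      refine Sylow.mem_normalizer_of_conj_mem huniq ?_
      rw [conjSL_mul_toSL hq, mul_inv_cancel_right, map_pow]
      exact pow_mem hP _
    have hpg : IsPGroup 2 (Subgroup.zpowers (conjSL : SpecialLinearGroup (Fin 3) F)) := by
      rintro ⟨_, k, rfl⟩
      refine ⟨1, Subtype.ext ?_⟩
      change (conjSL ^ k) ^ 2 ^ 1 = 1
      rw [pow_one, ← zpow_natCast, zpow_comm, zpow_natCast, pow_two, conjSL_mul_self,
        _root_.one_zpow]
    have h := hpg.inf_normalizer_sylow P
    exact (h.le ⟨Subgroup.mem_zpowers _, hmem⟩).2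
  obtain ⟨v, hv⟩ := IsCyclic.exists_ofOrder_eq_natCard (α := (GaussExt F)ˣ)
  have hvP : toSL v ∈ Subgroup.normalizer (P : Set (SpecialLinearGroup (Fin 3) F)) := by
    refine Sylow.mem_normalizer_of_conj_mem huniq ?_
    rw [← map_mul, mul_comm v t, map_mul, mul_inv_cancel_right]
    exact hP
  have hmem : conjSL * toSL v * conjSL * (toSL v)⁻¹ ∈ P := by
    rw [mul_assoc, mul_assoc]
    refine mul_mem hconj ?_
    rw [← mul_assoc]
    exact (Subgroup.mem_normalizer_iff.1 hvP _).1 hconj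
  rw [conjSL_mul_toSL hq, mul_assoc (toSL _), conjSL_mul_self, mul_one, ← map_inv, ← map_mul]
    at hmem
  obtain ⟨k, hk⟩ := P.isPGroup' ⟨_, hmem⟩
  have hk' := toSL_injective ((map_pow toSL _ _).trans ((congrArg Subtype.val hk).trans
    (map_one toSL).symm))
  have hq1 : v ^ Fintype.card F * v⁻¹ = v ^ (Fintype.card F - 1) := by
    rw [mul_inv_eq_iff_eq_mul, ← pow_succ, Nat.sub_add_cancel Fintype.card_pos]
  rw [hq1, ← pow_mul] at hk'
  have hdvd := orderOf_dvd_of_pow_eq_one hk'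
  rw [hv, natCard_units, show Fintype.card F ^ 2 - 1 = Fintype.card F ^ 2 - 1 ^ 2 by rw [one_pow],
    Nat.sq_sub_sq, mul_comm, Nat.mul_dvd_mul_iff_left (by lia)] at hdvd
  obtain ⟨m, -, hm⟩ := (Nat.dvd_prime_pow Nat.prime_two).1 hdvd
  exact ⟨m, hm⟩

theorem norm_eq_one_or_neg_one [Fintype F] (hq : Fintype.card F % 4 = 3) {t : (GaussExt F)ˣ}
    (ht : t ^ (2 * (Fintype.card F + 1)) = 1) :
    QuadraticAlgebra.norm t.val = 1 ∨ QuadraticAlgebra.norm t.val = -1 := by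
  rw [mul_comm, pow_mul] at ht
  have h := congrArg Units.val ht
  rw [Units.val_pow_eq_pow_val, unit_pow_card_add_one hq, ← map_pow, Units.val_one] at h
  exact sq_eq_one_iff.1 <|
    (algebraMap F (GaussExt F)).injective (h.trans (map_one _).symm)

theorem card_add_one_eq_two_pow [Fintype F] (hq : Fintype.card F % 4 = 3)
    {x : SpecialLinearGroup (Fin 3) F}
    (hx : ∃! P : Sylow 2 (SpecialLinearGroup (Fin 3) F), x ∈ P) :
    ∃ m, Fintype.card F + 1 = 2 ^ m := by
  obtain ⟨a, w, hw, haw⟩ := Nat.exists_eq_two_pow_mul_odd (n := Fintype.card F + 1) (by lia)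
  obtain ⟨P, hP, -⟩ := id hx
  obtain ⟨g, rfl⟩ := MulAction.exists_smul_eq (SpecialLinearGroup (Fin 3) F) (sylow hq hw haw) P
  obtain ⟨t, ht, h⟩ := (mem_sylow hq hw haw).1 (Sylow.mem_smul_iff_conj_mem.1 hP)
  have hx' := Sylow.existsUnique_mem_of_conj (y := g⁻¹ * x * g) (g := g) (by group) hx
  rcases h with h | h
  · exact card_add_one_eq_two_pow_of_toSL hq (h ▸ hx')
  · have hn : QuadraticAlgebra.norm t.val = 1 ∨ QuadraticAlgebra.norm t.val = -1 := by
      apply norm_eq_one_or_neg_one hq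
      rw [haw, ← mul_assoc, ← pow_succ', pow_mul, ht, one_pow]
    rw [h] at hx'
    obtain ⟨u, y, hy⟩ := hn.elim (exists_conj_of_norm_eq_one (two_ne_zero_of_card hq))
      exists_conj_of_norm_eq_neg_one
    exact card_add_one_eq_two_pow_of_toSL hq (Sylow.existsUnique_mem_of_conj hy hx')

theorem trace_eq_of_mul_eq {n R : Type*} [Fintype n] [DecidableEq n] [CommRing R]
    {x y g : SpecialLinearGroup n R} (h : x * g = g * y) :
    (x : Matrix n n R).trace = (y : Matrix n n R).trace := by
  have h₁ : g.val * g⁻¹.val = 1 := congrArg Subtype.val (mul_inv_cancel g)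
  have h₂ : g⁻¹.val * g.val = 1 := congrArg Subtype.val (inv_mul_cancel g)
  have h₃ : x.val * g.val = g.val * y.val := congrArg Subtype.val h
  rw [← mul_one x.val, ← h₁, ← mul_assoc, h₃, Matrix.trace_mul_comm, ← mul_assoc, h₂, one_mul]

theorem eq_zero_and_eq_zero_of_mul_eq {a b x y : F} (hb : b ≠ 0) (h₁ : b * x = a * y)
    (h₂ : b * y = -(a * x)) : x = 0 ∧ y = 0 := by
  have hy : y = 0 := by
    by_contra hy
    apply Fact.out (p := ∀ r : F, r ^ 2 ≠ -1 + 0 * r) (a / b)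
    field_simp
    apply mul_right_cancel₀ hy
    linear_combination b * h₂ - a * h₁
  subst hy
  simpa [hb] using h₁

/-- Elements commuting with a non-scalar element of the torus of norm `-1` lie in the torus. -/
theorem mem_range_toSL_of_commute {γ : (GaussExt F)ˣ} (hγ : QuadraticAlgebra.norm γ.val = -1)
    {g : SpecialLinearGroup (Fin 3) F} (h : toSL γ * g = g * toSL γ) : ∃ u, g = toSL u := by
  have hn := hγ
  rw [QuadraticAlgebra.norm_def] at hn
  have hb : γ.val.im ≠ 0 := by
    intro hb
    apply Fact.out (p := ∀ r : F, r ^ 2 ≠ -1 + 0 * r) γ.val.re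
    simp [hb] at hn
    linear_combination hn
  have e (i j : Fin 3) := congrArg (fun g : SpecialLinearGroup (Fin 3) F ↦ g i j) h
  have h00 := e 0 0
  have h01 := e 0 1
  have h02 := e 0 2
  have h12 := e 1 2
  have h20 := e 2 0
  have h21 := e 2 1
  simp [coe_toSL, Matrix.mul_apply, Fin.sum_univ_three, hγ] at h00 h01 h02 h12 h20 h21
  have g10 : g 1 0 = -g 0 1 := mul_left_cancel₀ hb (by linear_combination -h00)
  have g11 : g 1 1 = g 0 0 := mul_left_cancel₀ hb (by linear_combination -h01)
  obtain ⟨g12, g02⟩ := eq_zero_and_eq_zero_of_mul_eq (a := γ.val.re + 1) (x := g 1 2) (y := g 0 2)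
    hb (by linear_combination -h02) (by linear_combination h12)
  obtain ⟨g20, g21⟩ := eq_zero_and_eq_zero_of_mul_eq (a := γ.val.re + 1) (x := g 2 0) (y := g 2 1)
    hb (by linear_combination h21) (by linear_combination -h20)
  have hdet := g.2
  rw [det_fin_three] at hdet
  simp only [g10, g11, g12, g02, g20, g21] at hdet
  have hnorm : QuadraticAlgebra.norm (⟨g 0 0, -g 0 1⟩ : GaussExt F) * g 2 2 = 1 := by
    rw [QuadraticAlgebra.norm_def]
    linear_combination hdet
  have hu : (⟨g 0 0, -g 0 1⟩ : GaussExt F) ≠ 0 := by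
    intro h0
    rw [h0, QuadraticAlgebra.norm_zero, zero_mul] at hnorm
    exact zero_ne_one hnorm
  refine ⟨Units.mk0 _ hu, ?_⟩
  ext i j
  fin_cases i <;> fin_cases j <;>
    simp [coe_toSL, g10, g11, g12, g02, g20, g21, eq_inv_of_mul_eq_one_right hnorm]

theorem existsUnique_sylow [Fintype F] (hq : Fintype.card F % 4 = 3) {m : ℕ}
    (hm : Fintype.card F + 1 = 2 ^ m) :
    ∃ γ : (GaussExt F)ˣ, orderOf (toSL γ) = 2 ^ (m + 1) ∧
      ∃! P : Sylow 2 (SpecialLinearGroup (Fin 3) F), toSL γ ∈ P := by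
  have hm2 : 2 ≤ m := by
    by_contra! h
    interval_cases m <;> lia
  have hm' : Fintype.card F + 1 = 2 ^ m * 1 := by rw [mul_one, hm]
  have hdvd : 2 ^ (m + 1) ∣ Nat.card (GaussExt F)ˣ := by
    rw [natCard_units, ← one_pow 2, Nat.sq_sub_sq, hm, pow_succ]
    exact mul_dvd_mul_left _ (by lia)
  obtain ⟨γ, hγ⟩ : ∃ γ : (GaussExt F)ˣ, orderOf γ = 2 ^ (m + 1) := by
    obtain ⟨v, hv⟩ := IsCyclic.exists_ofOrder_eq_natCard (α := (GaussExt F)ˣ)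
    rw [← hv] at hdvd
    exact ⟨_, orderOf_pow_orderOf_div (orderOf_pos v).ne' hdvd⟩
  have norm_eq {t : (GaussExt F)ˣ} (ht : orderOf t = 2 ^ (m + 1)) :
      QuadraticAlgebra.norm t.val = -1 := by
    refine (norm_eq_one_or_neg_one hq ?_).resolve_left fun h ↦ ?_
    · rw [hm, ← pow_succ', ← ht, pow_orderOf_eq_one]
    · have h1 := unit_pow_card_add_one hq t
      rw [h, map_one, hm] at h1
      have h2 := orderOf_dvd_of_pow_eq_one (Units.ext h1)
      rw [ht, Nat.pow_dvd_pow_iff_le_right (by norm_num)] at h2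
      lia
  have hord : orderOf (toSL γ) = 2 ^ (m + 1) := by rw [orderOf_injective _ toSL_injective, hγ]
  have hγS : toSL γ ∈ sylow hq odd_one hm' :=
    ⟨γ, by rw [← hγ, pow_orderOf_eq_one], .inl rfl⟩
  have hcS : conjSL ∈ sylow hq odd_one hm' :=
    ⟨1, one_pow _, .inr (by rw [map_one, one_mul])⟩
  have hfix (g : SpecialLinearGroup (Fin 3) F) (hg : toSL γ * g = g * toSL γ) :
      g • sylow hq odd_one hm' = sylow hq odd_one hm' := by
    obtain ⟨u, rfl⟩ := mem_range_toSL_of_commute (norm_eq hγ) hg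
    refine Sylow.ext ((sylow hq odd_one hm').is_maximal' (toSL u • sylow hq odd_one hm').isPGroup'
      ?_)
    rintro _ ⟨t, ht, rfl | rfl⟩
    · refine Sylow.mem_smul_iff_conj_mem.2 ⟨t, ht, .inl ?_⟩
      rw [mul_assoc, ← map_mul, mul_comm t u, map_mul, inv_mul_cancel_left]
    · refine Sylow.mem_smul_iff_conj_mem.2 ⟨u⁻¹ * t * u ^ Fintype.card F, ?_, .inr ?_⟩
      · have hu : u ^ Fintype.card F = u * u ^ (Fintype.card F - 1) := by
          rw [← pow_succ', Nat.sub_add_cancel Fintype.card_pos]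
        rw [hu, show u⁻¹ * t * (u * u ^ (Fintype.card F - 1)) = t * u ^ (Fintype.card F - 1) by
          rw [mul_comm u⁻¹ t, mul_assoc, inv_mul_cancel_left], mul_pow, ht, one_mul, ← pow_mul,
          pow_succ, ← hm, ← mul_assoc, mul_comm (Fintype.card F - 1), ← Nat.sq_sub_sq, one_pow,
          ← natCard_units, pow_mul, pow_card_eq_one', one_pow]
      · simp only [mul_assoc, map_mul, map_inv]
        rw [conjSL_mul_toSL hq]
  refine ⟨γ, hord, sylow hq odd_one hm', hγS, fun P hP ↦ ?_⟩
  obtain ⟨g, rfl⟩ := MulAction.exists_smul_eq (SpecialLinearGroup (Fin 3) F)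
    (sylow hq odd_one hm') P
  obtain ⟨t, ht, h⟩ := (mem_sylow hq odd_one hm').1 (Sylow.mem_smul_iff_conj_mem.1 hP)
  have hconj : orderOf (g⁻¹ * toSL γ * g) = 2 ^ (m + 1) := by
    rw [← hord]
    simpa using orderOf_injective (MulAut.conj g⁻¹).toMonoidHom (MulAut.conj g⁻¹).injective (toSL γ)
  have hcomm : toSL γ * g = g * (g⁻¹ * toSL γ * g) := by group
  rcases h with h | h
  · rw [h] at hcomm hconj
    rw [orderOf_injective _ toSL_injective] at hconj
    have htr := trace_eq_of_mul_eq hcomm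
    have hn1 := norm_eq hγ
    have hn2 := norm_eq hconj
    have hre : t.val.re = γ.val.re := by
      simp [Matrix.trace_fin_three, coe_toSL, hn1, hn2] at htr
      exact mul_left_cancel₀ (two_ne_zero_of_card hq) (by linear_combination -htr)
    have him : t.val.im = γ.val.im ∨ t.val.im = -γ.val.im := by
      rw [QuadraticAlgebra.norm_def] at hn1 hn2
      rw [hre] at hn2
      exact sq_eq_sq_iff_eq_or_eq_neg.1 (by linear_combination hn2 - hn1)
    rcases him with him | him
    · have : t = γ := Units.ext (QuadraticAlgebra.ext hre him)
      exact hfix g (this ▸ hcomm)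
    · have : t = γ ^ Fintype.card F := by
        ext <;> simp [pow_card_eq_star hq, hre, him]
      have h' : (g * conjSL) • sylow hq odd_one hm' = sylow hq odd_one hm' := by
        apply hfix
        rw [← mul_assoc, hcomm, this, mul_assoc, ← conjSL_mul_toSL hq, mul_assoc]
      rwa [mul_smul, Sylow.smul_eq_iff_mem_normalizer.2 (Subgroup.le_normalizer hcS)] at h'
  · have h4 : (g⁻¹ * toSL γ * g) ^ 4 = 1 := by
      rw [h, show 4 = 2 * 2 from rfl, pow_mul, toSL_mul_conjSL_sq hq, ← map_pow, ← pow_mul, hm,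
        ← pow_succ, ht, map_one]
    have := Nat.le_of_dvd (by norm_num) (orderOf_dvd_of_pow_eq_one h4)
    rw [hconj] at this
    have h8 : 2 ^ 3 ≤ 2 ^ (m + 1) := Nat.pow_le_pow_right (by norm_num) (by lia)
    lia

end GaussExt

theorem Nat.prime_of_isPrimePow_of_add_one_eq_two_pow {q m : ℕ} (hq : IsPrimePow q)
    (hq4 : q % 4 = 3) (hm : q + 1 = 2 ^ m) : q.Prime := by
  obtain ⟨p, k, hp, hk, rfl⟩ := (isPrimePow_nat_iff q).1 hq
  have hpo : Odd p := by
    rw [← Nat.odd_pow_iff hk.ne', Nat.odd_iff]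
    lia
  have hko : Odd k := by
    by_contra h
    obtain ⟨j, rfl⟩ := Nat.not_odd_iff_even.1 h
    obtain ⟨r, hr⟩ := hpo.pow (n := j)
    have : p ^ (j + j) = 4 * (r * r + r) + 1 := by rw [pow_add, hr]; ring
    lia
  -- the cofactor of `p + 1` in `p ^ k + 1` is odd, hence trivial
  obtain ⟨j, rfl⟩ := hko
  obtain ⟨X, hX⟩ : p ^ 2 - 1 ∣ (p ^ 2) ^ j - 1 := by simpa using Nat.sub_dvd_pow_sub_pow (p ^ 2) 1 j
  obtain ⟨P, rfl⟩ : ∃ P, p = P + 1 := ⟨p - 1, by have := hp.pos; lia⟩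
  have h1 : (P + 1) ^ 2 - 1 = P * (P + 2) := by
    rw [Nat.sub_eq_iff_eq_add (Nat.one_le_pow _ _ (by lia))]; ring
  have h2 : ((P + 1) ^ 2) ^ j = P * (P + 2) * X + 1 := by
    rw [← h1, ← hX, Nat.sub_add_cancel (Nat.one_le_pow _ _ (by positivity))]
  have hfac : (P + 2) * ((P + 1) * P * X + 1) = 2 ^ m := by
    rw [← hm, pow_succ, pow_mul, h2]; ring
  obtain ⟨i, -, hi⟩ := (Nat.dvd_prime_pow Nat.prime_two).1 (Dvd.intro_left _ hfac)
  have hP : Even P := by rw [Nat.odd_add_one, Nat.not_odd_iff_even] at hpo; exact hpo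
  have hodd : Odd ((P + 1) * P * X + 1) := ((hP.mul_left _).mul_right _).add_one
  have hi0 : i = 0 := by
    by_contra h
    rw [hi, Nat.odd_pow_iff h] at hodd
    exact absurd hodd (by decide)
  have hX0 : X = 0 := by
    have : 0 < P := by have := hp.two_le; lia
    rw [hi0, pow_zero] at hi
    simpa [this.ne'] using hi
  rw [hX0, mul_zero, zero_add, ← pow_mul] at h2
  rwa [pow_succ, h2, one_mul]

/-- For `q ≡ 3 (mod 4)` an odd prime power, `SL_3(𝔽_q)` contains a picky `2`-element
if and only if `q` is a Fermat or Mersenne prime, or `q = 9`. -/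
theorem picky_two_element_SL3_iff
    (q : ℕ) (hq : IsPrimePow q) (hodd : Odd q) (hq4 : q % 4 = 3)
    (F : Type*) [Field F] [Fintype F] [DecidableEq F] (hF : Fintype.card F = q) :
    (∃ x : Matrix.SpecialLinearGroup (Fin 3) F,
        (∃ k : ℕ, orderOf x = 2 ^ k) ∧
          ∃! P : Sylow 2 (Matrix.SpecialLinearGroup (Fin 3) F), x ∈ P) ↔
      (IsFermatPrime q ∨ IsMersennePrime q ∨ q = 9) := by
  have : Fact (∀ r : F, r ^ 2 ≠ -1 + 0 * r) := by
    refine ⟨fun r hr ↦ FiniteField.isSquare_neg_one_iff.1 ⟨r, ?_⟩ (hF ▸ hq4)⟩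
    linear_combination -hr
  constructor
  · rintro ⟨x, -, hx⟩
    obtain ⟨m, hm⟩ := GaussExt.card_add_one_eq_two_pow (hF ▸ hq4) hx
    rw [hF] at hm
    exact .inr <| .inl
      ⟨Nat.prime_of_isPrimePow_of_add_one_eq_two_pow hq hq4 hm, m, Nat.eq_sub_of_add_eq hm⟩
  · intro h
    obtain ⟨m, hm⟩ : ∃ m, q + 1 = 2 ^ m := by
      obtain ⟨-, m, hm⟩ | ⟨-, m, hm⟩ | hq9 := h
      · match m with
        | 0 | 1 => exact ⟨2, by lia⟩
        | m + 2 => lia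
      · exact ⟨m, by rw [hm, Nat.sub_add_cancel Nat.one_le_two_pow]⟩
      · lia
    obtain ⟨γ, hγ, h⟩ := GaussExt.existsUnique_sylow (hF ▸ hq4) (hF.symm ▸ hm)
    exact ⟨GaussExt.toSL γ, ⟨m + 1, hγ⟩, h⟩
end
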